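/- Let μ(v) = (2π)^{−3/2} e^{−|v|²/2} be the Maxwellian corresponding to the normalization (N). Let m ≥ 9/2, let T ≥ 1, and let f be a smooth, rapidly decaying solution of the homogeneous Landau equation with Coulomb potential on [0,T] satisfying (N) for each t. Then there exists C depending only on m such that ‖f(T) − μ‖_{L^∞(ℝ³)} ≤ C (S⁴ + S^{4/7}), where S := sup_{T−1 < t < T} ‖f(t) − μ‖_{L²_m}. -/

import Mathlib

open MeasureTheory Real
noncomputable section

/-- Velocity space `ℝ³`. -/
abbrev V3 : Type := EuclideanSpace ℝ (Fin 3)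

/-- Japanese bracket `⟨v⟩ = (1 + |v|²)^{1/2}`. -/
def jap (v : V3) : ℝ := Real.sqrt (1 + ‖v‖ ^ 2)

/-- Positive part `x₊ = max(x,0)`. -/
def plus (x : ℝ) : ℝ := max x 0

/-- Partial derivative in the `i`-th coordinate direction. -/
def pd (i : Fin 3) (F : V3 → ℝ) (v : V3) : ℝ :=
  fderiv ℝ F v (EuclideanSpace.single i 1)

/-- The Landau-Coulomb diffusion matrix `A[g]`. -/
def Amat (g : V3 → ℝ) (v : V3) : Matrix (Fin 3) (Fin 3) ℝ := fun i j =>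
  ∫ w : V3, g w * (((if i = j then (1 : ℝ) else 0) -
      (v - w) i * (v - w) j / ‖v - w‖ ^ 2) / (8 * π * ‖v - w‖))

/-- The Coulomb potential `a[g]`. -/
def apot (g : V3 → ℝ) (v : V3) : ℝ := ∫ w : V3, g w / (4 * π * ‖v - w‖)

/-- Right-hand side `∇·(A[g]∇g − ∇a[g] g)` of the Landau equation. -/
def landauRHS (g : V3 → ℝ) (v : V3) : ℝ :=
  ∑ i : Fin 3, pd i (fun u =>
    (∑ j : Fin 3, Amat g u i j * pd j g u) - pd i (apot g) u * g u) v

/-- `f` solves the Landau equation pointwise at every time in `s`. -/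
def SolvesLandauOn (s : Set ℝ) (f : ℝ → V3 → ℝ) : Prop :=
  ∀ t ∈ s, ∀ v : V3, HasDerivAt (fun τ => f τ v) (landauRHS (f t) v) t

/-- A smooth, rapidly decaying (Schwartz-class in `v`) nonnegative solution on the
time set `s`, solving the equation pointwise on the interior of `s`. -/
structure SmoothRapidSolutionOn (s : Set ℝ) (f : ℝ → V3 → ℝ) : Prop where
  nonneg : ∀ t ∈ s, ∀ v : V3, 0 ≤ f t v
  smooth : ContDiffOn ℝ (⊤ : ℕ∞) (fun q : ℝ × V3 => f q.1 q.2) (s ×ˢ (Set.univ : Set V3))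
  schwartz : ∀ t ∈ s, ∃ φ : SchwartzMap V3 ℝ, ∀ v, f t v = φ v
  solves : SolvesLandauOn (interior s) f

/-- Normalization: unit mass, zero mean velocity, temperature `3`. -/
def Normalized (g : V3 → ℝ) : Prop :=
  (∫ v : V3, g v) = 1 ∧ (∀ i : Fin 3, (∫ v : V3, v i * g v) = 0) ∧
    (∫ v : V3, ‖v‖ ^ 2 * g v) = 3

/-- `c • Id ≤ M` as quadratic forms. -/
def matGE (c : ℝ) (M : Matrix (Fin 3) (Fin 3) ℝ) : Prop :=
  ∀ ξ : Fin 3 → ℝ, c * ∑ i, ξ i ^ 2 ≤ ∑ i, ∑ j, M i j * ξ i * ξ j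

/-- `M ≤ c • Id` as quadratic forms. -/
def matLE (M : Matrix (Fin 3) (Fin 3) ℝ) (c : ℝ) : Prop :=
  ∀ ξ : Fin 3 → ℝ, (∑ i, ∑ j, M i j * ξ i * ξ j) ≤ c * ∑ i, ξ i ^ 2

/-- `‖A[g]‖_{L^∞}`: sup over `v` of the operator norm of `A[g](v)`. -/
def AinfNorm (g : V3 → ℝ) : ℝ :=
  ⨆ v : V3, ‖Matrix.toEuclideanCLM (𝕜 := ℝ) (Amat g v)‖

/-- Fisher information (with the convention `x/0 = 0`). -/
def fisher (g : V3 → ℝ) : ℝ := ∫ v : V3, ‖gradient g v‖ ^ 2 / g v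

/-- The Maxwellian with unit mass, zero mean velocity and temperature `3`. -/
def maxwellian (v : V3) : ℝ := (2 * π) ^ (-(3 : ℝ) / 2) * Real.exp (-‖v‖ ^ 2 / 2)

namespace LL

/-- Coordinate map attached to an orthonormal basis. -/
def Pm (b : OrthonormalBasis (Fin 3) ℝ V3) (x : ℝ × (ℝ × ℝ)) : V3 :=
  x.1 • b 2 + (x.2.1 • b 0 + x.2.2 • b 1)

/-- horizontal shift -/
def Jm (b : OrthonormalBasis (Fin 3) ℝ V3) (u : ℝ × ℝ) : V3 := u.1 • b 0 + u.2 • b 1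

lemma Pm_continuous (b) : Continuous (Pm b) := by unfold Pm; fun_prop
lemma Jm_continuous (b) : Continuous (Jm b) := by unfold Jm; fun_prop

lemma Pm_mp (b : OrthonormalBasis (Fin 3) ℝ V3) :
    MeasurePreserving (Pm b) (volume : Measure (ℝ × (ℝ × ℝ))) (volume : Measure V3) := by
  have h1 := (volume_preserving_piFinSuccAbove (fun _ : Fin 3 => ℝ) 2).symm
  have h2 := ((MeasurePreserving.id (volume : Measure ℝ)).prod
    (volume_preserving_finTwoArrow ℝ).symm)
  have h3 := b.measurePreserving_repr_symm.comp ((PiLp.volume_preserving_toLp (Fin 3)).comp (h1.comp h2))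
  have h4 : Pm b = (b.repr.symm ∘ WithLp.toLp 2 ∘
        (MeasurableEquiv.piFinSuccAbove (fun _ : Fin 3 => ℝ) 2).symm ∘
          Prod.map id (MeasurableEquiv.finTwoArrow (α := ℝ)).symm) := by
    funext x
    simp only [Function.comp, Pm]
    rw [← b.sum_repr_symm, Fin.sum_univ_three]
    have e0 : (WithLp.toLp 2 ((MeasurableEquiv.piFinSuccAbove (fun _ : Fin 3 => ℝ) 2).symm
      (Prod.map id (MeasurableEquiv.finTwoArrow (α := ℝ)).symm x)) : V3) 0 = x.2.1 := rfl
    have e1 : (WithLp.toLp 2 ((MeasurableEquiv.piFinSuccAbove (fun _ : Fin 3 => ℝ) 2).symm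
      (Prod.map id (MeasurableEquiv.finTwoArrow (α := ℝ)).symm x)) : V3) 1 = x.2.2 := rfl
    have e2 : (WithLp.toLp 2 ((MeasurableEquiv.piFinSuccAbove (fun _ : Fin 3 => ℝ) 2).symm
      (Prod.map id (MeasurableEquiv.finTwoArrow (α := ℝ)).symm x)) : V3) 2 = x.1 := rfl
    rw [e0, e1, e2]
    abel
  rw [h4]
  exact h3

lemma exists_basis (e : V3) (he : ‖e‖ = 1) : ∃ b : OrthonormalBasis (Fin 3) ℝ V3, b 2 = e := by
  obtain ⟨b, hb⟩ := Orthonormal.exists_orthonormalBasis_extension_of_card_eq (𝕜 := ℝ) (E := V3)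
    (ι := Fin 3) (by simp) (v := fun _ => e) (s := {2}) (by
      rw [orthonormal_iff_ite]
      rintro ⟨i, hi⟩ ⟨j, hj⟩
      simp only [Set.mem_singleton_iff] at hi hj
      subst hi hj
      simp [he])
  exact ⟨b, hb 2 rfl⟩

/-- one-dimensional fundamental estimate -/
lemma oned {φ φ' : ℝ → ℝ} (h : ∀ s, HasDerivAt φ (φ' s) s) (hc : Continuous φ') {τ : ℝ} (hτ : 0 ≤ τ) :
    ENNReal.ofReal ((φ τ - φ 0) ^ 2) ≤
      ENNReal.ofReal τ * ∫⁻ s in Set.Icc 0 τ, ENNReal.ofReal ((φ' s) ^ 2) := by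
  have h1 : ∫ s in (0:ℝ)..τ, φ' s = φ τ - φ 0 :=
    intervalIntegral.integral_eq_sub_of_hasDerivAt (fun x _ => h x) (hc.intervalIntegrable _ _)
  have h2 : (φ τ - φ 0) ^ 2 ≤ τ * ∫ s in (0:ℝ)..τ, φ' s ^ 2 := by
    rcases hτ.eq_or_lt with h0 | h0
    · simp [← h0]
    · set m := (φ τ - φ 0) / τ
      have h3 : 0 ≤ ∫ s in (0:ℝ)..τ, (φ' s - m) ^ 2 :=
        intervalIntegral.integral_nonneg hτ (fun u _ => sq_nonneg _)
      have h4 : ∫ s in (0:ℝ)..τ, (φ' s - m) ^ 2 =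
          (∫ s in (0:ℝ)..τ, φ' s ^ 2) - 2 * m * (φ τ - φ 0) + m ^ 2 * τ := by
        have : (fun s => (φ' s - m) ^ 2) = fun s => φ' s ^ 2 - 2 * m * φ' s + m ^ 2 := by
          funext s; ring
        rw [this, intervalIntegral.integral_add, intervalIntegral.integral_sub,
          intervalIntegral.integral_const_mul, h1]
        · simp; ring
        all_goals exact Continuous.intervalIntegrable (by fun_prop) _ _
      have h5 : φ τ - φ 0 = m * τ := by simp only [m]; field_simp
      rw [h4, h5] at h3
      rw [h5]
      nlinarith
  rw [intervalIntegral.integral_of_le hτ, ← integral_Icc_eq_integral_Ioc] at h2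
  rw [← ofReal_integral_eq_lintegral_ofReal, ← ENNReal.ofReal_mul hτ]
  · exact ENNReal.ofReal_le_ofReal h2
  · exact (Continuous.integrableOn_Icc (by fun_prop))
  · exact Filter.Eventually.of_forall (fun _ => sq_nonneg _)

end LL

namespace LL
open scoped ENNReal

lemma setl_shift (F : V3 → ℝ≥0∞) {A B : Set V3} (hA : MeasurableSet A) (hB : MeasurableSet B)
    (x : V3) (h : ∀ p ∈ A, p + x ∈ B) : ∫⁻ p in A, F (p + x) ≤ ∫⁻ q in B, F q := by
  rw [← lintegral_indicator hA, ← lintegral_indicator hB,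
    ← lintegral_add_right_eq_self (B.indicator F) x]
  refine lintegral_mono (fun p => ?_)
  by_cases hp : p ∈ A
  · simp [hp, h p hp]
  · simp [hp]

lemma shift_est {U : V3 → ℝ} {G : V3 → V3} (hU : ∀ x, HasFDerivAt U (innerSL ℝ (G x)) x)
    (hG : Continuous G) {A B : Set V3} (hA : MeasurableSet A) (hB : MeasurableSet B)
    (x : V3) (h : ∀ p ∈ A, ∀ s ∈ Set.Icc (0:ℝ) 1, p + s • x ∈ B) :
    ∫⁻ p in A, ENNReal.ofReal ((U (p + x) - U p) ^ 2) ≤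
      ∫⁻ q in B, ENNReal.ofReal ((inner ℝ (G q) x) ^ 2) := by
  have h1 : ∀ p, ENNReal.ofReal ((U (p + x) - U p) ^ 2) ≤
      ∫⁻ s in Set.Icc (0:ℝ) 1, ENNReal.ofReal ((inner ℝ (G (p + s • x)) x) ^ 2) := by
    intro p
    have := oned (φ := fun s => U (p + s • x)) (φ' := fun s => inner ℝ (G (p + s • x)) x)
      (fun s => by
        have h2 : HasDerivAt (fun s : ℝ => p + s • x) x s := by
          simpa using ((hasDerivAt_id s).smul_const x).const_add p
        have := (hU (p + s • x)).comp_hasDerivAt s h2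
        exact this) (by fun_prop) zero_le_one
    simpa using this
  calc _ ≤ ∫⁻ p in A, ∫⁻ s in Set.Icc (0:ℝ) 1, ENNReal.ofReal ((inner ℝ (G (p + s • x)) x) ^ 2) :=
        lintegral_mono (fun p => h1 p)
    _ = ∫⁻ s in Set.Icc (0:ℝ) 1, ∫⁻ p in A, ENNReal.ofReal ((inner ℝ (G (p + s • x)) x) ^ 2) := by
        refine lintegral_lintegral_swap (Measurable.aemeasurable ?_)
        apply Measurable.ennreal_ofReal
        exact Continuous.measurable (by fun_prop)
    _ ≤ ∫⁻ s in Set.Icc (0:ℝ) 1, ∫⁻ q in B, ENNReal.ofReal ((inner ℝ (G q) x) ^ 2) := by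
        refine setLIntegral_mono' measurableSet_Icc (fun s hs => ?_)
        exact setl_shift (fun q => ENNReal.ofReal ((inner ℝ (G q) x) ^ 2)) hA hB (s • x)
          (fun p hp => h p hp s hs)
    _ = _ := by simp

/-- a mass argument: half of the measure has value zero. -/
lemma half_zero {α : Type*} [MeasurableSpace α] {μ : Measure α} {Om : Set α} (φ : α → ℝ) (a : ℝ) (v : ℝ≥0∞)
    (hv : v ≠ ∞) (h1 : μ Om = 2 * v) (N : Set α) (hN : MeasurableSet N) (h2 : μ (Om ∩ N) ≤ v)
    (h3 : ∀ x, φ x ≠ 0 → x ∈ N) :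
    ENNReal.ofReal (a ^ 2) * v ≤ ∫⁻ x in Om, ENNReal.ofReal ((φ x - a) ^ 2) ∂μ := by
  have h4 : v ≤ μ (Om \ N) := by
    have := measure_inter_add_sdiff (μ := μ) Om hN
    rw [h1, two_mul] at this
    by_contra hlt
    push Not at hlt
    have : μ (Om ∩ N) + μ (Om \ N) < v + v :=
      ENNReal.add_lt_add_of_le_of_lt (ne_top_of_le_ne_top hv h2) h2 hlt
    order
  calc ENNReal.ofReal (a ^ 2) * v ≤ ENNReal.ofReal (a ^ 2) * μ (Om \ N) := by gcongr
    _ = ENNReal.ofReal (a ^ 2) * (μ.restrict Om) Nᶜ := by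
        rw [Measure.restrict_apply hN.compl, Set.inter_comm, Set.sdiff_eq]
    _ = ∫⁻ x in Nᶜ, ENNReal.ofReal (a ^ 2) ∂(μ.restrict Om) := by simp
    _ ≤ ∫⁻ x in Nᶜ, ENNReal.ofReal ((φ x - a) ^ 2) ∂(μ.restrict Om) := by
        refine setLIntegral_mono' hN.compl (fun x hx => ?_)
        have : φ x = 0 := by
          by_contra h
          exact hx (h3 x h)
        rw [this]; simp
    _ ≤ _ := setLIntegral_le_lintegral _ _

def Sq (ρ : ℝ) : Set (ℝ × ℝ) := Set.Icc (-ρ) ρ ×ˢ Set.Icc (-ρ) ρ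
lemma Sq_meas (ρ : ℝ) : MeasurableSet (Sq ρ) := measurableSet_Icc.prod measurableSet_Icc
lemma Sq_vol {ρ : ℝ} (h : 0 ≤ ρ) : volume (Sq ρ) = ENNReal.ofReal (4 * ρ ^ 2) := by
  unfold Sq
  rw [Measure.volume_eq_prod, Measure.prod_prod, Real.volume_Icc, ← ENNReal.ofReal_mul (by linarith)]
  congr 1; ring

lemma Jm_norm_sq (b : OrthonormalBasis (Fin 3) ℝ V3) (u : ℝ × ℝ) : ‖Jm b u‖ ^ 2 = u.1 ^ 2 + u.2 ^ 2 := by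
  have h01 : inner ℝ (b 0) (b 1) = (0 : ℝ) := b.orthonormal.2 (by decide)
  unfold Jm
  rw [norm_add_sq_real, inner_smul_left, inner_smul_right, h01, norm_smul, norm_smul]
  simp

lemma Jm_norm_le (b : OrthonormalBasis (Fin 3) ℝ V3) {ρ : ℝ} (h : 0 ≤ ρ) {u : ℝ × ℝ} (hu : u ∈ Sq ρ) :
    ‖Jm b u‖ ≤ 2 * ρ := by
  obtain ⟨⟨h1, h2⟩, h3, h4⟩ := hu
  refine abs_le_of_sq_le_sq' ?_ (by linarith) |>.2
  rw [Jm_norm_sq]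
  nlinarith

lemma norm_sq_basis (b : OrthonormalBasis (Fin 3) ℝ V3) (g : V3) :
    ‖g‖ ^ 2 = inner ℝ g (b 0) ^ 2 + inner ℝ g (b 1) ^ 2 + inner ℝ g (b 2) ^ 2 := by
  have := b.sum_sq_norm_inner_left g
  rw [Fin.sum_univ_three] at this
  simp only [norm_eq_abs, sq_abs] at this
  linarith

lemma Jm_inner (b : OrthonormalBasis (Fin 3) ℝ V3) {ρ : ℝ} {u : ℝ × ℝ} (hu : u ∈ Sq ρ) (g : V3) :
    inner ℝ g (Jm b u) ^ 2 ≤ 2 * ρ ^ 2 * (‖g‖ ^ 2 - inner ℝ g (b 2) ^ 2) := by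
  obtain ⟨⟨h1, h2⟩, h3, h4⟩ := hu
  rw [norm_sq_basis b g]
  unfold Jm
  rw [inner_add_right, inner_smul_right, inner_smul_right]
  set x := inner ℝ g (b 0); set y := inner ℝ g (b 1)
  have a1 : u.1 ^ 2 ≤ ρ ^ 2 := by nlinarith
  have a2 : u.2 ^ 2 ≤ ρ ^ 2 := by nlinarith
  have : (u.1 * x + u.2 * y) ^ 2 ≤ (u.1 ^ 2 + u.2 ^ 2) * (x ^ 2 + y ^ 2) := by
    nlinarith [sq_nonneg (u.1 * y - u.2 * x)]
  nlinarith [sq_nonneg x, sq_nonneg y]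

/-- bad points -/
def Bad (b : OrthonormalBasis (Fin 3) ℝ V3) (E : Set V3) (ρ : ℝ) : Set V3 :=
  {p | ENNReal.ofReal (2 * ρ ^ 2) < volume (Sq ρ ∩ {u | p + Jm b u ∈ E})}

lemma Bad_meas (b) {E : Set V3} (hE : MeasurableSet E) (ρ : ℝ) : MeasurableSet (Bad b E ρ) := by
  unfold Bad
  refine measurableSet_lt measurable_const ?_
  have : MeasurableSet {x : V3 × (ℝ × ℝ) | x.2 ∈ Sq ρ ∧ x.1 + Jm b x.2 ∈ E} := by
    refine MeasurableSet.inter (measurable_snd (Sq_meas ρ)) ?_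
    exact (Continuous.measurable (by have := Jm_continuous b; fun_prop) : Measurable (fun x : V3 × (ℝ × ℝ) => x.1 + Jm b x.2)) hE
  exact measurable_measure_prodMk_left this

/-- linear measure of bad points behind `q`. -/
def bq (b : OrthonormalBasis (Fin 3) ℝ V3) (E : Set V3) (ρ ζ : ℝ) (q : V3) : ℝ≥0∞ :=
  ∫⁻ s in Set.Icc (0:ℝ) ζ, (Bad b E ρ).indicator 1 (q - s • b 2)

end LL

namespace LL
open scoped ENNReal

lemma Pm_eq (b : OrthonormalBasis (Fin 3) ℝ V3) (τ : ℝ) (u : ℝ × ℝ) :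
    Pm b (τ, u) = τ • b 2 + Jm b u := rfl

lemma Pm_norm_le (b : OrthonormalBasis (Fin 3) ℝ V3) {ρ ζ τ : ℝ} (h : 0 ≤ ρ) {u : ℝ × ℝ} (hu : u ∈ Sq ρ)
    (hτ : |τ| ≤ ζ) : ‖Pm b (τ, u)‖ ≤ ζ + 2 * ρ := by
  rw [Pm_eq]
  refine (norm_add_le _ _).trans (add_le_add ?_ (Jm_norm_le b h hu))
  simpa [norm_smul] using hτ

lemma ofReal_sq_add (x y : ℝ) : ENNReal.ofReal ((x + y) ^ 2) ≤
    2 * ENNReal.ofReal (x ^ 2) + 2 * ENNReal.ofReal (y ^ 2) := by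
  rw [show (2 : ℝ≥0∞) = ENNReal.ofReal 2 by simp, ← ENNReal.ofReal_mul (by norm_num),
    ← ENNReal.ofReal_mul (by norm_num), ← ENNReal.ofReal_add (by positivity) (by positivity)]
  apply ENNReal.ofReal_le_ofReal
  nlinarith [sq_nonneg (x - y)]

section
variable {U : V3 → ℝ} {G : V3 → V3} (hU : ∀ x, HasFDerivAt U (innerSL ℝ (G x)) x)
  (hG : Continuous G) (b : OrthonormalBasis (Fin 3) ℝ V3)
  {E : Set V3} (hE : MeasurableSet E) (hUE : ∀ x, U x ≠ 0 → x ∈ E) {c : V3} {ρ ζ : ℝ}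
  (hρ : 0 < ρ) (hζ : 0 < ζ) (hζρ : ζ ≤ ρ)

include hE hUE hρ in
lemma good_pt {p : V3} (hp : p ∉ Bad b E ρ) :
    ENNReal.ofReal (U p ^ 2) * ENNReal.ofReal (2 * ρ ^ 2) ≤
      ∫⁻ u in Sq ρ, ENNReal.ofReal ((U (p + Jm b u) - U p) ^ 2) := by
  have hJ := Jm_continuous b
  refine half_zero (fun u => U (p + Jm b u)) (U p) _ ENNReal.ofReal_ne_top ?_
    {u | p + Jm b u ∈ E} ?_ ?_ (fun u hu => hUE _ hu)
  · rw [Sq_vol hρ.le, show (2 : ℝ≥0∞) = ENNReal.ofReal 2 by simp, ← ENNReal.ofReal_mul (by norm_num)]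
    congr 1; ring
  · exact (Continuous.measurable (by fun_prop) : Measurable (fun u => p + Jm b u)) hE
  · simpa [Bad] using hp

include hE hUE hρ hU hζ hζρ in
lemma bad_pt (hvol : volume (E ∩ Metric.ball c (8 * ρ)) ≤ ENNReal.ofReal (2 * ρ ^ 2 * ζ))
    {p : V3} (hp : p ∈ Metric.ball c ρ) :
    ENNReal.ofReal (U p ^ 2) * ENNReal.ofReal (2 * ρ ^ 2 * ζ) ≤
      2 * ENNReal.ofReal (4 * ρ ^ 2) * (∫⁻ τ in Set.Icc 0 ζ, ENNReal.ofReal ((U (p + τ • b 2) - U p) ^ 2))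
      + 2 * ∫⁻ τ in Set.Icc 0 ζ, ∫⁻ u in Sq ρ,
        ENNReal.ofReal ((U (p + τ • b 2 + Jm b u) - U (p + τ • b 2)) ^ 2) := by
  have hJ := Jm_continuous b
  have hP := Pm_continuous b
  have hUc : Continuous U := continuous_iff_continuousAt.2 (fun x => (hU x).continuousAt)
  have h1 : ENNReal.ofReal (U p ^ 2) * ENNReal.ofReal (2 * ρ ^ 2 * ζ) ≤
      ∫⁻ x in Set.Icc 0 ζ ×ˢ Sq ρ, ENNReal.ofReal ((U (p + Pm b x) - U p) ^ 2) := by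
    refine half_zero (fun x => U (p + Pm b x)) (U p) _ ENNReal.ofReal_ne_top ?_
      {x | p + Pm b x ∈ E} ?_ ?_ (fun u hu => hUE _ hu)
    · rw [Measure.volume_eq_prod, Measure.prod_prod, Sq_vol hρ.le, Real.volume_Icc,
        show (2 : ℝ≥0∞) = ENNReal.ofReal 2 by simp, ← ENNReal.ofReal_mul (by linarith),
        ← ENNReal.ofReal_mul (by norm_num)]
      congr 1; ring
    · exact (Continuous.measurable (by fun_prop) : Measurable (fun u => p + Pm b u)) hE
    · refine le_trans ?_ hvol
      have hm : MeasurableSet ((fun x => p + x) ⁻¹' (E ∩ Metric.ball c (8 * ρ))) :=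
        (hE.inter measurableSet_ball).preimage (by fun_prop)
      calc volume (Set.Icc 0 ζ ×ˢ Sq ρ ∩ {x | p + Pm b x ∈ E})
          ≤ volume (Pm b ⁻¹' ((fun x => p + x) ⁻¹' (E ∩ Metric.ball c (8 * ρ)))) := by
            refine measure_mono ?_
            rintro ⟨τ, u⟩ ⟨⟨hτ, hu⟩, hx⟩
            refine ⟨hx, ?_⟩
            have h3 := Pm_norm_le b hρ.le hu (ζ := ζ) (τ := τ) (by
              rw [abs_of_nonneg hτ.1]; exact hτ.2)
            simp only [Metric.mem_ball, dist_eq_norm] at hp ⊢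
            calc ‖p + Pm b (τ, u) - c‖ = ‖(p - c) + Pm b (τ, u)‖ := by congr 1; abel
              _ ≤ ‖p - c‖ + ‖Pm b (τ, u)‖ := norm_add_le _ _
              _ < 8 * ρ := by linarith
        _ = volume ((fun x => p + x) ⁻¹' (E ∩ Metric.ball c (8 * ρ))) :=
            (Pm_mp b).measure_preimage hm.nullMeasurableSet
        _ = _ := measure_preimage_add _ _ _
  refine h1.trans ?_
  rw [Measure.volume_eq_prod, ← Measure.prod_restrict, lintegral_prod]
  swap
  · apply Measurable.aemeasurable
    apply Measurable.ennreal_ofReal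
    exact Continuous.measurable (by fun_prop)
  rw [← lintegral_const_mul', ← lintegral_const_mul', ← lintegral_add_left]
  · refine lintegral_mono (fun τ => ?_)
    calc ∫⁻ u in Sq ρ, ENNReal.ofReal ((U (p + Pm b (τ, u)) - U p) ^ 2)
        ≤ ∫⁻ u in Sq ρ, (2 * ENNReal.ofReal ((U (p + τ • b 2) - U p) ^ 2) + 2 *
          ENNReal.ofReal ((U (p + τ • b 2 + Jm b u) - U (p + τ • b 2)) ^ 2)) := by
          refine lintegral_mono (fun u => ?_)
          rw [Pm_eq, ← add_assoc]
          have := ofReal_sq_add (U (p + τ • b 2) - U p) (U (p + τ • b 2 + Jm b u) - U (p + τ • b 2))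
          convert this using 3
          ring
      _ = _ := by
          rw [lintegral_add_left measurable_const, lintegral_const_mul' _ _ (by simp), lintegral_const_mul' _ _ (by simp)]
          simp only [lintegral_const, MeasurableSet.univ, Measure.restrict_apply, Set.univ_inter, Sq_vol hρ.le]
          ring
  · apply Measurable.const_mul
    apply Measurable.ennreal_ofReal
    exact Continuous.measurable (by fun_prop)
  · simp
  · exact ENNReal.mul_ne_top (by simp) ENNReal.ofReal_ne_top

include hU hG in
lemma lineE {p : V3} {τ : ℝ} (hτ : τ ∈ Set.Icc 0 ζ) : ENNReal.ofReal ((U (p + τ • b 2) - U p) ^ 2) ≤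
    ENNReal.ofReal ζ * ∫⁻ s in Set.Icc 0 ζ, ENNReal.ofReal ((inner ℝ (G (p + s • b 2)) (b 2)) ^ 2) := by
  have := oned (φ := fun s => U (p + s • b 2)) (φ' := fun s => inner ℝ (G (p + s • b 2)) (b 2))
      (fun s => by
        have h2 : HasDerivAt (fun s : ℝ => p + s • b 2) (b 2) s := by
          simpa using ((hasDerivAt_id s).smul_const (b 2)).const_add p
        exact (hU (p + s • b 2)).comp_hasDerivAt s h2) (by fun_prop) hτ.1
  simp only [zero_smul, add_zero] at this
  refine this.trans ?_
  gcongr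
  · exact hτ.2
  · exact hτ.2

include hU hG in
lemma horiz (A : Set V3) (hA : MeasurableSet A) {B : Set V3} (hB : MeasurableSet B)
    {u : ℝ × ℝ} (hu : u ∈ Sq ρ) 
    (h : ∀ p ∈ A, ∀ s ∈ Set.Icc (0:ℝ) 1, p + s • Jm b u ∈ B) :
    ∫⁻ p in A, ENNReal.ofReal ((U (p + Jm b u) - U p) ^ 2) ≤ ENNReal.ofReal (2 * ρ ^ 2) *
      ∫⁻ q in B, ENNReal.ofReal (‖G q‖ ^ 2 - inner ℝ (G q) (b 2) ^ 2) := by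
  refine (shift_est hU hG hA hB _ h).trans ?_
  rw [← lintegral_const_mul' _ _ ENNReal.ofReal_ne_top]
  refine lintegral_mono (fun q => ?_)
  rw [← ENNReal.ofReal_mul (by positivity)]
  exact ENNReal.ofReal_le_ofReal (Jm_inner b hu _)
end
end LL

namespace LL
open scoped ENNReal

lemma bq_le (b) (E : Set V3) (ρ ζ : ℝ) (q : V3) : bq b E ρ ζ q ≤ ENNReal.ofReal ζ := by
  unfold bq
  calc _ ≤ ∫⁻ s in Set.Icc (0:ℝ) ζ, 1 := by
        refine lintegral_mono (fun s => ?_)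
        exact Set.indicator_le_self' (by simp) _
    _ = _ := by simp

lemma Pm_perp (b : OrthonormalBasis (Fin 3) ℝ V3) (τ : ℝ) (u : ℝ × ℝ) :
    ‖Pm b (τ, u)‖ ^ 2 - inner ℝ (Pm b (τ, u)) (b 2) ^ 2 = u.1 ^ 2 + u.2 ^ 2 := by
  rw [norm_sq_basis b, Pm]
  have h : ∀ i j, inner ℝ (b i) (b j) = if i = j then (1:ℝ) else 0 :=
    orthonormal_iff_ite.1 b.orthonormal
  simp [inner_add_left, inner_smul_left, h]

/-- points of E seen from q off axis -/
def Eoff (E : Set V3) (e : V3) (ρ : ℝ) (q : V3) : Set V3 :=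
  E ∩ {x | ‖x - q‖ ≤ 3 * ρ ∧ (ρ / 4) ^ 2 ≤ ‖x - q‖ ^ 2 - inner ℝ (x - q) e ^ 2}

lemma Eoff_meas {E : Set V3} (hE : MeasurableSet E) (e : V3) (ρ : ℝ) (q : V3) :
    MeasurableSet (Eoff E e ρ q) := by
  refine hE.inter (IsClosed.measurableSet ?_)
  have h1 : Continuous (fun x : V3 => ‖x - q‖) := by fun_prop
  have h2 : Continuous (fun x : V3 => ‖x - q‖ ^ 2 - inner ℝ (x - q) e ^ 2) := by fun_prop
  exact (isClosed_le h1 continuous_const).inter (isClosed_le continuous_const h2)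

lemma bq_Eoff (b : OrthonormalBasis (Fin 3) ℝ V3) {E : Set V3} (hE : MeasurableSet E) {ρ ζ : ℝ}
    (hρ : 0 < ρ) (hζρ : ζ ≤ ρ) (q : V3) :
    ENNReal.ofReal (ρ ^ 2) * bq b E ρ ζ q ≤ volume (Eoff E (b 2) ρ q) := by
  have hP := Pm_continuous b
  have hJ := Jm_continuous b
  set Q : ℝ × (ℝ × ℝ) → V3 := fun x => Pm b (-x.1, x.2) with hQ
  have hQmp : MeasurePreserving Q volume volume :=
    (Pm_mp b).comp ((Measure.measurePreserving_neg (volume : Measure ℝ)).prod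
      (MeasurePreserving.id (volume : Measure (ℝ × ℝ))))
  have hQc : Continuous Q := by fun_prop
  set N : Set (ℝ × (ℝ × ℝ)) := (Set.Icc 0 ζ ×ˢ (Sq ρ \ Sq (ρ / 4))) ∩ {x | q + Q x ∈ E} with hN
  have hNm : MeasurableSet N :=
    (measurableSet_Icc.prod ((Sq_meas ρ).diff (Sq_meas _))).inter
      ((Continuous.measurable (by fun_prop) : Measurable (fun x => q + Q x)) hE)
  have h1 : volume N ≤ volume (Eoff E (b 2) ρ q) := by
    have hm : MeasurableSet ((fun x => q + x) ⁻¹' (Eoff E (b 2) ρ q)) :=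
      (Eoff_meas hE _ _ _).preimage (by fun_prop)
    calc volume N ≤ volume (Q ⁻¹' ((fun x => q + x) ⁻¹' (Eoff E (b 2) ρ q))) := by
          refine measure_mono ?_
          rintro ⟨τ, u⟩ ⟨⟨hτ, hu, hu2⟩, hx⟩
          refine ⟨hx, ?_⟩
          have h3 := Pm_norm_le b hρ.le hu (ζ := ζ) (τ := -τ) (by
              rw [abs_neg, abs_of_nonneg hτ.1]; exact hτ.2)
          simp only [Set.mem_ofPred_eq, add_sub_cancel_left, hQ, Pm_perp]
          refine ⟨by linarith, ?_⟩
          have : ρ / 4 < |u.1| ∨ ρ / 4 < |u.2| := by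
            by_contra hcon
            push Not at hcon
            exact hu2 ⟨abs_le.1 hcon.1, abs_le.1 hcon.2⟩
          rcases this with h | h
          · have := pow_le_pow_left₀ (by positivity) h.le 2
            rw [sq_abs] at this
            nlinarith [sq_nonneg u.2]
          · have := pow_le_pow_left₀ (by positivity) h.le 2
            rw [sq_abs] at this
            nlinarith [sq_nonneg u.1]
      _ = volume ((fun x => q + x) ⁻¹' (Eoff E (b 2) ρ q)) :=
          hQmp.measure_preimage hm.nullMeasurableSet
      _ = _ := measure_preimage_add _ _ _
  refine le_trans ?_ h1
  rw [Measure.volume_eq_prod, Measure.prod_apply hNm, bq, ← lintegral_const_mul' _ _ ENNReal.ofReal_ne_top,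
    ← lintegral_indicator measurableSet_Icc]
  refine lintegral_mono (fun s => ?_)
  by_cases hs : s ∈ Set.Icc 0 ζ
  swap
  · simp [hs]
  rw [Set.indicator_of_mem hs]
  by_cases hb : q - s • b 2 ∈ Bad b E ρ
  swap
  · simp [hb]
  rw [Set.indicator_of_mem hb]
  simp only [Pi.one_apply, mul_one]
  have h2 : ENNReal.ofReal (2 * ρ ^ 2) < volume (Sq ρ ∩ {u | q - s • b 2 + Jm b u ∈ E}) := hb
  have h3 : volume (Sq ρ ∩ {u | q - s • b 2 + Jm b u ∈ E}) ≤ volume (Prod.mk s ⁻¹' N) + volume (Sq (ρ / 4)) := by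
    refine le_trans (measure_mono ?_) (measure_union_le _ _)
    rintro u ⟨hu, hx⟩
    by_cases hu2 : u ∈ Sq (ρ / 4)
    · exact Or.inr hu2
    · refine Or.inl ⟨⟨hs, hu, hu2⟩, ?_⟩
      have : q + Q (s, u) = q - s • b 2 + Jm b u := by
        simp only [hQ, Pm_eq]; rw [neg_smul]; abel
      simp only [Set.mem_ofPred_eq, this]
      exact hx
  rw [Sq_vol (by positivity)] at h3
  have h4 : ENNReal.ofReal (ρ ^ 2) + ENNReal.ofReal (4 * (ρ / 4) ^ 2) ≤ ENNReal.ofReal (2 * ρ ^ 2) := by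
    rw [← ENNReal.ofReal_add (by positivity) (by positivity)]
    exact ENNReal.ofReal_le_ofReal (by nlinarith)
  exact (ENNReal.add_le_add_iff_right ENNReal.ofReal_ne_top).1 (h4.trans (h2.le.trans h3))

section
variable {U : V3 → ℝ} {G : V3 → V3} (hU : ∀ x, HasFDerivAt U (innerSL ℝ (G x)) x)
  (hG : Continuous G) (b : OrthonormalBasis (Fin 3) ℝ V3)
  {E : Set V3} (hE : MeasurableSet E) (hUE : ∀ x, U x ≠ 0 → x ∈ E) {c : V3} {ρ ζ : ℝ}
  (hρ : 0 < ρ) (hζ : 0 < ζ) (hζρ : ζ ≤ ρ)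

include hU hG hE hUE hρ hζ hζρ in
theorem cell (hvol : volume (E ∩ Metric.ball c (8 * ρ)) ≤ ENNReal.ofReal (2 * ρ ^ 2 * ζ)) :
    ∫⁻ p in Metric.ball c ρ, ENNReal.ofReal (U p ^ 2) ≤
      ENNReal.ofReal (12 * ρ ^ 2) * (∫⁻ q in Metric.ball c (8 * ρ),
        ENNReal.ofReal (‖G q‖ ^ 2 - inner ℝ (G q) (b 2) ^ 2)) +
      ENNReal.ofReal (4 * ζ) * ∫⁻ q in Metric.ball c (2 * ρ),
        bq b E ρ ζ q * ENNReal.ofReal (inner ℝ (G q) (b 2) ^ 2) := by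
  have hJ := Jm_continuous b
  have hUc : Continuous U := continuous_iff_continuousAt.2 (fun x => (hU x).continuousAt)
  set X := ∫⁻ q in Metric.ball c (8 * ρ), ENNReal.ofReal (‖G q‖ ^ 2 - inner ℝ (G q) (b 2) ^ 2)
  set Y := ∫⁻ q in Metric.ball c (2 * ρ), bq b E ρ ζ q * ENNReal.ofReal (inner ℝ (G q) (b 2) ^ 2)
  set B := Metric.ball c ρ
  have hB : MeasurableSet B := measurableSet_ball
  have hBs : MeasurableSet (Metric.ball c (8 * ρ)) := measurableSet_ball
  have hBad := Bad_meas b hE ρ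
  -- T1
  have t1 : ∫⁻ p in B, ∫⁻ u in Sq ρ, ENNReal.ofReal ((U (p + Jm b u) - U p) ^ 2) ≤
      ENNReal.ofReal (2 * ρ ^ 2) * X * ENNReal.ofReal (4 * ρ ^ 2) := by
    rw [lintegral_lintegral_swap (Measurable.aemeasurable (Measurable.ennreal_ofReal
      (Continuous.measurable (by fun_prop))))]
    calc _ ≤ ∫⁻ u in Sq ρ, ENNReal.ofReal (2 * ρ ^ 2) * X := by
          refine setLIntegral_mono' (Sq_meas ρ) (fun u hu => ?_)
          refine horiz hU hG b B hB hBs hu (fun p hp s hs => ?_)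
          simp only [B, Metric.mem_ball, dist_eq_norm] at hp ⊢
          calc ‖p + s • Jm b u - c‖ = ‖(p - c) + s • Jm b u‖ := by congr 1; abel
              _ ≤ ‖p - c‖ + |s| * ‖Jm b u‖ := by
                refine (norm_add_le _ _).trans ?_
                rw [norm_smul, norm_eq_abs]
              _ < 8 * ρ := by
                have := Jm_norm_le b hρ.le hu
                rw [abs_of_nonneg hs.1]
                nlinarith [norm_nonneg (Jm b u), hs.2, hs.1]
      _ = _ := by simp [Sq_vol hρ.le]
  -- T2
  have t2 : ∫⁻ p in B, ∫⁻ τ in Set.Icc 0 ζ, ∫⁻ u in Sq ρ,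
        ENNReal.ofReal ((U (p + τ • b 2 + Jm b u) - U (p + τ • b 2)) ^ 2) ≤
      ENNReal.ofReal (2 * ρ ^ 2) * X * ENNReal.ofReal (4 * ρ ^ 2) * ENNReal.ofReal ζ := by
    have hm : Measurable (fun x : (V3 × ℝ) × (ℝ × ℝ) =>
      ENNReal.ofReal ((U (x.1.1 + x.1.2 • b 2 + Jm b x.2) - U (x.1.1 + x.1.2 • b 2)) ^ 2)) :=
      Measurable.ennreal_ofReal (Continuous.measurable (by fun_prop))
    rw [lintegral_lintegral_swap (Measurable.aemeasurable ?_)]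
    swap
    · exact hm.lintegral_prod_right' (ν := volume.restrict (Sq ρ))
    calc _ ≤ ∫⁻ τ in Set.Icc 0 ζ, ENNReal.ofReal (2 * ρ ^ 2) * X * ENNReal.ofReal (4 * ρ ^ 2) := by
          refine setLIntegral_mono' measurableSet_Icc (fun τ hτ => ?_)
          rw [lintegral_lintegral_swap (Measurable.aemeasurable (Measurable.ennreal_ofReal
            (Continuous.measurable (by fun_prop))))]
          calc _ ≤ ∫⁻ u in Sq ρ, ENNReal.ofReal (2 * ρ ^ 2) * X := by
                refine setLIntegral_mono' (Sq_meas ρ) (fun u hu => ?_)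
                refine (setl_shift (fun p => ENNReal.ofReal ((U (p + Jm b u) - U p) ^ 2)) hB
                  (measurableSet_ball : MeasurableSet (Metric.ball c (2 * ρ))) (τ • b 2) ?_).trans ?_
                · intro p hp
                  simp only [B, Metric.mem_ball, dist_eq_norm] at hp ⊢
                  calc ‖p + τ • b 2 - c‖ = ‖(p - c) + τ • b 2‖ := by congr 1; abel
                    _ ≤ ‖p - c‖ + |τ| * ‖b 2‖ := by
                      refine (norm_add_le _ _).trans ?_
                      rw [norm_smul, norm_eq_abs]
                    _ < 2 * ρ := by
                      rw [abs_of_nonneg hτ.1]; simp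
                      linarith [hτ.2]
                refine horiz hU hG b _ measurableSet_ball hBs hu (fun p hp s hs => ?_)
                simp only [Metric.mem_ball, dist_eq_norm] at hp ⊢
                calc ‖p + s • Jm b u - c‖ = ‖(p - c) + s • Jm b u‖ := by congr 1; abel
                    _ ≤ ‖p - c‖ + |s| * ‖Jm b u‖ := by
                      refine (norm_add_le _ _).trans ?_
                      rw [norm_smul, norm_eq_abs]
                    _ < 8 * ρ := by
                      have := Jm_norm_le b hρ.le hu
                      rw [abs_of_nonneg hs.1]
                      nlinarith [norm_nonneg (Jm b u), hs.2, hs.1]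
            _ = _ := by simp [Sq_vol hρ.le]
      _ = _ := by simp
  -- T3
  have t3 : ∫⁻ p in B, (Bad b E ρ).indicator 1 p *
        ∫⁻ τ in Set.Icc 0 ζ, ENNReal.ofReal ((U (p + τ • b 2) - U p) ^ 2) ≤
      ENNReal.ofReal ζ * ENNReal.ofReal ζ * Y := by
    have hm : Measurable (fun x : V3 × ℝ => (Bad b E ρ).indicator (1 : V3 → ℝ≥0∞) x.1 *
          ENNReal.ofReal ((inner ℝ (G (x.1 + x.2 • b 2)) (b 2)) ^ 2)) :=
      ((measurable_one.indicator hBad).comp measurable_fst).mul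
        (Measurable.ennreal_ofReal (Continuous.measurable (by fun_prop)))
    have hm2 : Measurable (fun x : ℝ × V3 => (Bad b E ρ).indicator (1 : V3 → ℝ≥0∞) (x.2 - x.1 • b 2) *
          ENNReal.ofReal ((inner ℝ (G x.2) (b 2)) ^ 2)) :=
      ((measurable_one.indicator hBad).comp (Continuous.measurable (by fun_prop))).mul
        (Measurable.ennreal_ofReal (Continuous.measurable (by fun_prop)))
    calc _ ≤ ∫⁻ p in B, ENNReal.ofReal ζ * ENNReal.ofReal ζ * ∫⁻ s in Set.Icc 0 ζ,
          (Bad b E ρ).indicator 1 p * ENNReal.ofReal ((inner ℝ (G (p + s • b 2)) (b 2)) ^ 2) := by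
          refine lintegral_mono (fun p => ?_)
          by_cases hb : p ∈ Bad b E ρ
          · simp only [hb, Set.indicator_of_mem, Pi.one_apply, one_mul]
            calc _ ≤ ∫⁻ τ in Set.Icc 0 ζ, ENNReal.ofReal ζ * ∫⁻ s in Set.Icc 0 ζ, ENNReal.ofReal ((inner ℝ (G (p + s • b 2)) (b 2)) ^ 2) :=
                  setLIntegral_mono' measurableSet_Icc (fun τ hτ => lineE hU hG b hτ)
              _ = _ := by simp; ring
          · simp [hb]
      _ = ENNReal.ofReal ζ * ENNReal.ofReal ζ * ∫⁻ s in Set.Icc 0 ζ, ∫⁻ p in B,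
          (Bad b E ρ).indicator 1 p * ENNReal.ofReal ((inner ℝ (G (p + s • b 2)) (b 2)) ^ 2) := by
          rw [lintegral_const_mul' _ _ (ENNReal.mul_ne_top ENNReal.ofReal_ne_top ENNReal.ofReal_ne_top),
            lintegral_lintegral_swap hm.aemeasurable]
      _ ≤ ENNReal.ofReal ζ * ENNReal.ofReal ζ * ∫⁻ s in Set.Icc 0 ζ, ∫⁻ q in Metric.ball c (2 * ρ),
          (Bad b E ρ).indicator 1 (q - s • b 2) * ENNReal.ofReal ((inner ℝ (G q) (b 2)) ^ 2) := by
          gcongr 1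
          refine setLIntegral_mono' measurableSet_Icc (fun s hs => ?_)
          have := setl_shift (fun q => (Bad b E ρ).indicator 1 (q - s • b 2) * ENNReal.ofReal ((inner ℝ (G q) (b 2)) ^ 2))
            hB (measurableSet_ball : MeasurableSet (Metric.ball c (2 * ρ))) (s • b 2) (by
              intro p hp
              simp only [B, Metric.mem_ball, dist_eq_norm] at hp ⊢
              calc ‖p + s • b 2 - c‖ = ‖(p - c) + s • b 2‖ := by congr 1; abel
                    _ ≤ ‖p - c‖ + |s| * ‖b 2‖ := by
                      refine (norm_add_le _ _).trans ?_
                      rw [norm_smul, norm_eq_abs]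
                    _ < 2 * ρ := by
                      rw [abs_of_nonneg hs.1]; simp
                      linarith [hs.2])
          simpa using this
      _ = _ := by
          rw [lintegral_lintegral_swap hm2.aemeasurable]
          congr 1
          refine lintegral_congr (fun q => ?_)
          rw [lintegral_mul_const', bq]
          exact ENNReal.ofReal_ne_top
  -- pointwise
  have hpt : ∀ p ∈ B, ENNReal.ofReal (2 * ρ ^ 2 * ζ) * ENNReal.ofReal (U p ^ 2) ≤
      ENNReal.ofReal ζ * (∫⁻ u in Sq ρ, ENNReal.ofReal ((U (p + Jm b u) - U p) ^ 2)) +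
      (2 * ENNReal.ofReal (4 * ρ ^ 2) * ((Bad b E ρ).indicator 1 p *
        ∫⁻ τ in Set.Icc 0 ζ, ENNReal.ofReal ((U (p + τ • b 2) - U p) ^ 2)) +
      2 * ∫⁻ τ in Set.Icc 0 ζ, ∫⁻ u in Sq ρ,
        ENNReal.ofReal ((U (p + τ • b 2 + Jm b u) - U (p + τ • b 2)) ^ 2)) := by
    intro p hp
    by_cases hb : p ∈ Bad b E ρ
    · refine le_add_left ?_
      have := bad_pt hU b hE hUE hρ hζ hζρ hvol hp
      simpa [hb, mul_comm] using this
    · refine le_add_right ?_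
      have := good_pt b hE hUE hρ hb
      rw [ENNReal.ofReal_mul (by positivity)]
      calc _ = ENNReal.ofReal ζ * (ENNReal.ofReal (U p ^ 2) * ENNReal.ofReal (2 * ρ ^ 2)) := by ring
        _ ≤ _ := by gcongr
  have hfin : ENNReal.ofReal (2 * ρ ^ 2 * ζ) * ∫⁻ p in B, ENNReal.ofReal (U p ^ 2) ≤
      ENNReal.ofReal (2 * ρ ^ 2 * ζ) * (ENNReal.ofReal (12 * ρ ^ 2) * X + ENNReal.ofReal (4 * ζ) * Y) := by
    have ma : Measurable (fun p => ENNReal.ofReal ζ * (∫⁻ u in Sq ρ, ENNReal.ofReal ((U (p + Jm b u) - U p) ^ 2))) := by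
      apply Measurable.const_mul
      have : Measurable (fun x : V3 × (ℝ × ℝ) => ENNReal.ofReal ((U (x.1 + Jm b x.2) - U x.1) ^ 2)) :=
        Measurable.ennreal_ofReal (Continuous.measurable (by fun_prop))
      exact this.lintegral_prod_right' (ν := volume.restrict (Sq ρ))
    have mb : Measurable (fun p => 2 * ENNReal.ofReal (4 * ρ ^ 2) * ((Bad b E ρ).indicator 1 p *
        ∫⁻ τ in Set.Icc 0 ζ, ENNReal.ofReal ((U (p + τ • b 2) - U p) ^ 2))) := by
      apply Measurable.const_mul
      refine (measurable_one.indicator hBad).mul ?_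
      have : Measurable (fun x : V3 × ℝ => ENNReal.ofReal ((U (x.1 + x.2 • b 2) - U x.1) ^ 2)) :=
        Measurable.ennreal_ofReal (Continuous.measurable (by fun_prop))
      exact this.lintegral_prod_right' (ν := volume.restrict (Set.Icc 0 ζ))
    rw [← lintegral_const_mul' _ _ ENNReal.ofReal_ne_top]
    refine (setLIntegral_mono' hB hpt).trans ?_
    rw [lintegral_add_left ma, lintegral_add_left mb, lintegral_const_mul' _ _ ENNReal.ofReal_ne_top,
      lintegral_const_mul' _ _ (ENNReal.mul_ne_top (by simp) ENNReal.ofReal_ne_top),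
      lintegral_const_mul' _ _ (by simp)]
    calc _ ≤ ENNReal.ofReal ζ * (ENNReal.ofReal (2 * ρ ^ 2) * X * ENNReal.ofReal (4 * ρ ^ 2)) +
        (2 * ENNReal.ofReal (4 * ρ ^ 2) * (ENNReal.ofReal ζ * ENNReal.ofReal ζ * Y) +
         2 * (ENNReal.ofReal (2 * ρ ^ 2) * X * ENNReal.ofReal (4 * ρ ^ 2) * ENNReal.ofReal ζ)) := by gcongr
      _ = _ := by
        have e1 : ENNReal.ofReal (2 * ρ ^ 2) = 2 * ENNReal.ofReal ρ ^ 2 := by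
          rw [ENNReal.ofReal_mul (by norm_num), ENNReal.ofReal_pow hρ.le]; simp
        have e2 : ENNReal.ofReal (4 * ρ ^ 2) = 4 * ENNReal.ofReal ρ ^ 2 := by
          rw [ENNReal.ofReal_mul (by norm_num), ENNReal.ofReal_pow hρ.le]; simp
        have e3 : ENNReal.ofReal (12 * ρ ^ 2) = 12 * ENNReal.ofReal ρ ^ 2 := by
          rw [ENNReal.ofReal_mul (by norm_num), ENNReal.ofReal_pow hρ.le]; simp
        have e4 : ENNReal.ofReal (4 * ζ) = 4 * ENNReal.ofReal ζ := by
          rw [ENNReal.ofReal_mul (by norm_num)]; simp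
        rw [ENNReal.ofReal_mul (q := ζ) (by positivity), e1, e2, e3, e4]
        ring
  exact (ENNReal.mul_le_mul_iff_right (by simpa using by positivity) ENNReal.ofReal_ne_top).1 hfin
end
end LL

namespace LL
open scoped ENNReal

/-- squared length of the projection orthogonal to z. -/
def PiSq (z ξ : V3) : ℝ := ‖ξ‖ ^ 2 - inner ℝ ξ z ^ 2 / ‖z‖ ^ 2
/-- Landau kernel as a quadratic form. -/
def kq (z ξ : V3) : ℝ := PiSq z ξ / (8 * π * ‖z‖)
/-- quadratic form of the diffusion matrix. -/
def AqE (f : V3 → ℝ) (x ξ : V3) : ℝ≥0∞ := ∫⁻ w, ENNReal.ofReal (f w * kq (x - w) ξ)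

structure FH (f : V3 → ℝ) (Sg : ℝ) : Prop where
  nn : ∀ v, 0 ≤ f v
  cont : Continuous f
  one : 1 ≤ Sg
  mass : ∫⁻ v, ENNReal.ofReal (f v) ≤ 1
  mass4 : ENNReal.ofReal (13 / 16) ≤ ∫⁻ v in Metric.ball 0 4, ENNReal.ofReal (f v)
  l2 : ∫⁻ v, ENNReal.ofReal (f v ^ 2) ≤ ENNReal.ofReal (Sg ^ 2)

lemma PiSq_nonneg (z ξ : V3) : 0 ≤ PiSq z ξ := by
  unfold PiSq
  rcases eq_or_ne z 0 with h | h
  · simp [h]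
  · have hz : 0 < ‖z‖ := norm_pos_iff.2 h
    rw [sub_nonneg, div_le_iff₀ (by positivity), ← mul_pow]
    exact sq_le_sq' (by linarith [neg_abs_le (inner ℝ ξ z), abs_real_inner_le_norm ξ z])
      (real_inner_le_norm ξ z)

lemma kq_nonneg (z ξ : V3) : 0 ≤ kq z ξ := div_nonneg (PiSq_nonneg z ξ) (by positivity)

lemma PiSq_le (z ξ : V3) : PiSq z ξ ≤ ‖ξ‖ ^ 2 := by
  unfold PiSq; have : 0 ≤ inner ℝ ξ z ^ 2 / ‖z‖ ^ 2 := by positivity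
  linarith

lemma PiSq_eq {z : V3} (hz : z ≠ 0) (ξ : V3) : PiSq z ξ = ‖ξ - (inner ℝ ξ z / ‖z‖ ^ 2) • z‖ ^ 2 := by
  have hz' : ‖z‖ ≠ 0 := norm_ne_zero_iff.2 hz
  rw [norm_sub_sq_real, inner_smul_right, norm_smul, PiSq, mul_pow, norm_eq_abs, sq_abs]
  field_simp; ring

lemma PiSq_le_sub {z : V3} (ξ : V3) (t : ℝ) : PiSq z ξ ≤ ‖ξ - t • z‖ ^ 2 := by
  rcases eq_or_ne z 0 with h | h
  · simp [h, PiSq]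
  have hz : 0 < ‖z‖ := norm_pos_iff.2 h
  rw [norm_sub_sq_real, inner_smul_right, norm_smul, PiSq, mul_pow, norm_eq_abs, sq_abs]
  have : 0 ≤ (inner ℝ ξ z / ‖z‖ - t * ‖z‖) ^ 2 := sq_nonneg _
  have e : (inner ℝ ξ z / ‖z‖ - t * ‖z‖) ^ 2 = inner ℝ ξ z ^ 2 / ‖z‖ ^ 2 - 2 * (t * inner ℝ ξ z) + t ^ 2 * ‖z‖ ^ 2 := by
    field_simp
    ring
  linarith

lemma norm_add_sq_le2 (x y : V3) : ‖x + y‖ ^ 2 ≤ 2 * ‖x‖ ^ 2 + 2 * ‖y‖ ^ 2 := by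
  have := parallelogram_law_with_norm ℝ x y
  nlinarith [norm_nonneg (x - y)]

/-- comparing projections for nearby directions -/
lemma PiSq_compare {c q w ξ : V3} (h2 : q ≠ w) :
    PiSq (c - w) ξ ≤ 2 * PiSq (q - w) ξ + 2 * ‖ξ‖ ^ 2 * (‖q - c‖ / ‖q - w‖) ^ 2 := by
  have hq : q - w ≠ 0 := sub_ne_zero.2 h2
  have hq' : 0 < ‖q - w‖ := norm_pos_iff.2 hq
  set s := inner ℝ ξ (q - w) / ‖q - w‖ ^ 2 with hs
  have e : ξ - s • (c - w) = (ξ - s • (q - w)) + s • (q - c) := by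
    simp only [smul_sub]; abel
  refine (PiSq_le_sub ξ s).trans ?_
  rw [e, PiSq_eq hq]
  refine (norm_add_sq_le2 _ _).trans ?_
  rw [← hs, norm_smul]
  have h3 : ‖s‖ ≤ ‖ξ‖ / ‖q - w‖ := by
    rw [hs, norm_div, norm_pow, norm_norm, div_le_div_iff₀ (by positivity) hq']
    have := norm_inner_le_norm (𝕜 := ℝ) ξ (q - w)
    nlinarith
  have h4 : (‖s‖ * ‖q - c‖) ^ 2 ≤ (‖ξ‖ / ‖q - w‖ * ‖q - c‖) ^ 2 := by gcongr
  have h5 : (‖ξ‖ / ‖q - w‖ * ‖q - c‖) ^ 2 = ‖ξ‖ ^ 2 * (‖q - c‖ / ‖q - w‖) ^ 2 := by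
    field_simp
  linarith

lemma PiSq_split {z e ξ : V3} (he : ‖e‖ = 1) :
    inner ℝ ξ e ^ 2 * PiSq z e ≤ 2 * PiSq z ξ + 2 * (‖ξ‖ ^ 2 - inner ℝ ξ e ^ 2) := by
  rcases eq_or_ne z 0 with h | h
  · subst h
    have : inner ℝ ξ e ^ 2 ≤ ‖ξ‖ ^ 2 := by
      have := PiSq_nonneg e ξ; unfold PiSq at this; rw [he] at this; linarith
    simp [PiSq, he]; nlinarith
  set α := inner ℝ ξ e with hα
  have h1 : α ^ 2 * PiSq z e = PiSq z (α • e) := by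
    simp [PiSq, norm_smul, inner_smul_left, he]; ring
  have e2 : α • e - (inner ℝ ξ z / ‖z‖ ^ 2) • z = (ξ - (inner ℝ ξ z / ‖z‖ ^ 2) • z) + (α • e - ξ) := by abel
  rw [h1]
  refine (PiSq_le_sub _ (inner ℝ ξ z / ‖z‖ ^ 2)).trans ?_
  rw [e2]
  refine (norm_add_sq_le2 _ _).trans ?_
  rw [← PiSq_eq h]
  have : ‖α • e - ξ‖ ^ 2 = ‖ξ‖ ^ 2 - α ^ 2 := by
    rw [norm_sub_sq_real, inner_smul_left, norm_smul, real_inner_comm, ← hα, he]; simp; ring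
  rw [this]

lemma one_le_jap (v : V3) : 1 ≤ jap v := by
  unfold jap; rw [Real.one_le_sqrt]; nlinarith [norm_nonneg v]
lemma norm_le_jap (v : V3) : ‖v‖ ≤ jap v := by
  unfold jap; apply Real.le_sqrt_of_sq_le; linarith
lemma jap_le (v : V3) : jap v ≤ 1 + ‖v‖ := by
  unfold jap; rw [Real.sqrt_le_left (by positivity)]; nlinarith [norm_nonneg v]
lemma jap_continuous : Continuous jap := by unfold jap; fun_prop
lemma jap_le_two {x c : V3} (h : ‖x - c‖ ≤ 1) : jap x ≤ 2 * jap c := by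
  have h1 : ‖x‖ ≤ ‖c‖ + 1 := by
    have := norm_add_le (x - c) c; rw [sub_add_cancel] at this; linarith
  unfold jap
  rw [Real.sqrt_le_left (by positivity), mul_pow, Real.sq_sqrt (by positivity)]
  nlinarith [norm_nonneg x, norm_nonneg c, sq_nonneg (‖c‖ - 1)]

section
variable {f : V3 → ℝ} {Sg : ℝ}

lemma FH.small (hf : FH f Sg) {A : Set V3} (hA : volume A ≤ ENNReal.ofReal (1 / (16 * Sg ^ 2))) :
    ∫⁻ v in A, ENNReal.ofReal (f v) ≤ ENNReal.ofReal (1 / 4) := by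
  have hS := hf.one
  have h0 : 0 < Sg := by linarith
  have hc := hf.cont
  calc ∫⁻ v in A, ENNReal.ofReal (f v) ≤
      ∫⁻ v in A, (ENNReal.ofReal (1 / (8 * Sg ^ 2)) * ENNReal.ofReal (f v ^ 2) + ENNReal.ofReal (2 * Sg ^ 2)) := by
        refine lintegral_mono (fun v => ?_)
        rw [← ENNReal.ofReal_mul (by positivity), ← ENNReal.ofReal_add (by positivity) (by positivity)]
        apply ENNReal.ofReal_le_ofReal
        have e : 1 / (8 * Sg ^ 2) * f v ^ 2 + 2 * Sg ^ 2 - f v = (f v - 4 * Sg ^ 2) ^ 2 / (8 * Sg ^ 2) := by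
          field_simp; ring
        have : 0 ≤ (f v - 4 * Sg ^ 2) ^ 2 / (8 * Sg ^ 2) := by positivity
        linarith
    _ = ENNReal.ofReal (1 / (8 * Sg ^ 2)) * (∫⁻ v in A, ENNReal.ofReal (f v ^ 2)) + ENNReal.ofReal (2 * Sg ^ 2) * volume A := by
        rw [lintegral_add_right _ measurable_const, lintegral_const_mul' _ _ ENNReal.ofReal_ne_top]
        simp
    _ ≤ ENNReal.ofReal (1 / (8 * Sg ^ 2)) * ENNReal.ofReal (Sg ^ 2) + ENNReal.ofReal (2 * Sg ^ 2) * ENNReal.ofReal (1 / (16 * Sg ^ 2)) := by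
        gcongr
        exact (setLIntegral_le_lintegral _ _).trans hf.l2
    _ = _ := by
        rw [← ENNReal.ofReal_mul (by positivity), ← ENNReal.ofReal_mul (by positivity),
          ← ENNReal.ofReal_add (by positivity) (by positivity)]
        congr 1; field_simp; norm_num

lemma FH.half (hf : FH f Sg) {A : Set V3} (hm : MeasurableSet A)
    (hA : volume (A ∩ Metric.ball 0 4) ≤ ENNReal.ofReal (1 / (16 * Sg ^ 2))) :
    ENNReal.ofReal (1 / 2) ≤ ∫⁻ v in Metric.ball 0 4 \ A, ENNReal.ofReal (f v) := by
  have h1 := hf.small hA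
  have h2 := hf.mass4
  rw [← lintegral_inter_add_sdiff _ _ hm, Set.inter_comm] at h2
  have h3 : ENNReal.ofReal (1 / 4) + ENNReal.ofReal (1 / 2) ≤ ENNReal.ofReal (13 / 16) := by
    rw [← ENNReal.ofReal_add (by norm_num) (by norm_num)]
    exact ENNReal.ofReal_le_ofReal (by norm_num)
  have h4 := h3.trans (h2.trans (add_le_add_left h1 _))
  exact (ENNReal.add_le_add_iff_left ENNReal.ofReal_ne_top).1 h4

lemma FH.Aq_ge (hf : FH f Sg) {W : Set V3} (hW : MeasurableSet W) {x ξ : V3} {m : ℝ}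
    (h : ∀ w ∈ W, m ≤ kq (x - w) ξ) :
    ENNReal.ofReal m * ∫⁻ v in W, ENNReal.ofReal (f v) ≤ AqE f x ξ := by
  unfold AqE
  rw [← lintegral_const_mul' _ _ ENNReal.ofReal_ne_top]
  refine (setLIntegral_mono' hW (fun w hw => ?_)).trans (setLIntegral_le_lintegral W _)
  rw [ENNReal.ofReal_mul (hf.nn w), mul_comm]
  gcongr
  exact h w hw

end
end LL

namespace LL
open scoped ENNReal

section
variable {f : V3 → ℝ} {Sg : ℝ}

lemma tube_vol (b : OrthonormalBasis (Fin 3) ℝ V3) (x : V3) {δ : ℝ} (hδ : 0 < δ) :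
    volume ({w : V3 | |inner ℝ (x - w) (b 0)| ≤ δ ∧ |inner ℝ (x - w) (b 1)| ≤ δ} ∩ Metric.ball 0 4) ≤
      ENNReal.ofReal (32 * δ ^ 2) := by
  set T := ({w : V3 | |inner ℝ (x - w) (b 0)| ≤ δ ∧ |inner ℝ (x - w) (b 1)| ≤ δ} ∩ Metric.ball 0 4)
  have hc1 : Continuous (fun w : V3 => |inner ℝ (x - w) (b 0)|) := by fun_prop
  have hc2 : Continuous (fun w : V3 => |inner ℝ (x - w) (b 1)|) := by fun_prop
  have hT : MeasurableSet T :=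
    (((isClosed_le hc1 continuous_const).inter (isClosed_le hc2 continuous_const)).measurableSet).inter
      measurableSet_ball
  rw [← (Pm_mp b).measure_preimage hT.nullMeasurableSet]
  have h : ∀ i j, inner ℝ (b i) (b j) = if i = j then (1:ℝ) else 0 :=
    orthonormal_iff_ite.1 b.orthonormal
  set x0 := inner ℝ x (b 0)
  set x1 := inner ℝ x (b 1)
  calc _ ≤ volume (Set.Icc (-4 : ℝ) 4 ×ˢ (Set.Icc (x0 - δ) (x0 + δ) ×ˢ Set.Icc (x1 - δ) (x1 + δ))) := by
        refine measure_mono ?_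
        rintro ⟨τ, u⟩ ⟨⟨h1, h2⟩, h3⟩
        have e0 : inner ℝ (x - Pm b (τ, u)) (b 0) = x0 - u.1 := by
          simp [Pm, inner_sub_left, inner_add_left, inner_smul_left, h, x0]
        have e1 : inner ℝ (x - Pm b (τ, u)) (b 1) = x1 - u.2 := by
          simp [Pm, inner_sub_left, inner_add_left, inner_smul_left, h, x1]
        have e2 : inner ℝ (Pm b (τ, u)) (b 2) = τ := by
          simp [Pm, inner_add_left, inner_smul_left, h]
        rw [e0, abs_le] at h1
        rw [e1, abs_le] at h2
        have h4 : |τ| ≤ 4 := by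
          rw [← e2]
          have := abs_real_inner_le_norm (Pm b (τ, u)) (b 2)
          simp at this h3
          linarith
        rw [abs_le] at h4
        exact ⟨h4, ⟨by linarith, by linarith⟩, by constructor <;> simp <;> linarith⟩
    _ = _ := by
        rw [Measure.volume_eq_prod, Measure.prod_prod, Measure.volume_eq_prod, Measure.prod_prod]
        simp only [Real.volume_Icc]
        rw [← ENNReal.ofReal_mul (by linarith), ← ENNReal.ofReal_mul (by norm_num)]
        congr 1; ring

lemma FH.nondeg (hf : FH f Sg) (x ξ : V3) :
    ENNReal.ofReal (‖ξ‖ ^ 2) ≤ ENNReal.ofReal (10 ^ 7 * Sg ^ 2 * jap x ^ 3) * AqE f x ξ := by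
  rcases eq_or_ne ξ 0 with h | h
  · simp [h]
  have hξ : 0 < ‖ξ‖ := norm_pos_iff.2 h
  have hS := hf.one
  have hS0 : 0 < Sg := by linarith
  obtain ⟨b, hb⟩ := exists_basis (‖ξ‖⁻¹ • ξ) (by rw [norm_smul]; simp; field_simp)
  set δ := 1 / (32 * Sg) with hδd
  have hδ : 0 < δ := by positivity
  set A := {w : V3 | |inner ℝ (x - w) (b 0)| ≤ δ ∧ |inner ℝ (x - w) (b 1)| ≤ δ}
  have hc1 : Continuous (fun w : V3 => |inner ℝ (x - w) (b 0)|) := by fun_prop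
  have hc2 : Continuous (fun w : V3 => |inner ℝ (x - w) (b 1)|) := by fun_prop
  have hA : MeasurableSet A :=
    ((isClosed_le hc1 continuous_const).inter (isClosed_le hc2 continuous_const)).measurableSet
  have h1 := hf.half hA ((tube_vol b x hδ).trans (ENNReal.ofReal_le_ofReal (by
    rw [hδd, div_pow, mul_pow]
    rw [one_pow, mul_one_div, div_le_div_iff₀ (by positivity) (by positivity)]
    nlinarith [sq_nonneg Sg])))
  have hJ := one_le_jap x
  set m := ‖ξ‖ ^ 2 * δ ^ 2 / (8 * π * (5 * jap x) ^ 3) with hm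
  have h2 := hf.Aq_ge (x := x) (ξ := ξ) (m := m) (W := Metric.ball 0 4 \ A) (measurableSet_ball.diff hA) (by
    rintro w ⟨hw, hwA⟩
    set z := x - w with hz
    have hzn : ‖z‖ ≤ 5 * jap x := by
      have : ‖z‖ ≤ ‖x‖ + ‖w‖ := norm_sub_le _ _
      simp at hw
      linarith [norm_le_jap x]
    have h3 : δ ^ 2 ≤ inner ℝ z (b 0) ^ 2 + inner ℝ z (b 1) ^ 2 := by
      by_contra hcon
      push Not at hcon
      apply hwA
      constructor
      · apply abs_le_of_sq_le_sq _ hδ.le; nlinarith [sq_nonneg (inner ℝ z (b 1))]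
      · apply abs_le_of_sq_le_sq _ hδ.le; nlinarith [sq_nonneg (inner ℝ z (b 0))]
    have hz0 : 0 < ‖z‖ := by
      rw [norm_pos_iff]; rintro h0
      rw [h0] at h3; simp at h3; nlinarith
    have h4 : PiSq z ξ = ‖ξ‖ ^ 2 * (inner ℝ z (b 0) ^ 2 + inner ℝ z (b 1) ^ 2) / ‖z‖ ^ 2 := by
      have e1 := norm_sq_basis b z
      have e2 : inner ℝ z (b 2) = ‖ξ‖⁻¹ * inner ℝ ξ z := by rw [hb, inner_smul_right, real_inner_comm]
      have e3 : inner ℝ z (b 0) ^ 2 + inner ℝ z (b 1) ^ 2 = ‖z‖ ^ 2 - (‖ξ‖⁻¹ * inner ℝ ξ z) ^ 2 := by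
        rw [← e2]; linarith
      rw [e3, PiSq]; field_simp
    unfold kq
    rw [h4, hm, div_div]
    apply div_le_div₀ (by positivity) (by gcongr) (by positivity)
    calc ‖z‖ ^ 2 * (8 * π * ‖z‖) = 8 * π * ‖z‖ ^ 3 := by ring
      _ ≤ _ := by gcongr)
  calc ENNReal.ofReal (‖ξ‖ ^ 2) ≤ ENNReal.ofReal (10 ^ 7 * Sg ^ 2 * jap x ^ 3) * (ENNReal.ofReal m * ENNReal.ofReal (1 / 2)) := by
        rw [← ENNReal.ofReal_mul (by positivity), ← ENNReal.ofReal_mul (by positivity)]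
        apply ENNReal.ofReal_le_ofReal
        have hp : π ≤ 4 := Real.pi_le_four
        have : 10 ^ 7 * Sg ^ 2 * jap x ^ 3 * (m * (1 / 2)) = ‖ξ‖ ^ 2 * (10 ^ 7 / (1024 * 2000 * π)) := by
          rw [hm, hδd]; field_simp; ring
        rw [this]
        have : 1 ≤ 10 ^ 7 / (1024 * 2000 * π) := by
          rw [le_div_iff₀ (by positivity)]; nlinarith [Real.pi_lt_d2]
        nlinarith [sq_nonneg ‖ξ‖]
    _ ≤ ENNReal.ofReal (10 ^ 7 * Sg ^ 2 * jap x ^ 3) * (ENNReal.ofReal m * ∫⁻ v in Metric.ball 0 4 \ A, ENNReal.ofReal (f v)) := by gcongr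
    _ ≤ _ := by gcongr

/-- far set of w -/
def Wf (c : V3) (d : ℝ) : Set V3 := Metric.ball 0 4 \ Metric.ball c d

lemma FH.far (hf : FH f Sg) (c : V3) :
    ENNReal.ofReal (1 / 2) ≤ ∫⁻ v in Wf c (jap c / (50 * Sg)), ENNReal.ofReal (f v) := by
  have hS := hf.one
  have hS0 : 0 < Sg := by linarith
  refine hf.half measurableSet_ball ?_
  have hJ := one_le_jap c
  have hJ2 := jap_le c
  rcases le_or_gt 8 ‖c‖ with h | h
  · have : Metric.ball c (jap c / (50 * Sg)) ∩ Metric.ball 0 4 = ∅ := by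
      rw [← Set.disjoint_iff_inter_eq_empty]
      apply Metric.ball_disjoint_ball
      rw [dist_zero_right]
      have : jap c / (50 * Sg) ≤ jap c / 50 := by
        apply div_le_div_of_nonneg_left (by linarith) (by norm_num) (by linarith)
      linarith
    rw [this]; simp
  · refine (measure_mono Set.inter_subset_left).trans ?_
    rw [EuclideanSpace.volume_ball_fin_three, ← ENNReal.ofReal_pow (by positivity), ← ENNReal.ofReal_mul (by positivity)]
    apply ENNReal.ofReal_le_ofReal
    have h1 : jap c / (50 * Sg) ≤ 9 / (50 * Sg) := by gcongr; linarith
    calc (jap c / (50 * Sg)) ^ 3 * (π * 4 / 3) ≤ (9 / (50 * Sg)) ^ 3 * (4 * 4 / 3) := by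
          gcongr; exact Real.pi_le_four
      _ ≤ 1 / (16 * Sg ^ 2) := by
        rw [div_pow, mul_pow, div_mul_eq_mul_div, div_le_div_iff₀ (by positivity) (by positivity)]
        nlinarith [sq_nonneg Sg, mul_nonneg (sq_nonneg Sg) (sub_nonneg.2 hS)]

lemma FH.N_le (hf : FH f Sg) {c : V3} {ρ : ℝ} (hρ1 : 8 * ρ ≤ 1 / 100 * jap c) (G : V3 → V3) :
    ∫⁻ q in Metric.ball c (8 * ρ), ENNReal.ofReal (‖G q‖ ^ 2) ≤
      ENNReal.ofReal (8 * 10 ^ 7 * Sg ^ 2 * jap c ^ 3) * ∫⁻ q in Metric.ball c (8 * ρ), AqE f q (G q) := by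
  have hJ := one_le_jap c
  rw [← lintegral_const_mul' _ _ ENNReal.ofReal_ne_top]
  refine setLIntegral_mono' measurableSet_ball (fun q hq => (hf.nondeg q (G q)).trans ?_)
  refine mul_le_mul_left (ENNReal.ofReal_le_ofReal ?_) _
  have : jap q ≤ 2 * jap c := by
    have h1 : ‖q - c‖ ≤ jap c / 100 := by
      simp only [Metric.mem_ball, dist_eq_norm] at hq; linarith
    have h2 : ‖q‖ ≤ ‖c‖ + ‖q - c‖ := by
      have := norm_add_le (q - c) c; rw [sub_add_cancel] at this; linarith
    have hjc : jap c ^ 2 = 1 + ‖c‖ ^ 2 := by unfold jap; rw [Real.sq_sqrt (by positivity)]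
    unfold jap
    rw [Real.sqrt_le_left (by positivity)]
    change 1 + ‖q‖ ^ 2 ≤ (2 * jap c) ^ 2
    nlinarith [norm_nonneg q, norm_nonneg c, norm_le_jap c]
  calc 10 ^ 7 * Sg ^ 2 * jap q ^ 3 ≤ 10 ^ 7 * Sg ^ 2 * (2 * jap c) ^ 3 := by
        gcongr; exact (zero_le_one.trans (one_le_jap q))
    _ = _ := by ring

lemma kq_meas (hfc : Continuous f) {G : V3 → V3} (hG : Continuous G) :
    Measurable (fun x : V3 × V3 => ENNReal.ofReal (f x.1 * kq (x.2 - x.1) (G x.2))) := by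
    apply Measurable.ennreal_ofReal
    unfold kq PiSq
    have m1 : Measurable (fun x : V3 × V3 => f x.1) := Continuous.measurable (by fun_prop)
    have m2 : Measurable (fun x : V3 × V3 => ‖G x.2‖ ^ 2) := Continuous.measurable (by fun_prop)
    have m3 : Measurable (fun x : V3 × V3 => inner ℝ (G x.2) (x.2 - x.1) ^ 2) := Continuous.measurable (by fun_prop)
    have m4 : Measurable (fun x : V3 × V3 => ‖x.2 - x.1‖ ^ 2) := Continuous.measurable (by fun_prop)
    have m5 : Measurable (fun x : V3 × V3 => 8 * π * ‖x.2 - x.1‖) := Continuous.measurable (by fun_prop)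
    exact m1.mul ((m2.sub (m3.div m4)).div m5)

lemma AqE_meas (hfc : Continuous f) {G : V3 → V3} (hG : Continuous G) :
    Measurable (fun q => AqE f q (G q)) := by
  unfold AqE
  exact (kq_meas hfc hG).lintegral_prod_left'

/-- averaging over directions -/
lemma FH.avg (hf : FH f Sg) {c : V3} {ρ : ℝ} (hρ : 0 < ρ) (hρS : ρ ≤ jap c / (800 * Sg))
    {G : V3 → V3} (hG : Continuous G) {K α Y : ℝ≥0∞} (hα : α ≠ ∞)
    (h : ∀ e : V3, ‖e‖ = 1 → K ≤ α * (∫⁻ q in Metric.ball c (8 * ρ),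
        ENNReal.ofReal (‖G q‖ ^ 2 - inner ℝ (G q) e ^ 2)) + Y) :
    K ≤ 2 * (α * ENNReal.ofReal (400 * jap c + 2 * 10 ^ 14 * ρ ^ 2 * Sg ^ 4 * jap c) * (∫⁻ q in Metric.ball c (8 * ρ), AqE f q (G q)) + Y) := by
  have hS := hf.one
  have hS0 : 0 < Sg := by linarith
  have hJ := one_le_jap c
  have hfc := hf.cont
  set d := jap c / (50 * Sg) with hd
  have hd0 : 0 < d := by positivity
  have hdρ : 16 * ρ ≤ d := by
    calc 16 * ρ ≤ 16 * (jap c / (800 * Sg)) := by linarith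
      _ = d := by rw [hd]; field_simp; ring
  set W := Wf c d
  have hW : MeasurableSet W := measurableSet_ball.diff measurableSet_ball
  set M := ∫⁻ v in W, ENNReal.ofReal (f v)
  have hM1 : M ≤ 1 := (setLIntegral_le_lintegral _ _).trans hf.mass
  have hM2 : ENNReal.ofReal (1 / 2) ≤ M := hf.far c
  set B := Metric.ball c (8 * ρ)
  have hB : MeasurableSet B := measurableSet_ball
  have hρ1 : 8 * ρ ≤ 1 / 100 * jap c := by
    have : jap c / (800 * Sg) ≤ jap c / 800 := by
        apply div_le_div_of_nonneg_left (by linarith) (by norm_num) (by linarith)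
    linarith
  -- pointwise inequality
  have hpt : ∀ w ∈ W, ∀ q ∈ B, PiSq (c - w) (G q) ≤
      400 * jap c * kq (q - w) (G q) + 512 * ρ ^ 2 / d ^ 2 * ‖G q‖ ^ 2 := by
    rintro w ⟨hw4, hwd⟩ q hq
    simp only [B, Metric.mem_ball, dist_eq_norm, not_lt, sub_zero] at hw4 hwd hq
    have hqw : d / 2 ≤ ‖q - w‖ := by
      have : ‖w - c‖ ≤ ‖q - w‖ + ‖q - c‖ := by
        calc ‖w - c‖ = ‖(q - c) - (q - w)‖ := by congr 1; abel
          _ ≤ ‖q - c‖ + ‖q - w‖ := norm_sub_le _ _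
          _ = _ := by ring
      linarith
    have hqw0 : 0 < ‖q - w‖ := by linarith
    have hqwu : ‖q - w‖ ≤ 6 * jap c := by
      calc ‖q - w‖ = ‖(q - c) + c - w‖ := by congr 1; abel
        _ ≤ ‖q - c‖ + ‖c‖ + ‖w‖ := (norm_sub_le _ _).trans (by gcongr; exact norm_add_le _ _)
        _ ≤ _ := by linarith [norm_le_jap c]
    have hne : q ≠ w := by rintro rfl; simp at hqw0
    have h1 := PiSq_compare (c := c) (ξ := G q) hne
    have h2 : PiSq (q - w) (G q) ≤ 200 * jap c * kq (q - w) (G q) := by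
      have : PiSq (q - w) (G q) = 8 * π * ‖q - w‖ * kq (q - w) (G q) := by
        unfold kq; field_simp
      have hk := kq_nonneg (q - w) (G q)
      calc _ = _ := this
        _ ≤ 8 * 4 * (6 * jap c) * kq (q - w) (G q) := by gcongr; exact Real.pi_le_four
        _ ≤ _ := by nlinarith
    have h3 : (‖q - c‖ / ‖q - w‖) ^ 2 ≤ (8 * ρ / (d / 2)) ^ 2 := by gcongr
    have h4 : (8 * ρ / (d / 2)) ^ 2 = 256 * ρ ^ 2 / d ^ 2 := by field_simp; norm_num
    rw [h4] at h3
    have h5 : 2 * ‖G q‖ ^ 2 * (‖q - c‖ / ‖q - w‖) ^ 2 ≤ 2 * ‖G q‖ ^ 2 * (256 * ρ ^ 2 / d ^ 2) := by gcongr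
    have h6 : 2 * ‖G q‖ ^ 2 * (256 * ρ ^ 2 / d ^ 2) = 512 * ρ ^ 2 / d ^ 2 * ‖G q‖ ^ 2 := by ring
    linarith
  have hkm := kq_meas hfc hG
  set D := ∫⁻ q in B, AqE f q (G q)
  set N := ∫⁻ q in B, ENNReal.ofReal (‖G q‖ ^ 2)
  have key : K * M ≤ α * (ENNReal.ofReal (400 * jap c) * D + ENNReal.ofReal (512 * ρ ^ 2 / d ^ 2) * N) + Y := by
    have s1 : K * M ≤ ∫⁻ w in W, (ENNReal.ofReal (f w) * (α * (∫⁻ q in B, ENNReal.ofReal (PiSq (c - w) (G q)))) + ENNReal.ofReal (f w) * Y) := by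
      rw [mul_comm, ← lintegral_mul_const'' _ (by fun_prop)]
      refine setLIntegral_mono' hW (fun w hw => ?_)
      rw [← mul_add]
      gcongr
      have hcw : 0 < ‖c - w‖ := by
        have := hw.2
        simp only [Metric.mem_ball, dist_eq_norm, not_lt] at this
        rw [norm_sub_rev]; linarith
      refine (h (‖c - w‖⁻¹ • (c - w)) (by rw [norm_smul]; simp; field_simp)).trans ?_
      gcongr with q
      apply le_of_eq
      rw [PiSq, inner_smul_right]; field_simp
    refine s1.trans ?_
    rw [lintegral_add_right _ (by fun_prop), lintegral_mul_const _ (by fun_prop)]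
    have s2 : (∫⁻ w in W, ENNReal.ofReal (f w)) * Y ≤ Y := by
      calc _ ≤ 1 * Y := by gcongr
        _ = Y := one_mul _
    refine add_le_add ?_ s2
    calc ∫⁻ w in W, ENNReal.ofReal (f w) * (α * ∫⁻ q in B, ENNReal.ofReal (PiSq (c - w) (G q)))
        ≤ ∫⁻ w in W, α * (ENNReal.ofReal (400 * jap c) * (∫⁻ q in B, ENNReal.ofReal (f w * kq (q - w) (G q)))
          + ENNReal.ofReal (f w) * (ENNReal.ofReal (512 * ρ ^ 2 / d ^ 2) * N)) := by
          refine setLIntegral_mono' hW (fun w hw => ?_)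
          rw [mul_left_comm]
          gcongr
          rw [← lintegral_const_mul' _ _ ENNReal.ofReal_ne_top, ← lintegral_const_mul' _ _ ENNReal.ofReal_ne_top,
            ← lintegral_const_mul' _ _ ENNReal.ofReal_ne_top, ← lintegral_const_mul' _ _ ENNReal.ofReal_ne_top,
            ← lintegral_add_right]
          · refine setLIntegral_mono' hB (fun q hq => ?_)
            have hk := kq_nonneg (q - w) (G q)
            have hfw := hf.nn w
            rw [← ENNReal.ofReal_mul hfw, ← ENNReal.ofReal_mul (by positivity), ← ENNReal.ofReal_mul (by positivity),
              ← ENNReal.ofReal_mul hfw, ← ENNReal.ofReal_add (by positivity) (by positivity)]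
            apply ENNReal.ofReal_le_ofReal
            have := mul_le_mul_of_nonneg_left (hpt w hw q hq) hfw
            linarith
          · have : Continuous (fun q => ‖G q‖ ^ 2) := by fun_prop
            exact ((this.measurable.ennreal_ofReal).const_mul _).const_mul _
      _ = α * (ENNReal.ofReal (400 * jap c) * (∫⁻ w in W, ∫⁻ q in B, ENNReal.ofReal (f w * kq (q - w) (G q)))
          + M * (ENNReal.ofReal (512 * ρ ^ 2 / d ^ 2) * N)) := by
          rw [lintegral_const_mul' _ _ hα, lintegral_add_right _ (by fun_prop),
            lintegral_const_mul' _ _ ENNReal.ofReal_ne_top, lintegral_mul_const _ (by fun_prop)]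
      _ ≤ α * (ENNReal.ofReal (400 * jap c) * D + 1 * (ENNReal.ofReal (512 * ρ ^ 2 / d ^ 2) * N)) := by
          gcongr
          rw [lintegral_lintegral_swap hkm.aemeasurable]
          refine lintegral_mono (fun q => ?_)
          exact setLIntegral_le_lintegral _ _
      _ = _ := by rw [one_mul]
  have hN : N ≤ ENNReal.ofReal (8 * 10 ^ 7 * Sg ^ 2 * jap c ^ 3) * D := hf.N_le hρ1 G
  have hfin : K ≤ 2 * (K * M) := by
    calc K = K * (2 * ENNReal.ofReal (1 / 2)) := by
            rw [show (2 : ℝ≥0∞) * ENNReal.ofReal (1 / 2) = 1 by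
              rw [show (1 / 2 : ℝ) = 2⁻¹ by norm_num, ENNReal.ofReal_inv_of_pos (by norm_num)]
              simp [ENNReal.mul_inv_cancel], mul_one]
      _ = 2 * (K * ENNReal.ofReal (1 / 2)) := by ring
      _ ≤ _ := by gcongr
  refine hfin.trans ?_
  refine mul_le_mul_right (key.trans ?_) 2
  refine add_le_add ?_ le_rfl
  rw [mul_assoc]
  refine mul_le_mul_right ?_ α
  calc _ ≤ ENNReal.ofReal (400 * jap c) * D + ENNReal.ofReal (512 * ρ ^ 2 / d ^ 2) * (ENNReal.ofReal (8 * 10 ^ 7 * Sg ^ 2 * jap c ^ 3) * D) := by gcongr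
    _ = ENNReal.ofReal (400 * jap c + 512 * ρ ^ 2 / d ^ 2 * (8 * 10 ^ 7 * Sg ^ 2 * jap c ^ 3)) * D := by
        rw [ENNReal.ofReal_add (by positivity) (by positivity), ENNReal.ofReal_mul (p := 512 * ρ ^ 2 / d ^ 2) (by positivity)]
        ring
    _ ≤ _ := by
        refine mul_le_mul_left (ENNReal.ofReal_le_ofReal ?_) D
        rw [hd]
        have : 512 * ρ ^ 2 / (jap c / (50 * Sg)) ^ 2 * (8 * 10 ^ 7 * Sg ^ 2 * jap c ^ 3) = 512 * 2500 * 8 * 10 ^ 7 * (ρ ^ 2 * Sg ^ 4 * jap c) := by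
          field_simp; ring
        rw [this]
        have : 0 ≤ ρ ^ 2 * Sg ^ 4 * jap c := by positivity
        nlinarith
end
end LL

namespace LL
open scoped ENNReal

section
variable {f : V3 → ℝ} {Sg : ℝ} {U : V3 → ℝ} {G : V3 → V3} {E : Set V3} {c : V3} {ρ ζ : ℝ}

lemma rho_small (hS : 1 ≤ Sg) (hρS : ρ ≤ jap c / (800 * Sg)) : 8 * ρ ≤ 1 / 100 * jap c := by
  have hJ := one_le_jap c
  have : jap c / (800 * Sg) ≤ jap c / 800 := by
      apply div_le_div_of_nonneg_left (by linarith) (by norm_num) (by linarith)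
  linarith

lemma ofReal_comb {a b c d : ℝ} (ha : 0 ≤ a) (hb : 0 ≤ b) (hc : 0 ≤ c) (hd : 0 ≤ d) (D : ℝ≥0∞) :
    2 * (ENNReal.ofReal a * ENNReal.ofReal b * D + ENNReal.ofReal c * (ENNReal.ofReal d * D)) =
      ENNReal.ofReal (2 * (a * b + c * d)) * D := by
  rw [ENNReal.ofReal_mul (p := 2) (by positivity), ENNReal.ofReal_add (by positivity) (by positivity), ENNReal.ofReal_mul ha,
        ENNReal.ofReal_mul hc, ENNReal.ofReal_ofNat]
  ring

theorem cell_s (hf : FH f Sg) (hU : ∀ x, HasFDerivAt U (innerSL ℝ (G x)) x) (hG : Continuous G)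
    (hE : MeasurableSet E) (hUE : ∀ x, U x ≠ 0 → x ∈ E) (hρ : 0 < ρ) (hζ : 0 < ζ) (hζρ : ζ ≤ ρ)
    (hρS : ρ ≤ jap c / (800 * Sg))
    (hvol : volume (E ∩ Metric.ball c (8 * ρ)) ≤ ENNReal.ofReal (2 * ρ ^ 2 * ζ)) :
    ∫⁻ p in Metric.ball c ρ, ENNReal.ofReal (U p ^ 2) ≤
      ENNReal.ofReal (2 * (12 * ρ ^ 2 * (400 * jap c + 2 * 10 ^ 14 * ρ ^ 2 * Sg ^ 4 * jap c) +
        4 * ζ ^ 2 * (8 * 10 ^ 7 * Sg ^ 2 * jap c ^ 3))) * ∫⁻ q in Metric.ball c (8 * ρ), AqE f q (G q) := by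
  have hS := hf.one
  have hJ := one_le_jap c
  set D := ∫⁻ q in Metric.ball c (8 * ρ), AqE f q (G q)
  set N := ∫⁻ q in Metric.ball c (8 * ρ), ENNReal.ofReal (‖G q‖ ^ 2) with hNd
  have hN : N ≤ ENNReal.ofReal (8 * 10 ^ 7 * Sg ^ 2 * jap c ^ 3) * D := hf.N_le (rho_small hS hρS) G
  have h1 := hf.avg hρ hρS hG (K := ∫⁻ p in Metric.ball c ρ, ENNReal.ofReal (U p ^ 2))
    (α := ENNReal.ofReal (12 * ρ ^ 2)) (Y := ENNReal.ofReal (4 * ζ ^ 2) * N) ENNReal.ofReal_ne_top (by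
      intro e he
      obtain ⟨b, hb⟩ := exists_basis e he
      have := cell (b := b) hU hG hE hUE hρ hζ hζρ hvol
      rw [hb] at this
      refine this.trans (add_le_add le_rfl ?_)
      rw [show 4 * ζ ^ 2 = 4 * ζ * ζ by ring, ENNReal.ofReal_mul (p := 4 * ζ) (by positivity), mul_assoc]
      refine mul_le_mul_right ?_ _
      rw [hNd, ← lintegral_const_mul' _ _ ENNReal.ofReal_ne_top]
      refine (lintegral_mono_set (Metric.ball_subset_ball (by linarith : 2 * ρ ≤ 8 * ρ))).trans ?_
      refine lintegral_mono (fun q => ?_)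
      refine mul_le_mul' (bq_le b E ρ ζ q) (ENNReal.ofReal_le_ofReal ?_)
      have h2 := PiSq_nonneg e (G q)
      unfold PiSq at h2
      rw [he] at h2; linarith)
  refine h1.trans ?_
  calc _ ≤ 2 * (ENNReal.ofReal (12 * ρ ^ 2) *
        ENNReal.ofReal (400 * jap c + 2 * 10 ^ 14 * ρ ^ 2 * Sg ^ 4 * jap c) * D + ENNReal.ofReal (4 * ζ ^ 2) * (ENNReal.ofReal (8 * 10 ^ 7 * Sg ^ 2 * jap c ^ 3) * D)) := by gcongr
    _ = _ := ofReal_comb (by positivity) (by positivity) (by positivity) (by positivity) D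

lemma bad_L (hf : FH f Sg) {e : V3} (b : OrthonormalBasis (Fin 3) ℝ V3) (hb : b 2 = e) (hG : Continuous G) (he : ‖e‖ = 1) (hE : MeasurableSet E)
    {l : ℝ} (hl : 0 < l) (hEl : ∀ x ∈ E, l / 2 ≤ f x) (hρ : 0 < ρ) (hζ : 0 < ζ) (hζρ : ζ ≤ ρ)
    (hvol : volume (E ∩ Metric.ball c (8 * ρ)) ≤ ENNReal.ofReal (2 * ρ ^ 2 * ζ)) {q : V3} (hq : q ∈ Metric.ball c (2 * ρ)) :
    bq b E ρ ζ q * ENNReal.ofReal (inner ℝ (G q) e ^ 2) ≤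
      ENNReal.ofReal (55296 / (ρ * l)) * AqE f q (G q) +
      ENNReal.ofReal (576 * ζ) * ENNReal.ofReal (‖G q‖ ^ 2 - inner ℝ (G q) e ^ 2) := by
  have h1 := bq_Eoff b hE hρ hζρ q
  rw [hb] at h1
  set F := Eoff E e ρ q
  have hF : MeasurableSet F := Eoff_meas hE e ρ q
  have hFv : volume F ≤ ENNReal.ofReal (2 * ρ ^ 2 * ζ) := by
    refine (measure_mono ?_).trans hvol
    rintro x ⟨hx, hx1, -⟩
    refine ⟨hx, ?_⟩
    simp only [Metric.mem_ball, dist_eq_norm] at hq ⊢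
    have : ‖x - c‖ ≤ ‖x - q‖ + ‖q - c‖ := norm_sub_le_norm_sub_add_norm_sub x q c
    linarith
  set P := ‖G q‖ ^ 2 - inner ℝ (G q) e ^ 2
  have hP : 0 ≤ P := by
    have h2 := PiSq_nonneg e (G q)
    unfold PiSq at h2
    rw [he] at h2; simpa [P] using h2
  have hpt : ∀ x ∈ F, inner ℝ (G q) e ^ 2 ≤ 55296 * ρ / l * (f x * kq (q - x) (G q)) + 288 * P := by
    rintro x ⟨hxE, hx1, hx2⟩
    set z := q - x with hz
    have hzn : ‖x - q‖ = ‖z‖ := norm_sub_rev _ _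
    have hin : inner ℝ (x - q) e ^ 2 = inner ℝ e z ^ 2 := by
      rw [show x - q = -z by simp [z], inner_neg_left, neg_sq, real_inner_comm]
    rw [hzn] at hx1 hx2
    rw [hin] at hx2
    have hz0 : 0 < ‖z‖ := by
      rcases (norm_nonneg z).eq_or_lt with h | h
      · rw [← h] at hx2; nlinarith [sq_nonneg (inner ℝ e z)]
      · exact h
    have h3 : 1 / 144 ≤ PiSq z e := by
      have : PiSq z e = (‖z‖ ^ 2 - inner ℝ e z ^ 2) / ‖z‖ ^ 2 := by
        unfold PiSq; rw [he]; field_simp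
      rw [this, le_div_iff₀ (by positivity)]
      nlinarith
    have h4 := PiSq_split (z := z) (ξ := G q) he
    have h5 : inner ℝ (G q) e ^ 2 ≤ 288 * PiSq z (G q) + 288 * P := by
      have := mul_le_mul_of_nonneg_left h3 (sq_nonneg (inner ℝ (G q) e))
      linarith
    have h6 : PiSq z (G q) ≤ 192 * ρ / l * (f x * kq z (G q)) := by
      have : PiSq z (G q) = 8 * π * ‖z‖ * kq z (G q) := by
        unfold kq; field_simp
      have hk := kq_nonneg z (G q)
      calc _ = _ := this
        _ ≤ 8 * 4 * (3 * ρ) * kq z (G q) := by gcongr; exact Real.pi_le_four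
        _ = 192 * ρ / l * (l / 2 * kq z (G q)) := by field_simp; ring
        _ ≤ _ := by gcongr; exact hEl x hxE
    have h7 : 288 * (192 * ρ / l * (f x * kq z (G q))) = 55296 * ρ / l * (f x * kq z (G q)) := by ring
    linarith
  have h2 : volume F * ENNReal.ofReal (inner ℝ (G q) e ^ 2) ≤ ENNReal.ofReal (55296 * ρ / l) * AqE f q (G q) +
      ENNReal.ofReal (288 * P) * volume F := by
    calc volume F * ENNReal.ofReal (inner ℝ (G q) e ^ 2) = ∫⁻ x in F, ENNReal.ofReal (inner ℝ (G q) e ^ 2) := by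
          simp [mul_comm]
      _ ≤ ∫⁻ x in F, (ENNReal.ofReal (55296 * ρ / l) * ENNReal.ofReal (f x * kq (q - x) (G q)) + ENNReal.ofReal (288 * P)) := by
          refine setLIntegral_mono' hF (fun x hx => ?_)
          have hk := kq_nonneg (q - x) (G q)
          have hfx := hf.nn x
          rw [← ENNReal.ofReal_mul (by positivity), ← ENNReal.ofReal_add (by positivity) (by positivity)]
          exact ENNReal.ofReal_le_ofReal (hpt x hx)
      _ = ENNReal.ofReal (55296 * ρ / l) * (∫⁻ x in F, ENNReal.ofReal (f x * kq (q - x) (G q))) + ENNReal.ofReal (288 * P) * volume F := by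
          rw [lintegral_add_right _ measurable_const, lintegral_const_mul' _ _ ENNReal.ofReal_ne_top]
          simp
      _ ≤ _ := by
          gcongr
          exact setLIntegral_le_lintegral _ _
  have hi : ENNReal.ofReal (1 / ρ ^ 2) * ENNReal.ofReal (ρ ^ 2) = 1 := by
    rw [← ENNReal.ofReal_mul (by positivity), one_div_mul_cancel (by positivity)]; simp
  calc bq b E ρ ζ q * ENNReal.ofReal (inner ℝ (G q) e ^ 2)
      = ENNReal.ofReal (1 / ρ ^ 2) * ENNReal.ofReal (ρ ^ 2) * bq b E ρ ζ q * ENNReal.ofReal (inner ℝ (G q) e ^ 2) := by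
        rw [hi, one_mul]
    _ = ENNReal.ofReal (1 / ρ ^ 2) * ((ENNReal.ofReal (ρ ^ 2) * bq b E ρ ζ q) * ENNReal.ofReal (inner ℝ (G q) e ^ 2)) := by ring
    _ ≤ ENNReal.ofReal (1 / ρ ^ 2) * (volume F * ENNReal.ofReal (inner ℝ (G q) e ^ 2)) := by gcongr
    _ ≤ ENNReal.ofReal (1 / ρ ^ 2) * (ENNReal.ofReal (55296 * ρ / l) * AqE f q (G q) +
      ENNReal.ofReal (288 * P) * ENNReal.ofReal (2 * ρ ^ 2 * ζ)) := by
        refine mul_le_mul_right (h2.trans ?_) _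
        gcongr
    _ = _ := by
        rw [mul_add, ← mul_assoc]
        congr 1
        · rw [← ENNReal.ofReal_mul (by positivity)]
          congr 2; field_simp
        · rw [← ENNReal.ofReal_mul (by positivity), ← ENNReal.ofReal_mul (by positivity), ← ENNReal.ofReal_mul (by positivity)]
          congr 1; field_simp; ring

theorem cell_L (hf : FH f Sg) (hU : ∀ x, HasFDerivAt U (innerSL ℝ (G x)) x) (hG : Continuous G)
    (hE : MeasurableSet E) (hUE : ∀ x, U x ≠ 0 → x ∈ E) (hρ : 0 < ρ) (hζ : 0 < ζ) (hζρ : ζ ≤ ρ)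
    (hρS : ρ ≤ jap c / (800 * Sg)) {l : ℝ} (hl : 0 < l) (hEl : ∀ x ∈ E, l / 2 ≤ f x)
    (hvol : volume (E ∩ Metric.ball c (8 * ρ)) ≤ ENNReal.ofReal (2 * ρ ^ 2 * ζ)) :
    ∫⁻ p in Metric.ball c ρ, ENNReal.ofReal (U p ^ 2) ≤
      ENNReal.ofReal (2 * (2316 * ρ ^ 2 * (400 * jap c + 2 * 10 ^ 14 * ρ ^ 2 * Sg ^ 4 * jap c) +
        4 * ζ * (55296 / (ρ * l)))) * ∫⁻ q in Metric.ball c (8 * ρ), AqE f q (G q) := by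
  have hS := hf.one
  have hJ := one_le_jap c
  set D := ∫⁻ q in Metric.ball c (8 * ρ), AqE f q (G q) with hD
  have h1 := hf.avg hρ hρS hG (K := ∫⁻ p in Metric.ball c ρ, ENNReal.ofReal (U p ^ 2))
    (α := ENNReal.ofReal (2316 * ρ ^ 2)) (Y := ENNReal.ofReal (4 * ζ * (55296 / (ρ * l))) * D) ENNReal.ofReal_ne_top (by
      intro e he
      obtain ⟨b, hb⟩ := exists_basis e he
      have := cell (b := b) hU hG hE hUE hρ hζ hζρ hvol
      rw [hb] at this
      refine this.trans ?_
      set P := ∫⁻ q in Metric.ball c (8 * ρ), ENNReal.ofReal (‖G q‖ ^ 2 - inner ℝ (G q) e ^ 2)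
      have h2 : ∫⁻ q in Metric.ball c (2 * ρ), bq b E ρ ζ q * ENNReal.ofReal (inner ℝ (G q) e ^ 2) ≤
          ENNReal.ofReal (55296 / (ρ * l)) * D + ENNReal.ofReal (576 * ζ) * P := by
        calc _ ≤ ∫⁻ q in Metric.ball c (2 * ρ), (ENNReal.ofReal (55296 / (ρ * l)) * AqE f q (G q) +
              ENNReal.ofReal (576 * ζ) * ENNReal.ofReal (‖G q‖ ^ 2 - inner ℝ (G q) e ^ 2)) :=
              setLIntegral_mono' measurableSet_ball (fun q hq => bad_L hf b hb hG he hE hl hEl hρ hζ hζρ hvol hq)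
          _ ≤ ∫⁻ q in Metric.ball c (8 * ρ), (ENNReal.ofReal (55296 / (ρ * l)) * AqE f q (G q) +
              ENNReal.ofReal (576 * ζ) * ENNReal.ofReal (‖G q‖ ^ 2 - inner ℝ (G q) e ^ 2)) :=
              lintegral_mono_set (Metric.ball_subset_ball (by linarith : 2 * ρ ≤ 8 * ρ))
          _ = _ := by
              rw [lintegral_add_left ((AqE_meas hf.cont hG).const_mul _), lintegral_const_mul' _ _ ENNReal.ofReal_ne_top,
                lintegral_const_mul' _ _ ENNReal.ofReal_ne_top]
      calc _ ≤ ENNReal.ofReal (12 * ρ ^ 2) * P + ENNReal.ofReal (4 * ζ) * (ENNReal.ofReal (55296 / (ρ * l)) * D + ENNReal.ofReal (576 * ζ) * P) := by gcongr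
        _ = ENNReal.ofReal (12 * ρ ^ 2 + 4 * ζ * (576 * ζ)) * P + ENNReal.ofReal (4 * ζ * (55296 / (ρ * l))) * D := by
            rw [ENNReal.ofReal_add (by positivity) (by positivity), ENNReal.ofReal_mul (p := 4 * ζ) (by positivity),
              ENNReal.ofReal_mul (p := 4 * ζ) (by positivity)]
            ring
        _ ≤ _ := by
            gcongr
            nlinarith)
  refine h1.trans (le_of_eq ?_)
  rw [← ofReal_comb (by positivity) (by positivity) (by positivity) (by positivity), ENNReal.ofReal_mul (p := 4 * ζ) (by positivity), mul_assoc (ENNReal.ofReal (4 * ζ))]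
end
end LL

namespace LL
open scoped ENNReal

lemma vol_ball (p : V3) {r : ℝ} (hr : 0 ≤ r) : volume (Metric.ball p r) = ENNReal.ofReal (r ^ 3 * (π * 4 / 3)) := by
  rw [EuclideanSpace.volume_ball_fin_three, ← ENNReal.ofReal_pow hr, ← ENNReal.ofReal_mul (by positivity)]

theorem cover {ρ : V3 → ℝ} (hρc : Continuous ρ) (h0 : ∀ c, 0 < ρ c) (h8 : ∀ c, 8 * ρ c ≤ 1)
    (hcmp : ∀ c p, ‖c - p‖ ≤ 1 → ρ c ≤ 2 * ρ p) {u D : V3 → ℝ≥0∞} (hu : Measurable u) (hD : Measurable D)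
    {Q : ℝ≥0∞} (hQ : Q ≠ ∞)
    (h : ∀ c, ∫⁻ p in Metric.ball c (ρ c), u p ≤ Q * ∫⁻ p in Metric.ball c (8 * ρ c), D p) :
    ∫⁻ p, u p ≤ ENNReal.ofReal (2 ^ 21) * Q * ∫⁻ p, D p := by
  set w : V3 → ℝ≥0∞ := fun c => ENNReal.ofReal ((ρ c)⁻¹ ^ 3) with hw
  have hwm : Measurable w := by
    have : Measurable ρ := hρc.measurable
    exact ((this.inv).pow_const 3).ennreal_ofReal
  -- generic swap
  have swap : ∀ (A : ℝ) (g : V3 → ℝ≥0∞), Measurable g →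
      ∫⁻ c, w c * ∫⁻ p in Metric.ball c (A * ρ c), g p = ∫⁻ p, g p * ∫⁻ c in {c | ‖p - c‖ < A * ρ c}, w c := by
    intro A g hg
    have hS : MeasurableSet {x : V3 × V3 | ‖x.2 - x.1‖ < A * ρ x.1} := by
      have c1 : Continuous (fun x : V3 × V3 => ‖x.2 - x.1‖) := by fun_prop
      have c2 : Continuous (fun x : V3 × V3 => A * ρ x.1) := by fun_prop
      exact (isOpen_lt c1 c2).measurableSet
    have hm : Measurable (fun x : V3 × V3 => {x : V3 × V3 | ‖x.2 - x.1‖ < A * ρ x.1}.indicator (fun x => w x.1 * g x.2) x) :=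
      ((hwm.comp measurable_fst).mul (hg.comp measurable_snd)).indicator hS
    calc ∫⁻ c, w c * ∫⁻ p in Metric.ball c (A * ρ c), g p
        = ∫⁻ c, ∫⁻ p, {x : V3 × V3 | ‖x.2 - x.1‖ < A * ρ x.1}.indicator (fun x => w x.1 * g x.2) (c, p) := by
          refine lintegral_congr (fun c => ?_)
          rw [← lintegral_const_mul _ hg, ← lintegral_indicator measurableSet_ball]
          refine lintegral_congr (fun p => ?_)
          simp [Set.indicator, Metric.mem_ball, dist_eq_norm]
      _ = ∫⁻ p, ∫⁻ c, {x : V3 × V3 | ‖x.2 - x.1‖ < A * ρ x.1}.indicator (fun x => w x.1 * g x.2) (c, p) :=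
          lintegral_lintegral_swap hm.aemeasurable
      _ = _ := by
          refine lintegral_congr (fun p => ?_)
          rw [← lintegral_const_mul _ hwm]
          have c1 : Continuous (fun x : V3 => ‖p - x‖) := by fun_prop
          have c2 : Continuous (fun x : V3 => A * ρ x) := by fun_prop
          rw [← lintegral_indicator (isOpen_lt c1 c2).measurableSet]
          refine lintegral_congr (fun c => ?_)
          simp [Set.indicator, mul_comm]
  have low : ∀ p, ENNReal.ofReal (π / 48) ≤ ∫⁻ c in {c | ‖p - c‖ < 1 * ρ c}, w c := by
    intro p
    have hp := h0 p
    have h8p := h8 p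
    have hsub : Metric.ball p (ρ p / 2) ⊆ {c | ‖p - c‖ < 1 * ρ c} := by
      intro c hc
      simp only [Metric.mem_ball, dist_eq_norm] at hc
      have h1 : ‖p - c‖ < ρ p / 2 := by rw [norm_sub_rev]; exact hc
      have := hcmp p c (by linarith)
      simp only [Set.mem_ofPred_eq]; linarith
    calc ENNReal.ofReal (π / 48) = ENNReal.ofReal ((2 * ρ p)⁻¹ ^ 3) * volume (Metric.ball p (ρ p / 2)) := by
          rw [vol_ball p (by positivity), ← ENNReal.ofReal_mul (by positivity)]
          congr 1; field_simp; norm_num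
      _ = ∫⁻ c in Metric.ball p (ρ p / 2), ENNReal.ofReal ((2 * ρ p)⁻¹ ^ 3) := by simp
      _ ≤ ∫⁻ c in Metric.ball p (ρ p / 2), w c := by
          refine setLIntegral_mono' measurableSet_ball (fun c hc => ENNReal.ofReal_le_ofReal ?_)
          simp only [Metric.mem_ball, dist_eq_norm] at hc
          have hc0 := h0 c
          have := hcmp c p (by linarith)
          gcongr
      _ ≤ _ := lintegral_mono_set hsub
  have high : ∀ p, ∫⁻ c in {c | ‖p - c‖ < 8 * ρ c}, w c ≤ ENNReal.ofReal (2 ^ 15 * (π * 4 / 3)) := by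
    intro p
    have hp := h0 p
    have h1 : ∀ c, ‖p - c‖ < 8 * ρ c → ρ p ≤ 2 * ρ c ∧ ρ c ≤ 2 * ρ p := by
      intro c hc
      have := h8 c
      exact ⟨hcmp p c (by linarith), hcmp c p (by rw [norm_sub_rev]; linarith)⟩
    have c1 : Continuous (fun x : V3 => ‖p - x‖) := by fun_prop
    have c2 : Continuous (fun x : V3 => 8 * ρ x) := by fun_prop
    calc ∫⁻ c in {c | ‖p - c‖ < 8 * ρ c}, w c ≤ ∫⁻ c in {c | ‖p - c‖ < 8 * ρ c}, ENNReal.ofReal ((ρ p / 2)⁻¹ ^ 3) := by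
          refine setLIntegral_mono' (isOpen_lt c1 c2).measurableSet (fun c hc => ENNReal.ofReal_le_ofReal ?_)
          have := (h1 c hc).1
          have hc0 := h0 c
          gcongr
          linarith
      _ ≤ ∫⁻ c in Metric.ball p (16 * ρ p), ENNReal.ofReal ((ρ p / 2)⁻¹ ^ 3) := by
          refine lintegral_mono_set (fun c hc => ?_)
          have h2 := (h1 c hc).2
          simp only [Set.mem_ofPred_eq] at hc
          rw [Metric.mem_ball, dist_eq_norm, norm_sub_rev]; linarith
      _ = _ := by
          simp only [lintegral_const, MeasurableSet.univ, Measure.restrict_apply, Set.univ_inter]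
          rw [vol_ball p (by positivity), ← ENNReal.ofReal_mul (by positivity)]
          congr 1; field_simp; norm_num
  have main : ENNReal.ofReal (π / 48) * ∫⁻ p, u p ≤ Q * (ENNReal.ofReal (2 ^ 15 * (π * 4 / 3)) * ∫⁻ p, D p) := by
    calc ENNReal.ofReal (π / 48) * ∫⁻ p, u p = ∫⁻ p, u p * ENNReal.ofReal (π / 48) := by
          rw [lintegral_mul_const _ hu, mul_comm]
      _ ≤ ∫⁻ p, u p * ∫⁻ c in {c | ‖p - c‖ < 1 * ρ c}, w c := lintegral_mono (fun p => mul_le_mul_right (low p) _)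
      _ = ∫⁻ c, w c * ∫⁻ p in Metric.ball c (1 * ρ c), u p := (swap 1 u hu).symm
      _ ≤ ∫⁻ c, Q * (w c * ∫⁻ p in Metric.ball c (8 * ρ c), D p) := by
          refine lintegral_mono (fun c => ?_)
          rw [mul_left_comm]
          refine mul_le_mul_right ?_ _
          rw [one_mul]; exact h c
      _ = Q * ∫⁻ p, D p * ∫⁻ c in {c | ‖p - c‖ < 8 * ρ c}, w c := by
          rw [lintegral_const_mul' _ _ hQ, swap 8 D hD]
      _ ≤ Q * ∫⁻ p, D p * ENNReal.ofReal (2 ^ 15 * (π * 4 / 3)) := by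
          refine mul_le_mul_right (lintegral_mono (fun p => mul_le_mul_right (high p) _)) _
      _ = _ := by rw [lintegral_mul_const _ hD]; ring
  have e1 : ENNReal.ofReal (48 / π) * ENNReal.ofReal (π / 48) = 1 := by
    rw [← ENNReal.ofReal_mul (by positivity)]
    rw [show 48 / π * (π / 48) = 1 by field_simp]; simp
  calc ∫⁻ p, u p = ENNReal.ofReal (48 / π) * (ENNReal.ofReal (π / 48) * ∫⁻ p, u p) := by
        rw [← mul_assoc, e1, one_mul]
    _ ≤ ENNReal.ofReal (48 / π) * (Q * (ENNReal.ofReal (2 ^ 15 * (π * 4 / 3)) * ∫⁻ p, D p)) := by gcongr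
    _ = (ENNReal.ofReal (48 / π) * ENNReal.ofReal (2 ^ 15 * (π * 4 / 3))) * Q * ∫⁻ p, D p := by ring
    _ = _ := by
        rw [← ENNReal.ofReal_mul (by positivity)]
        congr 3; field_simp; norm_num

section
variable {f : V3 → ℝ} {Sg : ℝ} {U : V3 → ℝ} {G : V3 → V3} {E : Set V3} {x : ℝ}

lemma sqrt_jap_cmp {c p : V3} (h : ‖c - p‖ ≤ 1) : √(jap p) ≤ 2 * √(jap c) := by
  have h1 : jap p ≤ 2 * jap c := jap_le_two (by rw [norm_sub_rev]; exact h)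
  have := one_le_jap c
  rw [Real.sqrt_le_left (by positivity), mul_pow, Real.sq_sqrt (by linarith)]
  linarith

lemma one_le_sqrt_jap (c : V3) : 1 ≤ √(jap c) := Real.one_le_sqrt.2 (one_le_jap c)

theorem static_s (hf : FH f Sg) (hU : ∀ x, HasFDerivAt U (innerSL ℝ (G x)) x) (hG : Continuous G)
    (hE : MeasurableSet E) (hUE : ∀ x, U x ≠ 0 → x ∈ E) (hx : 0 < x) (hxS : 800 * Sg * x ≤ 1)
    (hvol : ∀ c, volume (E ∩ Metric.ball c 1) ≤ ENNReal.ofReal (2 * x ^ 3 / √(jap c) ^ 5)) :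
    ∫⁻ p, ENNReal.ofReal (U p ^ 2) ≤ ENNReal.ofReal (10 ^ 17 * Sg ^ 2 * x ^ 2) * ∫⁻ q, AqE f q (G q) := by
  have hS := hf.one
  have hUc : Continuous U := continuous_iff_continuousAt.2 (fun x => (hU x).continuousAt)
  have hjs : ∀ c : V3, 0 < √(jap c) := fun c => by linarith [one_le_sqrt_jap c]
  have hx1 : 800 * x ≤ 1 := by nlinarith
  have := cover (ρ := fun c => x / √(jap c)) (u := fun p => ENNReal.ofReal (U p ^ 2)) (D := fun q => AqE f q (G q))
    (Q := ENNReal.ofReal (10 ^ 10 * Sg ^ 2 * x ^ 2))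
    (by
      have := jap_continuous
      exact continuous_const.div (by fun_prop) (fun c => (hjs c).ne'))
    (fun c => by have := hjs c; positivity)
    (fun c => by
      have := one_le_sqrt_jap c
      rw [← mul_div_assoc, div_le_one (hjs c)]; linarith)
    (fun c p h => by
      have h1 := sqrt_jap_cmp h
      have h2 := hjs c
      have h3 := hjs p
      rw [← mul_div_assoc, div_le_div_iff₀ h2 h3]; nlinarith)
    (by fun_prop) (AqE_meas hf.cont hG) ENNReal.ofReal_ne_top (fun c => by
      have h1 := one_le_sqrt_jap c
      set s := √(jap c) with hs
      have hs2 : jap c = s ^ 2 := by rw [hs, Real.sq_sqrt (by linarith [one_le_jap c])]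
      have hs0 : 0 < s := by linarith
      have hρ8 : 8 * (x / s) ≤ 1 := by rw [← mul_div_assoc, div_le_one hs0]; linarith
      refine (cell_s hf hU hG hE hUE (ρ := x / s) (ζ := x / s ^ 3) (by positivity) (by positivity) ?_ ?_ ?_).trans ?_
      · apply div_le_div_of_nonneg_left hx.le hs0; nlinarith [sq_nonneg s, mul_nonneg (sq_nonneg s) hs0.le]
      · rw [hs2, div_le_div_iff₀ hs0 (by positivity)]
        nlinarith [mul_nonneg (sq_nonneg s) hs0.le, mul_nonneg (sub_nonneg.2 h1) (sq_nonneg s)]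
      · refine (measure_mono (Set.inter_subset_inter_right _ (Metric.ball_subset_ball hρ8))).trans ((hvol c).trans ?_)
        refine ENNReal.ofReal_le_ofReal (le_of_eq ?_)
        rw [← hs]; field_simp
      · refine mul_le_mul_left (ENNReal.ofReal_le_ofReal ?_) _
        rw [hs2]
        have e : 2 * (12 * (x / s) ^ 2 * (400 * s ^ 2 + 2 * 10 ^ 14 * (x / s) ^ 2 * Sg ^ 4 * s ^ 2) +
          4 * (x / s ^ 3) ^ 2 * (8 * 10 ^ 7 * Sg ^ 2 * (s ^ 2) ^ 3)) =
          x ^ 2 * (9600 + 48 * 10 ^ 14 * (Sg * x) ^ 2 * Sg ^ 2 / s ^ 2 + 64 * 10 ^ 7 * Sg ^ 2) := by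
          field_simp; ring
        rw [e]
        have h2 : 48 * 10 ^ 14 * (Sg * x) ^ 2 * Sg ^ 2 / s ^ 2 ≤ 48 * 10 ^ 14 * (1 / 800) ^ 2 * Sg ^ 2 := by
          rw [div_le_iff₀ (by positivity)]
          have : (Sg * x) ^ 2 ≤ (1 / 800) ^ 2 := by
            have : Sg * x ≤ 1 / 800 := by linarith
            have : 0 ≤ Sg * x := by positivity
            gcongr
          calc 48 * 10 ^ 14 * (Sg * x) ^ 2 * Sg ^ 2 ≤ 48 * 10 ^ 14 * (1 / 800) ^ 2 * Sg ^ 2 * 1 := by rw [mul_one]; gcongr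
            _ ≤ _ := by gcongr; nlinarith
        have hS2 : 1 ≤ Sg ^ 2 := by nlinarith
        calc _ ≤ x ^ 2 * (10 ^ 10 * Sg ^ 2) := by
              gcongr
              nlinarith
          _ = _ := by ring)
  refine this.trans ?_
  rw [← ENNReal.ofReal_mul (by positivity)]
  refine mul_le_mul_left (ENNReal.ofReal_le_ofReal ?_) _
  nlinarith [mul_nonneg (sq_nonneg Sg) (sq_nonneg x)]

theorem static_L (hf : FH f Sg) (hU : ∀ x, HasFDerivAt U (innerSL ℝ (G x)) x) (hG : Continuous G)
    (hE : MeasurableSet E) (hUE : ∀ x, U x ≠ 0 → x ∈ E) (hx : 0 < x) (hx1 : 800 * x ≤ 1)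
    {l : ℝ} (hl : Sg ^ 4 ≤ l) (hEl : ∀ x ∈ E, l / 2 ≤ f x)
    (hvol : ∀ c, volume (E ∩ Metric.ball c 1) ≤ ENNReal.ofReal (2 * x ^ 5 / (√l * √(jap c)) ^ 3)) :
    ∫⁻ p, ENNReal.ofReal (U p ^ 2) ≤ ENNReal.ofReal (10 ^ 25 * x ^ 2 / l) * ∫⁻ q, AqE f q (G q) := by
  have hS := hf.one
  have hl1 : 1 ≤ l := le_trans (one_le_pow₀ hS) hl
  have hUc : Continuous U := continuous_iff_continuousAt.2 (fun x => (hU x).continuousAt)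
  have hjs : ∀ c : V3, 0 < √(jap c) := fun c => by linarith [one_le_sqrt_jap c]
  set a := √l with ha
  have ha2 : l = a ^ 2 := by rw [ha, Real.sq_sqrt (by linarith)]
  have ha1 : 1 ≤ a := Real.one_le_sqrt.2 hl1
  have haS : Sg ≤ a := by
    apply Real.le_sqrt_of_sq_le
    refine le_trans ?_ hl
    exact pow_le_pow_right₀ hS (by norm_num)
  have ha0 : 0 < a := by linarith
  have := cover (ρ := fun c => x / (a * √(jap c))) (u := fun p => ENNReal.ofReal (U p ^ 2)) (D := fun q => AqE f q (G q))
    (Q := ENNReal.ofReal (10 ^ 18 * x ^ 2 / l))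
    (by
      have := jap_continuous
      exact continuous_const.div (by fun_prop) (fun c => (mul_pos ha0 (hjs c)).ne'))
    (fun c => by have := hjs c; positivity)
    (fun c => by
      have := one_le_sqrt_jap c
      rw [← mul_div_assoc, div_le_one (mul_pos ha0 (hjs c))]; nlinarith)
    (fun c p h => by
      have h1 := sqrt_jap_cmp h
      have h2 := hjs c
      have h3 := hjs p
      rw [← mul_div_assoc, div_le_div_iff₀ (by positivity) (by positivity)]
      calc x * (a * √(jap p)) ≤ x * (a * (2 * √(jap c))) := by gcongr
        _ = _ := by ring)
    (by fun_prop) (AqE_meas hf.cont hG) ENNReal.ofReal_ne_top (fun c => by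
      have h1 := one_le_sqrt_jap c
      set s := √(jap c) with hs
      have hs2 : jap c = s ^ 2 := by rw [hs, Real.sq_sqrt (by linarith [one_le_jap c])]
      have hs0 : 0 < s := by linarith
      have has : 1 ≤ a * s := by nlinarith
      have hρ8 : 8 * (x / (a * s)) ≤ 1 := by rw [← mul_div_assoc, div_le_one (by positivity)]; linarith
      refine (cell_L hf hU hG hE hUE (ρ := x / (a * s)) (ζ := x ^ 3 / (a * s)) (l := l) (by positivity) (by positivity) ?_ ?_ (by linarith) hEl ?_).trans ?_
      · apply div_le_div_of_nonneg_right _ (by positivity); nlinarith [sq_nonneg x]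
      · rw [hs2, div_le_div_iff₀ (by positivity) (by positivity)]
        calc x * (800 * Sg) = (800 * x) * Sg := by ring
          _ ≤ 1 * a := by gcongr
          _ ≤ s ^ 2 * (a * s) := by
            have : 1 ≤ s ^ 3 := one_le_pow₀ h1
            nlinarith
      · refine (measure_mono (Set.inter_subset_inter_right _ (Metric.ball_subset_ball hρ8))).trans ((hvol c).trans ?_)
        refine ENNReal.ofReal_le_ofReal (le_of_eq ?_)
        rw [← hs]; field_simp
      · refine mul_le_mul_left (ENNReal.ofReal_le_ofReal ?_) _
        rw [hs2]
        have h2 : (x / (a * s)) ^ 2 * Sg ^ 4 ≤ 1 := by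
          rw [div_pow, div_mul_eq_mul_div, div_le_one (by positivity), mul_pow, ← ha2]
          have hx2 : x ^ 2 ≤ 1 := by nlinarith
          have hs3 : 1 ≤ s ^ 2 := by nlinarith
          calc x ^ 2 * Sg ^ 4 ≤ 1 * l := by gcongr
            _ ≤ l * s ^ 2 := by nlinarith
        have e : 2 * (2316 * (x / (a * s)) ^ 2 * (400 * s ^ 2 + 2 * 10 ^ 14 * (x / (a * s)) ^ 2 * Sg ^ 4 * s ^ 2) +
          4 * (x ^ 3 / (a * s)) * (55296 / (x / (a * s) * l))) =
          x ^ 2 / l * (2 * (2316 * (400 + 2 * 10 ^ 14 * ((x / (a * s)) ^ 2 * Sg ^ 4)) + 221184)) := by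
          rw [ha2]
          field_simp; ring
        rw [e]
        calc _ ≤ x ^ 2 / l * 10 ^ 18 := by
              gcongr
              nlinarith
          _ = _ := by ring)
  refine this.trans ?_
  rw [← ENNReal.ofReal_mul (by positivity)]
  refine mul_le_mul_left (ENNReal.ofReal_le_ofReal ?_) _
  rw [← mul_div_assoc]
  refine div_le_div_of_nonneg_right ?_ (by linarith)
  nlinarith [sq_nonneg x]
end
end LL

namespace LL
open scoped ENNReal

/-- Partial derivative of a Schwartz function. -/
def dS (i : Fin 3) (φ : SchwartzMap V3 ℝ) : SchwartzMap V3 ℝ :=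
  LineDeriv.lineDerivOp (EuclideanSpace.single i (1 : ℝ)) φ

lemma dS_apply (i : Fin 3) (φ : SchwartzMap V3 ℝ) (v : V3) : dS i φ v = pd i φ v :=
  SchwartzMap.lineDerivOp_apply_eq_fderiv _ φ v

lemma dS_fun (i : Fin 3) (φ : SchwartzMap V3 ℝ) : (dS i φ : V3 → ℝ) = pd i φ :=
  funext (dS_apply i φ)

lemma schw_diff (φ : SchwartzMap V3 ℝ) (v : V3) : HasFDerivAt φ (fderiv ℝ φ v) v :=
  (φ.differentiable v).hasFDerivAt

/-- weight controlling all kernels -/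
def wk (z : V3) : ℝ := 1 + ‖z‖ + ‖z‖⁻¹

lemma wk_pos (z : V3) : 0 < wk z := by unfold wk; positivity

lemma ae_ne0 : ∀ᵐ z : V3, z ≠ 0 := by
  simp [ae_iff]

def dom (z : V3) : ℝ := wk z / (1 + ‖z‖) ^ 6

lemma dom_int : Integrable dom := by
  have hm : AEStronglyMeasurable dom volume := by
    unfold dom wk; apply Measurable.aestronglyMeasurable; fun_prop
  have h1 : Integrable (fun z : V3 => (1 + ‖z‖) ^ (-(4:ℝ))) :=
    integrable_one_add_norm (by simp; norm_num)
  have h2 : IntegrableOn dom (Metric.ball 0 1) := by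
    refine integrableOn_ball_of_norm_le_rpow (C := 3) (α := 1) (by simp) (by simp) ?_ hm
    filter_upwards [ae_restrict_mem Metric.isOpen_ball.measurableSet, ae_restrict_of_ae ae_ne0] with z hz hne
    have hz' : ‖z‖ < 1 := by simpa using hz
    have h0 : 0 ≤ dom z := div_nonneg (wk_pos z).le (by positivity)
    rw [Real.norm_of_nonneg h0, Real.rpow_neg_one]
    have hp : 0 < ‖z‖ := norm_pos_iff.2 hne
    have : 1 ≤ ‖z‖⁻¹ := (one_le_inv₀ hp).2 hz'.le
    calc dom z ≤ wk z := div_le_self (wk_pos z).le (one_le_pow₀ (by linarith))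
      _ ≤ _ := by unfold wk; linarith
  have h3 : IntegrableOn dom (Metric.ball 0 1)ᶜ := by
    refine (h1.const_mul 2).integrableOn.mono' hm.restrict ?_
    refine (ae_restrict_iff' Metric.isOpen_ball.measurableSet.compl).2 (Filter.Eventually.of_forall fun z hz => ?_)
    have hz' : 1 ≤ ‖z‖ := by simpa using hz
    have h0 : 0 ≤ dom z := div_nonneg (wk_pos z).le (by positivity)
    rw [Real.norm_of_nonneg h0, Real.rpow_neg (by positivity)]
    have e : (1 + ‖z‖) ^ (4:ℝ) = (1 + ‖z‖) ^ 4 := by exact_mod_cast Real.rpow_natCast (1 + ‖z‖) 4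
    rw [e]
    unfold dom
    have : ‖z‖⁻¹ ≤ 1 := inv_le_one_of_one_le₀ hz'
    have h5 : wk z ≤ 2 * (1 + ‖z‖)^2 := by unfold wk; nlinarith
    calc wk z / (1 + ‖z‖) ^ 6 ≤ (2 * (1 + ‖z‖)^2) / (1 + ‖z‖) ^ 6 := by gcongr
      _ = _ := by field_simp
  have := h2.union h3
  rwa [Set.union_compl_self, integrableOn_univ] at this

lemma schw_decay0 (φ : SchwartzMap V3 ℝ) (n : ℕ) : ∃ C, 0 < C ∧ ∀ x : V3, (1 + ‖x‖) ^ 6 * ‖iteratedFDeriv ℝ n φ x‖ ≤ C := by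
  refine ⟨_, ?_, fun x => (SchwartzMap.one_add_le_sup_seminorm_apply (𝕜 := ℝ) (m := (6, n)) le_rfl le_rfl φ x).trans
    (le_add_of_nonneg_right zero_le_one)⟩
  have := (SchwartzMap.one_add_le_sup_seminorm_apply (𝕜 := ℝ) (m := (6, n)) le_rfl le_rfl φ 0)
  have h : 0 ≤ (1 + ‖(0:V3)‖) ^ 6 * ‖iteratedFDeriv ℝ n φ 0‖ := by positivity
  exact lt_of_le_of_lt (h.trans this) (lt_add_one _)

lemma one_add_sub (v z : V3) : (1 + ‖z‖) ≤ (1 + ‖v - z‖) * (1 + ‖v‖) := by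
  have : ‖z‖ ≤ ‖v - z‖ + ‖v‖ := by
    have := norm_sub_le v (v - z); rw [sub_sub_cancel] at this; linarith
  nlinarith [norm_nonneg (v - z), norm_nonneg v]

lemma shift_bound {C a : ℝ} {v z : V3} (h : (1 + ‖v - z‖) ^ 6 * a ≤ C) (ha : 0 ≤ a) :
    a ≤ C * (1 + ‖v‖) ^ 6 / (1 + ‖z‖) ^ 6 := by
  rw [le_div_iff₀ (by positivity)]
  have := pow_le_pow_left₀ (by positivity) (one_add_sub v z) 6
  calc a * (1 + ‖z‖) ^ 6 ≤ a * ((1 + ‖v - z‖) * (1 + ‖v‖)) ^ 6 := by gcongr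
    _ = ((1 + ‖v - z‖) ^ 6 * a) * (1 + ‖v‖) ^ 6 := by ring
    _ ≤ _ := by gcongr

lemma schw_bd (φ : SchwartzMap V3 ℝ) : ∃ C, 0 < C ∧ ∀ v z : V3, |φ (v - z)| ≤ C * (1 + ‖v‖) ^ 6 / (1 + ‖z‖) ^ 6 ∧
    ‖fderiv ℝ φ (v - z)‖ ≤ C * (1 + ‖v‖) ^ 6 / (1 + ‖z‖) ^ 6 := by
  obtain ⟨C0, h0, H0⟩ := schw_decay0 φ 0
  obtain ⟨C1, h1, H1⟩ := schw_decay0 φ 1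
  refine ⟨C0 + C1, by positivity, fun v z => ⟨?_, ?_⟩⟩
  · refine shift_bound ?_ (abs_nonneg _)
    have := H0 (v - z)
    rw [norm_iteratedFDeriv_zero, Real.norm_eq_abs] at this
    linarith
  · refine shift_bound ?_ (norm_nonneg _)
    have := H1 (v - z)
    rw [norm_iteratedFDeriv_one] at this
    linarith

/-- admissible kernels -/
structure KB (k : V3 → ℝ) (c : ℝ) : Prop where
  meas : AEStronglyMeasurable k volume
  bd : ∀ z, z ≠ 0 → |k z| ≤ c * wk z

def Tk (k φ : V3 → ℝ) (v : V3) : ℝ := ∫ z, φ (v - z) * k z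

variable {k : V3 → ℝ} {c : ℝ}

lemma KB.c_nonneg (hk : KB k c) : 0 ≤ c := by
  have := hk.bd (EuclideanSpace.single 0 1) (by simp)
  by_contra h
  push Not at h
  have := mul_neg_of_neg_of_pos h (wk_pos (EuclideanSpace.single 0 1))
  have := abs_nonneg (k (EuclideanSpace.single 0 1))
  linarith

lemma KB.dombd (hk : KB k c) {a D : ℝ} {z : V3} (hz : z ≠ 0) (ha : 0 ≤ a) (h : a ≤ D / (1 + ‖z‖) ^ 6) :
    a * |k z| ≤ D * c * dom z := by
  calc a * |k z| ≤ (D / (1 + ‖z‖) ^ 6) * (c * wk z) := mul_le_mul h (hk.bd z hz) (abs_nonneg _) (ha.trans h)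
    _ = _ := by unfold dom; ring

lemma Tk_int (hk : KB k c) (φ : SchwartzMap V3 ℝ) (v : V3) : Integrable (fun z => φ (v - z) * k z) := by
  obtain ⟨C, hC, H⟩ := schw_bd φ
  refine (dom_int.const_mul (C * (1 + ‖v‖) ^ 6 * c)).mono' ?_ ?_
  · exact (φ.continuous.comp (by fun_prop : Continuous fun z : V3 => v - z)).aestronglyMeasurable.mul hk.meas
  · filter_upwards [ae_ne0] with z hz
    rw [norm_mul, Real.norm_eq_abs, Real.norm_eq_abs]
    exact hk.dombd hz (abs_nonneg _) (H v z).1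

lemma Tk_hasF (hk : KB k c) (φ : SchwartzMap V3 ℝ) (v : V3) :
    HasFDerivAt (Tk k φ) (∫ z, k z • fderiv ℝ φ (v - z)) v ∧ Integrable (fun z => k z • fderiv ℝ φ (v - z)) := by
  obtain ⟨C, hC, H⟩ := schw_bd φ
  have hfc : Continuous (fderiv ℝ φ) := (φ.smooth 1).continuous_fderiv one_ne_zero
  have key : ∀ z, z ≠ 0 → ∀ x ∈ Metric.ball v 1, ‖k z • fderiv ℝ φ (x - z)‖ ≤ C * (1 + (‖v‖ + 1)) ^ 6 * c * dom z := by
    intro z hz x hx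
    have hx' : ‖x‖ ≤ ‖v‖ + 1 := by
      have h1 : ‖x - v‖ < 1 := by simpa [dist_eq_norm] using hx
      have := norm_sub_norm_le x v
      linarith
    rw [norm_smul, mul_comm, Real.norm_eq_abs]
    refine hk.dombd hz (norm_nonneg _) ((H x z).2.trans ?_)
    gcongr
  have hme : ∀ x : V3, AEStronglyMeasurable (fun z => k z • fderiv ℝ φ (x - z)) volume := fun x =>
    hk.meas.smul (hfc.comp (by fun_prop : Continuous fun z : V3 => x - z)).aestronglyMeasurable
  refine ⟨hasFDerivAt_integral_of_dominated_of_fderiv_le (F' := fun x z => k z • fderiv ℝ φ (x - z)) (s := Metric.ball v 1)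
      (bound := fun z => C * (1 + (‖v‖ + 1)) ^ 6 * c * dom z)
      (Metric.ball_mem_nhds v one_pos) ?_ (Tk_int hk φ v) (hme v) ?_ (dom_int.const_mul _) ?_, ?_⟩
  · exact Filter.Eventually.of_forall fun x => (Tk_int hk φ x).1
  · filter_upwards [ae_ne0] with z hz x hx using key z hz x hx
  · refine Filter.Eventually.of_forall fun z x _ => ?_
    have h1 : HasFDerivAt (fun x : V3 => φ (x - z)) (fderiv ℝ φ (x - z)) x := by
      have := (schw_diff φ (x - z)).comp x ((hasFDerivAt_id x).sub_const z)
      simp at this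
      exact this
    exact h1.mul_const (k z)
  · refine (dom_int.const_mul (C * (1 + (‖v‖ + 1)) ^ 6 * c)).mono' (hme v) ?_
    filter_upwards [ae_ne0] with z hz using key z hz v (Metric.mem_ball_self one_pos)

lemma Tk_diff (hk : KB k c) (φ : SchwartzMap V3 ℝ) : Differentiable ℝ (Tk k φ) :=
  fun v => (Tk_hasF hk φ v).1.differentiableAt

lemma Tk_cont (hk : KB k c) (φ : SchwartzMap V3 ℝ) : Continuous (Tk k φ) := (Tk_diff hk φ).continuous

lemma pd_Tk (hk : KB k c) (φ : SchwartzMap V3 ℝ) (i : Fin 3) (v : V3) : pd i (Tk k φ) v = Tk k (dS i φ) v := by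
  unfold pd
  rw [(Tk_hasF hk φ v).1.fderiv, ContinuousLinearMap.integral_apply (Tk_hasF hk φ v).2]
  unfold Tk
  refine integral_congr_ae (Filter.Eventually.of_forall fun z => ?_)
  simp [dS_apply, pd, mul_comm]

lemma pd_Tk_fun (hk : KB k c) (φ : SchwartzMap V3 ℝ) (i : Fin 3) : pd i (Tk k φ) = Tk k (dS i φ) := funext (pd_Tk hk φ i)

lemma Tk_ibp {k' : V3 → ℝ} {c' : ℝ} (hk : KB k c) (hk' : KB k' c') (hd : Differentiable ℝ k) (i : Fin 3)
    (he : ∀ z, pd i k z = k' z) (φ : SchwartzMap V3 ℝ) (v : V3) : Tk k' φ v = Tk k (dS i φ) v := by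
  have hφ : ∀ z, HasFDerivAt (fun z : V3 => φ (v - z)) (-(fderiv ℝ φ (v - z))) z := by
    intro z
    have := (schw_diff φ (v - z)).comp z ((hasFDerivAt_id z).const_sub v)
    simp at this
    exact this
  have e1 : ∀ z, fderiv ℝ (fun z : V3 => φ (v - z)) z (EuclideanSpace.single i 1) = - dS i φ (v - z) := by
    intro z; rw [(hφ z).fderiv, dS_apply]; rfl
  have e2 : ∀ z, fderiv ℝ k z (EuclideanSpace.single i 1) = k' z := he
  have := integral_mul_fderiv_eq_neg_fderiv_mul_of_integrable (μ := (volume : Measure V3)) (f := fun z : V3 => φ (v - z)) (g := k)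
    (v := EuclideanSpace.single i 1) ?_ ?_ ?_ (fun z _ => (hφ z).differentiableAt) (fun z _ => hd z)
  · simp only [e1, e2, neg_mul, integral_neg, neg_neg] at this
    exact this
  · simp only [e1, neg_mul]; exact (Tk_int hk _ v).neg
  · simp only [e2]; exact Tk_int hk' φ v
  · exact Tk_int hk φ v

lemma Tk_lim {kn : ℕ → V3 → ℝ} (hn : ∀ n, KB (kn n) c) (hl : ∀ z, z ≠ 0 → Filter.Tendsto (fun n => kn n z) Filter.atTop (nhds (k z)))
    (φ : SchwartzMap V3 ℝ) (v : V3) : Filter.Tendsto (fun n => Tk (kn n) φ v) Filter.atTop (nhds (Tk k φ v)) := by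
  obtain ⟨C, hC, H⟩ := schw_bd φ
  refine tendsto_integral_of_dominated_convergence (fun z => C * (1 + ‖v‖) ^ 6 * c * dom z) (fun n => (Tk_int (hn n) φ v).1)
    (dom_int.const_mul _) (fun n => ?_) ?_
  · filter_upwards [ae_ne0] with z hz
    rw [norm_mul, Real.norm_eq_abs, Real.norm_eq_abs]
    exact (hn n).dombd hz (abs_nonneg _) (H v z).1
  · filter_upwards [ae_ne0] with z hz using (hl z hz).const_mul _

end LL

namespace LL
open scoped ENNReal

/-- regularized powers -/
def pe (ε a : ℝ) (z : V3) : ℝ := (‖z‖ ^ 2 + ε ^ 2) ^ a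

variable {ε : ℝ}

lemma q_pos (hε : 0 < ε) (z : V3) : 0 < ‖z‖ ^ 2 + ε ^ 2 := by positivity

lemma pe_hasF (hε : 0 < ε) (a : ℝ) (z : V3) : HasFDerivAt (pe ε a) ((2 * a * pe ε (a - 1) z) • innerSL ℝ z) z := by
  have h1 : HasFDerivAt (fun z : V3 => ‖z‖ ^ 2 + ε ^ 2) ((2:ℝ) • innerSL ℝ z) z := by
    have := ((hasStrictFDerivAt_norm_sq z).hasFDerivAt).add_const (ε ^ 2)
    rw [ofNat_smul_eq_nsmul]
    exact this
  have h2 := (Real.hasDerivAt_rpow_const (p := a) (Or.inl (q_pos hε z).ne')).comp_hasFDerivAt z h1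
  have e : (2 * a * pe ε (a - 1) z) • innerSL ℝ z = (a * (‖z‖ ^ 2 + ε ^ 2) ^ (a - 1)) • ((2:ℝ) • innerSL ℝ z) := by
    rw [smul_smul]; unfold pe; congr 1; ring
  rw [e]
  exact h2

lemma pe_cont (hε : 0 < ε) (a : ℝ) : Continuous (pe ε a) :=
  continuous_iff_continuousAt.2 fun z => (pe_hasF hε a z).continuousAt

lemma inner_single (z : V3) (i : Fin 3) : inner ℝ z (EuclideanSpace.single i (1:ℝ)) = z i := by
  rw [EuclideanSpace.inner_single_right]; simp

lemma pd_pe (hε : 0 < ε) (a : ℝ) (i : Fin 3) (z : V3) : pd i (pe ε a) z = 2 * a * pe ε (a - 1) z * z i := by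
  unfold pd; rw [(pe_hasF hε a z).fderiv]
  simp [inner_single]

lemma coord_hasF (j : Fin 3) (z : V3) : HasFDerivAt (fun z : V3 => z j) (EuclideanSpace.proj j : V3 →L[ℝ] ℝ) z :=
  (EuclideanSpace.proj j : V3 →L[ℝ] ℝ).hasFDerivAt

lemma zpe_hasF (hε : 0 < ε) (a : ℝ) (j : Fin 3) (z : V3) : HasFDerivAt (fun z : V3 => z j * pe ε a z)
    (z j • ((2 * a * pe ε (a - 1) z) • innerSL ℝ z) + pe ε a z • (EuclideanSpace.proj j : V3 →L[ℝ] ℝ)) z :=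
  (coord_hasF j z).mul (pe_hasF hε a z)

lemma pd_zpe (hε : 0 < ε) (a : ℝ) (i j : Fin 3) (z : V3) : pd i (fun z : V3 => z j * pe ε a z) z =
    (if i = j then 1 else 0) * pe ε a z + 2 * a * (z i * z j * pe ε (a - 1) z) := by
  unfold pd; rw [(zpe_hasF hε a j z).fderiv]
  simp [inner_single, eq_comm]
  split_ifs <;> ring

lemma pe_pos (hε : 0 < ε) (a : ℝ) (z : V3) : 0 < pe ε a z := rpow_pos_of_pos (q_pos hε z) a

lemma pe_succ (hε : 0 < ε) (a : ℝ) (z : V3) : pe ε (a - 1) z * (‖z‖ ^ 2 + ε ^ 2) = pe ε a z := by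
  unfold pe; rw [rpow_sub_one (q_pos hε z).ne']; have := (q_pos hε z).ne'; field_simp

lemma abs_coord_le (z : V3) (i : Fin 3) : |z i| ≤ ‖z‖ := by
  simpa using PiLp.norm_apply_le z i

lemma coord_mul_le (z : V3) (i j : Fin 3) : |z i * z j| ≤ ‖z‖ ^ 2 := by
  rw [abs_mul, sq]; exact mul_le_mul (abs_coord_le z i) (abs_coord_le z j) (abs_nonneg _) (norm_nonneg _)

lemma zz_pe_le (hε : 0 < ε) (a : ℝ) (i j : Fin 3) (z : V3) : |z i * z j * pe ε (a - 1) z| ≤ pe ε a z := by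
  rw [abs_mul, abs_of_pos (pe_pos hε _ z), ← pe_succ hε a z, mul_comm]
  refine mul_le_mul_of_nonneg_left ((coord_mul_le z i j).trans ?_) (pe_pos hε _ z).le
  nlinarith

lemma pe_half_le (hε : 0 < ε) (z : V3) (hz : z ≠ 0) : pe ε (-(1/2)) z ≤ ‖z‖⁻¹ := by
  have hp : 0 < ‖z‖ := norm_pos_iff.2 hz
  unfold pe
  rw [rpow_neg (q_pos hε z).le, ← Real.sqrt_eq_rpow]
  refine inv_anti₀ hp (Real.le_sqrt_of_sq_le (by nlinarith))

lemma pe_const_le (hε : 0 < ε) {a : ℝ} (ha : a ≤ 0) (z : V3) : pe ε a z ≤ (ε ^ 2) ^ a := by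
  exact Real.rpow_le_rpow_of_nonpos (by positivity) (by nlinarith [sq_nonneg ‖z‖]) ha

lemma inv_le_wk (z : V3) : ‖z‖⁻¹ ≤ wk z := by unfold wk; linarith [norm_nonneg z]
lemma one_le_wk (z : V3) : 1 ≤ wk z := by unfold wk; have : 0 ≤ ‖z‖⁻¹ := by positivity
                                          linarith [norm_nonneg z]
lemma norm_le_wk (z : V3) : ‖z‖ ≤ wk z := by unfold wk; have : 0 ≤ ‖z‖⁻¹ := by positivity
                                             linarith [norm_nonneg z]

lemma coord_cont (i : Fin 3) : Continuous fun z : V3 => z i := (EuclideanSpace.proj i : V3 →L[ℝ] ℝ).continuous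

lemma KB_z (hε : 0 < ε) (j : Fin 3) : KB (fun z => z j * pe ε (-(1/2)) z) 1 where
  meas := ((coord_cont j).mul (pe_cont hε _)).aestronglyMeasurable
  bd z hz := by
    have hp : 0 < ‖z‖ := norm_pos_iff.2 hz
    rw [abs_mul, abs_of_pos (pe_pos hε _ z), one_mul]
    refine le_trans ?_ (one_le_wk z)
    calc |z j| * pe ε (-(1/2)) z ≤ ‖z‖ * ‖z‖⁻¹ := mul_le_mul (abs_coord_le z j) (pe_half_le hε z hz) (pe_pos hε _ z).le hp.le
      _ = 1 := mul_inv_cancel₀ hp.ne'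

/-- regularized projection kernel -/
def Ke (ε : ℝ) (i j : Fin 3) (z : V3) : ℝ :=
  (if i = j then 1 else 0) * pe ε (-(1/2)) z - z i * z j * pe ε (-(1/2) - 1) z

lemma Ke_cont (hε : 0 < ε) (i j : Fin 3) : Continuous (Ke ε i j) :=
  (continuous_const.mul (pe_cont hε _)).sub (((coord_cont i).mul (coord_cont j)).mul (pe_cont hε _))

lemma KB_Ke (hε : 0 < ε) (i j : Fin 3) : KB (Ke ε i j) 2 where
  meas := (Ke_cont hε i j).aestronglyMeasurable
  bd z hz := by
    have h1 := zz_pe_le hε (-(1/2)) i j z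
    have h2 := pe_half_le hε z hz
    have h3 := inv_le_wk z
    have h4 : |(if i = j then (1:ℝ) else 0) * pe ε (-(1/2)) z| ≤ pe ε (-(1/2)) z := by
      split_ifs
      · rw [one_mul, abs_of_pos (pe_pos hε _ z)]
      · simpa using (pe_pos hε _ z).le
    unfold Ke
    have := abs_sub ((if i = j then (1:ℝ) else 0) * pe ε (-(1/2)) z) (z i * z j * pe ε (-(1/2) - 1) z)
    linarith

lemma pd_zKe (hε : 0 < ε) (i j : Fin 3) (z : V3) : pd i (fun z : V3 => z j * pe ε (-(1/2)) z) z = Ke ε i j z := by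
  rw [pd_zpe hε]; unfold Ke; ring

lemma Ke_symm (i j : Fin 3) (z : V3) : Ke ε i j z = Ke ε j i z := by
  unfold Ke; rw [mul_comm (z i)]; simp [eq_comm]

lemma dS_comm (i j : Fin 3) (φ : SchwartzMap V3 ℝ) : dS i (dS j φ) = dS j (dS i φ) := by
  ext v
  have hd : ∀ x, HasFDerivAt (fderiv ℝ φ) (fderiv ℝ (fderiv ℝ φ) x) x := fun x =>
    ((((φ.smooth 2).fderiv_right (m := 1) (by norm_num)).differentiable one_ne_zero) x).hasFDerivAt
  have hs := second_derivative_symmetric (f := φ) (fun x => schw_diff φ x) (hd v)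
    (EuclideanSpace.single i 1) (EuclideanSpace.single j 1)
  have e : ∀ a b : Fin 3, dS a (dS b φ) v = fderiv ℝ (fderiv ℝ φ) v (EuclideanSpace.single a 1) (EuclideanSpace.single b 1) := by
    intro a b
    rw [dS_apply, dS_fun]
    unfold pd
    rw [((hd v).clm_apply (hasFDerivAt_const _ v)).fderiv]
    simp
  rw [e, e, hs]

lemma Ke_swap (hε : 0 < ε) (i j : Fin 3) (φ : SchwartzMap V3 ℝ) (v : V3) :
    Tk (Ke ε i j) (dS i φ) v = Tk (Ke ε i i) (dS j φ) v := by
  have hd : Differentiable ℝ (fun z : V3 => z i * pe ε (-(1/2)) z) := fun z => (zpe_hasF hε _ i z).differentiableAt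
  rw [Tk_ibp (KB_z hε i) (KB_Ke hε i j) hd j (fun z => (pd_zKe hε j i z).trans (Ke_symm _ _ _)),
    Tk_ibp (KB_z hε i) (KB_Ke hε i i) hd i (fun z => (pd_zKe hε i i z)), dS_comm]

/-- the limit kernel (without 8π) -/
def K0 (i j : Fin 3) (z : V3) : ℝ := ((if i = j then (1 : ℝ) else 0) - z i * z j / ‖z‖ ^ 2) / (8 * π * ‖z‖)

def en (n : ℕ) : ℝ := 1 / ((n:ℝ) + 1)
lemma en_pos (n : ℕ) : 0 < en n := by unfold en; positivity
lemma en_lim : Filter.Tendsto en Filter.atTop (nhds 0) := tendsto_one_div_add_atTop_nhds_zero_nat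

lemma pe_lim (a : ℝ) (z : V3) (hz : z ≠ 0) : Filter.Tendsto (fun n => pe (en n) a z) Filter.atTop (nhds ((‖z‖ ^ 2) ^ a)) := by
  have h1 : Filter.Tendsto (fun n => ‖z‖ ^ 2 + en n ^ 2) Filter.atTop (nhds (‖z‖ ^ 2)) := by
    simpa using (en_lim.pow 2).const_add (‖z‖ ^ 2)
  have hp : 0 < ‖z‖ := norm_pos_iff.2 hz
  exact ((Real.continuousAt_rpow_const _ a (Or.inl (by positivity))).tendsto).comp h1

lemma pow_half (z : V3) : (‖z‖ ^ 2) ^ (-(1/2) : ℝ) = ‖z‖⁻¹ := by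
  rw [rpow_neg (by positivity), ← Real.sqrt_eq_rpow, Real.sqrt_sq (norm_nonneg z)]

lemma Ke_lim (i j : Fin 3) (z : V3) (hz : z ≠ 0) :
    Filter.Tendsto (fun n => Ke (en n) i j z) Filter.atTop (nhds (8 * π * K0 i j z)) := by
  have hp : 0 < ‖z‖ := norm_pos_iff.2 hz
  have h := ((pe_lim (-(1/2)) z hz).const_mul (if i = j then (1:ℝ) else 0)).sub ((pe_lim (-(1/2)-1) z hz).const_mul (z i * z j))
  refine h.congr' (Filter.Eventually.of_forall fun n => rfl) |>.trans (le_of_eq ?_)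
  congr 1
  rw [rpow_sub_one (by positivity), pow_half]
  unfold K0
  field_simp

lemma KB_K0 (i j : Fin 3) : KB (K0 i j) 1 where
  meas := by
    apply Measurable.aestronglyMeasurable
    unfold K0
    have := (coord_cont i).measurable
    have := (coord_cont j).measurable
    fun_prop
  bd z hz := by
    have hp : 0 < ‖z‖ := norm_pos_iff.2 hz
    have h1 : |z i * z j / ‖z‖ ^ 2| ≤ 1 := by
      rw [abs_div, abs_of_pos (by positivity : 0 < ‖z‖ ^ 2)]
      exact div_le_one_of_le₀ (coord_mul_le z i j) (by positivity)
    have h2 : |(if i = j then (1 : ℝ) else 0) - z i * z j / ‖z‖ ^ 2| ≤ 2 := by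
      refine (abs_sub _ _).trans ?_
      have : |(if i = j then (1 : ℝ) else 0)| ≤ 1 := by split_ifs <;> simp
      linarith
    unfold K0
    rw [abs_div, abs_of_pos (by positivity : 0 < 8 * π * ‖z‖), one_mul]
    refine le_trans ?_ (inv_le_wk z)
    rw [div_le_iff₀ (by positivity)]
    have : ‖z‖⁻¹ * (8 * π * ‖z‖) = 8 * π := by field_simp
    rw [this]; linarith [Real.pi_gt_three]

lemma Tk_const (a : ℝ) (k φ : V3 → ℝ) (v : V3) : Tk (fun z => a * k z) φ v = a * Tk k φ v := by
  unfold Tk; rw [← integral_const_mul]; congr 1; ext z; ring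

lemma K0_swap (i j : Fin 3) (φ : SchwartzMap V3 ℝ) (v : V3) :
    Tk (K0 i j) (dS i φ) v = Tk (K0 i i) (dS j φ) v := by
  have h1 := Tk_lim (fun n => KB_Ke (en_pos n) i j) (Ke_lim i j) (dS i φ) v
  have h2 := Tk_lim (fun n => KB_Ke (en_pos n) i i) (Ke_lim i i) (dS j φ) v
  simp only [Ke_swap (en_pos _) i j] at h1
  have := tendsto_nhds_unique h1 h2
  rw [Tk_const, Tk_const] at this
  exact mul_left_cancel₀ (by positivity : (8 * π) ≠ 0) this

/-- Coulomb kernel -/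
def N0 (z : V3) : ℝ := 1 / (4 * π * ‖z‖)

lemma KB_N0 : KB N0 1 where
  meas := by
    apply Measurable.aestronglyMeasurable
    unfold N0
    fun_prop
  bd z hz := by
    have hp : 0 < ‖z‖ := norm_pos_iff.2 hz
    unfold N0
    rw [abs_of_pos (by positivity), one_mul]
    refine le_trans ?_ (inv_le_wk z)
    rw [div_le_iff₀ (by positivity)]
    have : ‖z‖⁻¹ * (4 * π * ‖z‖) = 4 * π := by field_simp
    rw [this]; linarith [Real.pi_gt_three]

lemma normsq3 (z : V3) : ‖z‖ ^ 2 = z 0 ^ 2 + z 1 ^ 2 + z 2 ^ 2 := by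
  rw [EuclideanSpace.norm_sq_eq]; simp [Fin.sum_univ_three]

lemma K0_trace (z : V3) (hz : z ≠ 0) : ∑ i, K0 i i z = N0 z := by
  have hp : 0 < ‖z‖ := norm_pos_iff.2 hz
  have := normsq3 z
  unfold K0 N0
  rw [Fin.sum_univ_three]
  simp only [if_true]
  field_simp
  rw [this]; ring

lemma Tk_sum {ks : Fin 3 → V3 → ℝ} {c : ℝ} (hk : ∀ i, KB (ks i) c) (φ : SchwartzMap V3 ℝ) (v : V3) {k : V3 → ℝ}
    (he : ∀ z, z ≠ 0 → ∑ i, ks i z = k z) : ∑ i, Tk (ks i) φ v = Tk k φ v := by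
  unfold Tk
  rw [← integral_finsetSum _ (fun i _ => Tk_int (hk i) φ v)]
  refine integral_congr_ae ?_
  filter_upwards [ae_ne0] with z hz
  rw [← he z hz, Finset.mul_sum]

lemma N3 (j : Fin 3) (φ : SchwartzMap V3 ℝ) (v : V3) : ∑ i, Tk (K0 i j) (dS i φ) v = Tk N0 (dS j φ) v := by
  rw [Finset.sum_congr rfl fun i _ => K0_swap i j φ v]
  exact Tk_sum (fun i => KB_K0 i i) _ v K0_trace

/-- κ -/
def kap : ℝ := ∫ y : V3, 3 * (‖y‖ ^ 2 + 1) ^ (-(5/2) : ℝ) / (4 * π)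

lemma kap_nonneg : 0 ≤ kap := integral_nonneg fun y => by positivity

def Le (ε : ℝ) (i : Fin 3) (z : V3) : ℝ := -(pe ε (-(3/2)) z - 3 * (z i * z i * pe ε (-(3/2) - 1) z))

lemma pe_int (a : ℝ) (z : V3) : |pe ε a z| = pe ε a z := abs_of_nonneg (rpow_nonneg (by positivity) _)

lemma KB_pe (hε : 0 < ε) {a : ℝ} (ha : a ≤ 0) : KB (pe ε a) ((ε ^ 2) ^ a) where
  meas := (pe_cont hε _).aestronglyMeasurable
  bd z _ := by
    rw [pe_int]
    exact (pe_const_le hε ha z).trans (le_mul_of_one_le_right (by positivity) (one_le_wk z))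

lemma KB_zpe (hε : 0 < ε) {a : ℝ} (ha : a ≤ 0) (i : Fin 3) : KB (fun z => -(z i * pe ε a z)) ((ε ^ 2) ^ a) where
  meas := ((coord_cont i).mul (pe_cont hε _)).neg.aestronglyMeasurable
  bd z _ := by
    rw [abs_neg, abs_mul, pe_int, mul_comm]
    exact mul_le_mul (pe_const_le hε ha z) ((abs_coord_le z i).trans (norm_le_wk z)) (abs_nonneg _) (by positivity)

lemma KB_Le (hε : 0 < ε) (i : Fin 3) : KB (Le ε i) (4 * (ε ^ 2) ^ (-(3/2) : ℝ)) where
  meas := ((pe_cont hε _).sub (continuous_const.mul (((coord_cont i).mul (coord_cont i)).mul (pe_cont hε _)))).neg.aestronglyMeasurable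
  bd z _ := by
    have h1 := zz_pe_le hε (-(3/2)) i i z
    have h2 := pe_const_le hε (by norm_num : (-(3/2) : ℝ) ≤ 0) z
    have h3 : 4 * (ε ^ 2) ^ (-(3/2) : ℝ) ≤ 4 * (ε ^ 2) ^ (-(3/2) : ℝ) * wk z := le_mul_of_one_le_right (by positivity) (one_le_wk z)
    have h4 := pe_int (ε := ε) (-(3/2)) z
    unfold Le
    rw [abs_neg]
    have := abs_sub (pe ε (-(3/2)) z) (3 * (z i * z i * pe ε (-(3/2) - 1) z))
    rw [abs_mul 3, abs_of_pos (by norm_num : (0:ℝ) < 3)] at this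
    linarith

lemma N4e (hε : 0 < ε) (φ : SchwartzMap V3 ℝ) (v : V3) :
    ∑ i, Tk (pe ε (-(1/2))) (dS i (dS i φ)) v = - Tk (fun z => 3 * ε ^ 2 * pe ε (-(5/2)) z) φ v := by
  have h1 : ∀ i, Tk (pe ε (-(1/2))) (dS i (dS i φ)) v = Tk (Le ε i) φ v := by
    intro i
    rw [← Tk_ibp (KB_pe hε (by norm_num : (-(1/2):ℝ) ≤ 0)) (KB_zpe hε (by norm_num : (-(3/2):ℝ) ≤ 0) i)
      (fun z => (pe_hasF hε _ z).differentiableAt) i ?_ (dS i φ) v,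
      ← Tk_ibp (KB_zpe hε (by norm_num : (-(3/2):ℝ) ≤ 0) i) (KB_Le hε i)
      (fun z => (zpe_hasF hε _ i z).neg.differentiableAt) i ?_ φ v]
    · intro z
      have := pd_zpe hε (-(3/2)) i i z
      unfold pd at this ⊢
      have e : (fun z : V3 => -(z i * pe ε (-(3/2)) z)) = -(fun z : V3 => (z i * pe ε (-(3/2)) z)) := rfl
      rw [e, fderiv_neg, neg_apply, this]; unfold Le; simp; ring
    · intro z; rw [pd_pe hε]; norm_num; ring
  simp only [h1]
  rw [Tk_sum (KB_Le hε) φ v (k := fun z => (-1) * (3 * ε ^ 2 * pe ε (-(5/2)) z)), Tk_const]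
  · ring
  · intro z _
    have := pe_succ hε (-(3/2)) z
    have e : (-(3/2) - 1 : ℝ) = -(5/2) := by norm_num
    rw [e, normsq3] at this
    unfold Le
    rw [Fin.sum_univ_three, e, ← this]; ring

lemma N4scale (hε : 0 < ε) (φ : SchwartzMap V3 ℝ) (v : V3) :
    Tk (fun z => 3 * ε ^ 2 * pe ε (-(5/2)) z) φ v = ∫ y : V3, φ (v - ε • y) * (3 * (‖y‖ ^ 2 + 1) ^ (-(5/2) : ℝ)) := by
  have h := Measure.integral_comp_smul (volume : Measure V3) (fun z => φ (v - z) * (3 * ε ^ 2 * pe ε (-(5/2)) z)) ε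
  have h3 : Module.finrank ℝ V3 = 3 := by simp
  rw [h3, abs_of_pos (by positivity), smul_eq_mul] at h
  unfold Tk
  have h' : ∫ z, φ (v - z) * (3 * ε ^ 2 * pe ε (-(5/2)) z) = ε ^ 3 * ∫ x : V3, φ (v - ε • x) * (3 * ε ^ 2 * pe ε (-(5/2)) (ε • x)) := by
    rw [h, mul_inv_cancel_left₀ (by positivity)]
  rw [h', ← integral_const_mul]
  congr 1; ext y
  have : pe ε (-(5/2)) (ε • y) = (ε ^ 5)⁻¹ * (‖y‖ ^ 2 + 1) ^ (-(5/2) : ℝ) := by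
    unfold pe
    rw [norm_smul, Real.norm_of_nonneg hε.le, show (ε * ‖y‖) ^ 2 + ε ^ 2 = ε ^ 2 * (‖y‖ ^ 2 + 1) by ring,
      mul_rpow (by positivity) (by positivity)]
    congr 1
    rw [← Real.rpow_natCast ε 2, ← Real.rpow_mul hε.le, ← Real.rpow_natCast ε 5, ← Real.rpow_neg hε.le]
    norm_num
  rw [this]; field_simp

lemma schw_sup (φ : SchwartzMap V3 ℝ) : ∃ C, 0 < C ∧ ∀ v, |φ v| ≤ C := by
  obtain ⟨C, h, H⟩ := schw_bd φ
  refine ⟨C, h, fun v => ?_⟩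
  have := (H 0 (-v)).1
  simp at this
  refine this.trans (div_le_self h.le (one_le_pow₀ (by linarith [norm_nonneg v])))

lemma int52 : Integrable (fun y : V3 => (‖y‖ ^ 2 + 1) ^ (-(5/2) : ℝ)) := by
  have := integrable_rpow_neg_one_add_norm_sq (E := V3) (μ := volume) (r := 5) (by simp; norm_num)
  refine this.congr (Filter.Eventually.of_forall fun y => ?_)
  simp only []
  rw [add_comm, neg_div]

lemma N4 (φ : SchwartzMap V3 ℝ) (v : V3) : ∑ i, Tk N0 (dS i (dS i φ)) v = - (kap * φ v) := by
  have h1 : ∀ i, Filter.Tendsto (fun n => Tk (pe (en n) (-(1/2))) (dS i (dS i φ)) v) Filter.atTop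
      (nhds (4 * π * Tk N0 (dS i (dS i φ)) v)) := by
    intro i
    have := Tk_lim (k := fun z => 4 * π * N0 z) (c := 1) (kn := fun n => pe (en n) (-(1/2))) ?_ ?_ (dS i (dS i φ)) v
    · rwa [Tk_const] at this
    · intro n
      refine ⟨(pe_cont (en_pos n) _).aestronglyMeasurable, fun z hz => ?_⟩
      rw [pe_int, one_mul]
      exact (pe_half_le (en_pos n) z hz).trans (inv_le_wk z)
    · intro z hz
      have hp : 0 < ‖z‖ := norm_pos_iff.2 hz
      have := pe_lim (-(1/2)) z hz
      rw [pow_half] at this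
      convert this using 2
      unfold N0; field_simp
  have h2 := tendsto_finsetSum Finset.univ (fun i _ => h1 i)
  simp only [N4e (en_pos _), N4scale (en_pos _)] at h2
  have h3 : Filter.Tendsto (fun n => ∫ y : V3, φ (v - en n • y) * (3 * (‖y‖ ^ 2 + 1) ^ (-(5/2) : ℝ))) Filter.atTop
      (nhds (∫ y : V3, φ v * (3 * (‖y‖ ^ 2 + 1) ^ (-(5/2) : ℝ)))) := by
    obtain ⟨C, hC, H⟩ := schw_sup φ
    refine tendsto_integral_of_dominated_convergence (fun y => C * (3 * (‖y‖ ^ 2 + 1) ^ (-(5/2) : ℝ))) ?_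
      ((int52.const_mul 3).const_mul C) ?_ ?_
    · intro n
      have e : Continuous (fun y : V3 => φ (v - en n • y)) := φ.continuous.comp (by fun_prop)
      exact e.aestronglyMeasurable.mul (int52.const_mul 3).1
    · intro n
      refine Filter.Eventually.of_forall fun y => ?_
      rw [norm_mul, Real.norm_eq_abs, Real.norm_of_nonneg (by positivity)]
      exact mul_le_mul_of_nonneg_right (H _) (by positivity)
    · refine Filter.Eventually.of_forall fun y => ?_
      refine Filter.Tendsto.mul_const _ ?_
      have : Filter.Tendsto (fun n => v - en n • y) Filter.atTop (nhds v) := by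
        simpa using (en_lim.smul_const y).const_sub v
      exact (φ.continuous.tendsto v).comp this
  have h4 := tendsto_nhds_unique h2 h3.neg
  rw [← Finset.mul_sum, integral_const_mul] at h4
  have h5 : ∫ y : V3, 3 * (‖y‖ ^ 2 + 1) ^ (-(5/2) : ℝ) = 4 * π * kap := by
    unfold kap; rw [integral_div]; field_simp
  rw [h5] at h4
  have : (4 * π) ≠ 0 := by positivity
  refine mul_left_cancel₀ this ?_
  rw [h4]; ring

end LL

namespace LL
open scoped ENNReal

lemma Amat_eq (g : V3 → ℝ) (v : V3) (i j : Fin 3) : Amat g v i j = Tk (K0 i j) g v := by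
  unfold Amat Tk
  rw [← integral_sub_left_eq_self (fun z => g (v - z) * K0 i j z) volume v]
  congr 1; ext w
  rw [sub_sub_cancel]; rfl

lemma apot_eq (g : V3 → ℝ) (v : V3) : apot g v = Tk N0 g v := by
  unfold apot Tk
  rw [← integral_sub_left_eq_self (fun z => g (v - z) * N0 z) volume v]
  congr 1; ext w
  rw [sub_sub_cancel]; unfold N0; ring

lemma pd_eq {F : V3 → ℝ} {L : V3 →L[ℝ] ℝ} {v : V3} (h : HasFDerivAt F L v) (i : Fin 3) :
    pd i F v = L (EuclideanSpace.single i 1) := by unfold pd; rw [h.fderiv]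

lemma pd_mul {F G : V3 → ℝ} {v : V3} (hF : DifferentiableAt ℝ F v) (hG : DifferentiableAt ℝ G v) (i : Fin 3) :
    pd i (fun u => F u * G u) v = pd i F v * G v + F v * pd i G v := by
  rw [pd_eq (hF.hasFDerivAt.fun_mul hG.hasFDerivAt)]; simp [pd]; ring

lemma pd_sub {F G : V3 → ℝ} {v : V3} (hF : DifferentiableAt ℝ F v) (hG : DifferentiableAt ℝ G v) (i : Fin 3) :
    pd i (fun u => F u - G u) v = pd i F v - pd i G v := by
  rw [pd_eq (hF.hasFDerivAt.fun_sub hG.hasFDerivAt)]; simp [pd]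

lemma pd_add {F G : V3 → ℝ} {v : V3} (hF : DifferentiableAt ℝ F v) (hG : DifferentiableAt ℝ G v) (i : Fin 3) :
    pd i (fun u => F u + G u) v = pd i F v + pd i G v := by
  rw [pd_eq (hF.hasFDerivAt.fun_add hG.hasFDerivAt)]; simp [pd]

lemma pd_sum {F : Fin 3 → V3 → ℝ} {v : V3} (hF : ∀ j, DifferentiableAt ℝ (F j) v) (i : Fin 3) :
    pd i (fun u => ∑ j, F j u) v = ∑ j, pd i (F j) v := by
  rw [pd_eq (HasFDerivAt.fun_sum fun j (_ : j ∈ Finset.univ) => (hF j).hasFDerivAt)]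
  simp [pd]

/-- shorthand for the matrix -/
def AA (φ : V3 → ℝ) (i j : Fin 3) (v : V3) : ℝ := Tk (K0 i j) φ v

theorem landau_eq (φ : SchwartzMap V3 ℝ) (v : V3) :
    landauRHS φ v = ∑ i, ∑ j, AA φ i j v * dS i (dS j φ) v + kap * φ v ^ 2 := by
  unfold landauRHS AA
  have e : ∀ i, (fun u => (∑ j : Fin 3, Amat φ u i j * pd j φ u) - pd i (apot φ) u * φ u) =
      (fun u => (∑ j : Fin 3, Tk (K0 i j) φ u * dS j φ u) - Tk N0 (dS i φ) u * φ u) := by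
    intro i; ext u
    have : apot (φ : V3 → ℝ) = Tk N0 φ := funext (apot_eq φ)
    rw [this, pd_Tk KB_N0]
    simp only [Amat_eq, dS_apply]
  have hd : ∀ (ψ : SchwartzMap V3 ℝ) u, DifferentiableAt ℝ ψ u := fun ψ u => ψ.differentiable u
  have e2 : ∀ i, pd i (fun u => (∑ j : Fin 3, Amat φ u i j * pd j φ u) - pd i (apot φ) u * φ u) v =
      (∑ j, (Tk (K0 i j) (dS i φ) v * dS j φ v + Tk (K0 i j) φ v * dS i (dS j φ) v))
        - (Tk N0 (dS i (dS i φ)) v * φ v + Tk N0 (dS i φ) v * dS i φ v) := by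
    intro i
    rw [e, pd_sub (DifferentiableAt.fun_sum fun j _ => (Tk_diff (KB_K0 i j) φ v).fun_mul (hd _ v)) ((Tk_diff KB_N0 _ v).fun_mul (hd _ v)),
      pd_sum fun j => (Tk_diff (KB_K0 i j) φ v).fun_mul (hd _ v), pd_mul (Tk_diff KB_N0 _ v) (hd _ v), pd_Tk KB_N0, dS_apply i φ]
    congr 1
    refine Finset.sum_congr rfl fun j _ => ?_
    rw [pd_mul (Tk_diff (KB_K0 i j) φ v) (hd _ v), pd_Tk (KB_K0 i j), dS_apply i (dS j φ)]
  rw [Finset.sum_congr rfl fun i _ => e2 i]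
  have h4 := N4 φ v
  have h3 := fun j => N3 j φ v
  simp only [Finset.sum_sub_distrib, Finset.sum_add_distrib]
  have h5 : ∑ i, ∑ j, Tk (K0 i j) (dS i φ) v * dS j φ v = ∑ j, Tk N0 (dS j φ) v * dS j φ v := by
    rw [Finset.sum_comm]
    refine Finset.sum_congr rfl fun j _ => ?_
    rw [← Finset.sum_mul, h3]
  rw [h5, ← Finset.sum_mul, h4]; ring

/-! Maxwellian -/

lemma pow_exp_bd (M : ℕ) {r : ℝ} (hr : 0 ≤ r) : (1 + r) ^ M * exp (-r ^ 2 / 2) ≤ M.factorial * exp (3/2) := by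
  have h := Real.pow_div_factorial_le_exp (1 + r) (by positivity) M
  rw [div_le_iff₀ (by positivity)] at h
  calc (1 + r) ^ M * exp (-r ^ 2 / 2) ≤ exp (1 + r) * M.factorial * exp (-r ^ 2 / 2) := by gcongr
    _ = M.factorial * exp (1 + r + -r ^ 2 / 2) := by rw [exp_add (1 + r)]; ring
    _ ≤ _ := by gcongr; nlinarith [sq_nonneg (r - 1)]

lemma gauss_smooth : ContDiff ℝ (⊤ : ℕ∞) (fun v : V3 => exp (-‖v‖ ^ 2 / 2)) := by
  have : ContDiff ℝ (⊤ : ℕ∞) (fun v : V3 => ‖v‖ ^ 2) := contDiff_norm_sq ℝ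
  exact (this.neg.div_const 2).exp

def gaussS : SchwartzMap V3 ℝ where
  toFun v := exp (-‖v‖ ^ 2 / 2)
  smooth' := gauss_smooth
  decay' k n := by
    have ht : Function.HasTemperateGrowth (fun v : V3 => (-(1/2) : ℝ) * ‖v‖ ^ 2) :=
      (Function.HasTemperateGrowth.const _).mul (Function.hasTemperateGrowth_norm_sq V3)
    obtain ⟨p, C, hC, H⟩ := ht.norm_iteratedFDeriv_le_uniform n
    refine ⟨n.factorial * (max C 1) ^ n * ((k + p * n).factorial * exp (3/2)), fun x => ?_⟩
    have hD : ∀ i, 1 ≤ i → i ≤ n → ‖iteratedFDeriv ℝ i (fun v : V3 => (-(1/2) : ℝ) * ‖v‖ ^ 2) x‖ ≤ (max C 1 * (1 + ‖x‖) ^ p) ^ i := by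
      intro i h1 h2
      have hm : 1 ≤ max C 1 * (1 + ‖x‖) ^ p := by
        have : 1 ≤ (1 + ‖x‖) ^ p := one_le_pow₀ (by linarith [norm_nonneg x])
        exact one_le_mul_of_one_le_of_one_le (le_max_right _ _) this
      refine ((H i h2 x).trans ?_).trans (le_self_pow₀ hm (by omega))
      gcongr; exact le_max_left _ _
    have hg : ∀ i ≤ n, ‖iteratedFDeriv ℝ i exp (-(1/2) * ‖x‖ ^ 2)‖ ≤ exp (-‖x‖ ^ 2 / 2) := by
      intro i _
      rw [norm_iteratedFDeriv_eq_norm_iteratedDeriv, iteratedDeriv_eq_iterate, Real.iter_deriv_exp, Real.norm_of_nonneg (exp_pos _).le]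
      apply le_of_eq; congr 1; ring
    have hsm : ContDiff ℝ n (fun v : V3 => (-(1/2) : ℝ) * ‖v‖ ^ 2) := contDiff_const.mul (contDiff_norm_sq ℝ)
    have := norm_iteratedFDeriv_comp_le (n := n) (Real.contDiff_exp (n := n)) hsm le_rfl x hg hD
    have e : (fun v : V3 => exp (-‖v‖ ^ 2 / 2)) = exp ∘ (fun v : V3 => (-(1/2) : ℝ) * ‖v‖ ^ 2) := by
      ext v; simp; ring
    rw [e]
    have h2 := pow_exp_bd (k + p * n) (norm_nonneg x)
    calc ‖x‖ ^ k * ‖iteratedFDeriv ℝ n (exp ∘ (fun v : V3 => (-(1/2) : ℝ) * ‖v‖ ^ 2)) x‖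
        ≤ (1 + ‖x‖) ^ k * (n.factorial * exp (-‖x‖ ^ 2 / 2) * (max C 1 * (1 + ‖x‖) ^ p) ^ n) := by
          gcongr; linarith
      _ = n.factorial * (max C 1) ^ n * ((1 + ‖x‖) ^ (k + p * n) * exp (-‖x‖ ^ 2 / 2)) := by
          rw [pow_add, pow_mul, mul_pow]; ring
      _ ≤ _ := by gcongr

def muS : SchwartzMap V3 ℝ := ((2 * π) ^ (-(3 : ℝ) / 2)) • gaussS

lemma muS_apply (v : V3) : muS v = maxwellian v := rfl

lemma gauss_hasF (v : V3) : HasFDerivAt muS ((-muS v) • innerSL ℝ v) v := by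
  have h1 : HasFDerivAt (fun z : V3 => -‖z‖ ^ 2 / 2) ((-1:ℝ) • innerSL ℝ v) v := by
    have h0 : HasFDerivAt (fun z : V3 => ‖z‖ ^ 2) ((2:ℝ) • innerSL ℝ v) v := by
      rw [ofNat_smul_eq_nsmul]
      exact (hasStrictFDerivAt_norm_sq v).hasFDerivAt
    have := h0.const_mul (-(1/2) : ℝ)
    rw [smul_smul] at this
    norm_num at this
    have e : (fun z : V3 => -‖z‖ ^ 2 / 2) = fun z : V3 => -(1/2 * ‖z‖ ^ 2) := by ext z; ring
    rw [e, neg_one_smul]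
    exact this
  have h2 := (h1.exp).const_mul ((2 * π) ^ (-(3 : ℝ) / 2))
  have e : (-muS v) • innerSL ℝ v = ((2 * π) ^ (-(3 : ℝ) / 2)) • (exp (-‖v‖ ^ 2 / 2)) • ((-1:ℝ) • innerSL ℝ v) := by
    rw [smul_smul, smul_smul, muS_apply]; unfold maxwellian; congr 1; ring
  rw [e]
  exact h2

lemma dS_mu (i : Fin 3) (v : V3) : dS i muS v = -(v i * muS v) := by
  rw [dS_apply, pd_eq (gauss_hasF v)]
  simp [inner_single]; ring

lemma dS_dS_mu (i j : Fin 3) (v : V3) : dS i (dS j muS) v = (v i * v j - if i = j then 1 else 0) * muS v := by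
  have e : (dS j muS : V3 → ℝ) = fun v => -(v j * muS v) := funext (dS_mu j)
  rw [dS_apply, e, pd_eq (((coord_hasF j v).fun_mul (gauss_hasF v)).fun_neg)]
  simp [inner_single, eq_comm]
  split_ifs <;> ring

lemma K0_z (i : Fin 3) (z : V3) (hz : z ≠ 0) : ∑ j, K0 i j z * z j = 0 := by
  have hp : 0 < ‖z‖ := norm_pos_iff.2 hz
  have h := normsq3 z
  have e : ∑ j, K0 i j z * z j = (z i - z i * (z 0 ^ 2 + z 1 ^ 2 + z 2 ^ 2) / ‖z‖ ^ 2) / (8 * π * ‖z‖) := by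
    unfold K0; rw [Fin.sum_univ_three]
    fin_cases i <;> simp <;> ring
  rw [e, ← h]; field_simp; ring

lemma K0_symm (i j : Fin 3) (z : V3) : K0 i j z = K0 j i z := by
  unfold K0; rw [mul_comm (z i)]; simp [eq_comm]

lemma flux_mu (i : Fin 3) (u : V3) : (∑ j, Tk (K0 i j) muS u * dS j muS u) - Tk N0 (dS i muS) u * muS u = 0 := by
  rw [← N3 i muS u]
  have h1 : ∀ j, Tk (K0 i j) muS u * dS j muS u - Tk (K0 j i) (dS j muS) u * muS u =
      -muS u * ∫ z, muS (u - z) * (K0 i j z * z j) := by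
    intro j
    have hs : K0 j i = K0 i j := funext (K0_symm j i)
    rw [hs, dS_mu]
    unfold Tk
    have hi1 := Tk_int (KB_K0 i j) muS u
    have hi2 := Tk_int (KB_K0 i j) (dS j muS) u
    rw [← integral_const_mul, ← integral_mul_const, ← integral_mul_const, ← integral_sub (hi1.mul_const _) (hi2.mul_const _)]
    congr 1; ext z
    rw [dS_mu]; simp; ring
  rw [Finset.sum_mul, ← Finset.sum_sub_distrib, Finset.sum_congr rfl fun j _ => h1 j, ← Finset.mul_sum]
  have hint : ∀ j, Integrable fun z => muS (u - z) * (K0 i j z * z j) := by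
    intro j
    have hi1 := (Tk_int (KB_K0 i j) muS u).const_mul (u j)
    have hi2 := Tk_int (KB_K0 i j) (dS j muS) u
    refine (hi1.add hi2).congr (Filter.Eventually.of_forall fun z => ?_)
    simp [dS_mu]; ring
  rw [← integral_finsetSum _ fun j _ => hint j]
  have : ∫ z, ∑ j, muS (u - z) * (K0 i j z * z j) = 0 := by
    rw [← integral_zero V3 ℝ]
    refine integral_congr_ae ?_
    filter_upwards [ae_ne0] with z hz
    rw [← Finset.mul_sum, K0_z i z hz, mul_zero]
  rw [this, mul_zero]

theorem landau_mu (v : V3) : landauRHS muS v = 0 := by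
  unfold landauRHS
  refine Finset.sum_eq_zero fun i _ => ?_
  have e : (fun u => (∑ j : Fin 3, Amat muS u i j * pd j muS u) - pd i (apot muS) u * muS u) = fun _ => 0 := by
    ext u
    have : apot (muS : V3 → ℝ) = Tk N0 muS := funext (apot_eq muS)
    rw [this, pd_Tk KB_N0]
    simp only [Amat_eq, ← dS_apply]
    exact flux_mu i u
  rw [e]; simp [pd]

/-- equation for the perturbation -/
theorem pert_eq (φ : SchwartzMap V3 ℝ) (v : V3) : landauRHS φ v =
    ∑ i, ∑ j, AA φ i j v * dS i (dS j (φ - muS)) v + kap * φ v * (φ v - muS v)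
    + ∑ i, ∑ j, AA (φ - muS : SchwartzMap V3 ℝ) i j v * dS i (dS j muS) v + kap * muS v * (φ v - muS v) := by
  have h := landau_eq muS v
  rw [landau_mu] at h
  rw [landau_eq]
  have hs : ∀ i j, dS i (dS j (φ - muS)) v = dS i (dS j φ) v - dS i (dS j muS) v := by
    intro i j
    have h1 : ∀ (k : Fin 3) (a b : SchwartzMap V3 ℝ), dS k (a - b) = dS k a - dS k b := by
      intro k a b
      ext u
      rw [dS_apply]
      have : ((a - b : SchwartzMap V3 ℝ) : V3 → ℝ) = fun u => a u - b u := rfl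
      rw [this, pd_sub (a.differentiable u) (b.differentiable u), ← dS_apply, ← dS_apply]; rfl
    rw [h1, h1]; rfl
  have hA : ∀ i j, AA (φ - muS : SchwartzMap V3 ℝ) i j v = AA φ i j v - AA muS i j v := by
    intro i j; unfold AA Tk
    rw [← integral_sub (Tk_int (KB_K0 i j) φ v) (Tk_int (KB_K0 i j) muS v)]
    congr 1; ext z; simp; ring
  simp only [hs, hA, mul_sub, sub_mul, Finset.sum_sub_distrib]
  linarith

end LL

namespace LL
open scoped ENNReal

def qf (φ : V3 → ℝ) (x ξ : V3) : ℝ := ∑ i, ∑ j, AA φ i j x * ξ i * ξ j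

lemma kq_eq (z ξ : V3) : kq z ξ = ∑ i, ∑ j, K0 i j z * ξ i * ξ j := by
  have h := normsq3 ξ
  have h2 : inner ℝ ξ z = z 0 * ξ 0 + z 1 * ξ 1 + z 2 * ξ 2 := by
    simp [PiLp.inner_apply, Fin.sum_univ_three]
  unfold kq PiSq K0
  rw [h, h2]
  simp [Fin.sum_univ_three]
  ring

lemma qf_int (φ : SchwartzMap V3 ℝ) (x ξ : V3) : Integrable (fun z => φ (x - z) * kq z ξ) ∧
    ∫ z, φ (x - z) * kq z ξ = qf φ x ξ := by
  have e : (fun z => φ (x - z) * kq z ξ) = fun z => ∑ i, ∑ j, (φ (x - z) * K0 i j z) * (ξ i * ξ j) := by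
    ext z; rw [kq_eq, Finset.mul_sum]
    refine Finset.sum_congr rfl fun i _ => ?_
    rw [Finset.mul_sum]
    exact Finset.sum_congr rfl fun j _ => by ring
  have hi : ∀ i j, Integrable fun z => (φ (x - z) * K0 i j z) * (ξ i * ξ j) := fun i j => (Tk_int (KB_K0 i j) φ x).mul_const _
  rw [e]
  refine ⟨integrable_finsetSum _ fun i _ => integrable_finsetSum _ fun j _ => hi i j, ?_⟩
  rw [integral_finsetSum _ fun i _ => integrable_finsetSum _ fun j _ => hi i j]
  unfold qf
  refine Finset.sum_congr rfl fun i _ => ?_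
  rw [integral_finsetSum _ fun j _ => hi i j]
  refine Finset.sum_congr rfl fun j _ => ?_
  rw [integral_mul_const]; unfold AA Tk; ring

lemma AqE_eq (φ : SchwartzMap V3 ℝ) (h0 : ∀ v, 0 ≤ φ v) (x ξ : V3) : AqE φ x ξ = ENNReal.ofReal (qf φ x ξ) := by
  rw [← (qf_int φ x ξ).2, ofReal_integral_eq_lintegral_ofReal (qf_int φ x ξ).1
    (Filter.Eventually.of_forall fun z => mul_nonneg (h0 _) (kq_nonneg z ξ))]
  unfold AqE
  rw [← lintegral_sub_left_eq_self (fun z => ENNReal.ofReal (φ (x - z) * kq z ξ)) x]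
  simp

lemma qf_nonneg (φ : SchwartzMap V3 ℝ) (h0 : ∀ v, 0 ≤ φ v) (x ξ : V3) : 0 ≤ qf φ x ξ := by
  rw [← (qf_int φ x ξ).2]
  exact integral_nonneg fun z => mul_nonneg (h0 _) (kq_nonneg z ξ)

/-- gradient vector -/
def gr (U : V3 → ℝ) (x : V3) : V3 := WithLp.toLp 2 (fun i => pd i U x)

lemma gr_apply (U : V3 → ℝ) (x : V3) (i : Fin 3) : gr U x i = pd i U x := rfl

lemma vec_sum (ξ : V3) : ξ = ∑ i, ξ i • EuclideanSpace.single i (1:ℝ) := by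
  ext j; simp [Fin.sum_univ_three]; fin_cases j <;> simp

lemma gr_hasF {U : V3 → ℝ} {x : V3} (h : DifferentiableAt ℝ U x) : HasFDerivAt U (innerSL ℝ (gr U x)) x := by
  have : innerSL ℝ (gr U x) = fderiv ℝ U x := by
    ext ξ
    have e : fderiv ℝ U x ξ = ∑ i, ξ i * pd i U x := by
      conv_lhs => rw [vec_sum ξ]
      rw [map_sum]; simp [pd]
    rw [e]
    simp [PiLp.inner_apply, gr_apply, Fin.sum_univ_three]
  rw [this]; exact h.hasFDerivAt

lemma pd_cont {U : V3 → ℝ} (h : ContDiff ℝ 1 U) (i : Fin 3) : Continuous (pd i U) :=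
  (h.continuous_fderiv one_ne_zero).clm_apply continuous_const

lemma gr_cont {U : V3 → ℝ} (h : ContDiff ℝ 1 U) : Continuous (gr U) :=
  (PiLp.continuous_toLp 2 _).comp (continuous_pi fun i => pd_cont h i)

lemma c1_of_pd {U : V3 → ℝ} (hd : Differentiable ℝ U) (hc : ∀ i, Continuous (pd i U)) : ContDiff ℝ 1 U := by
  rw [contDiff_one_iff_fderiv]
  refine ⟨hd, ?_⟩
  have : fderiv ℝ U = fun x => innerSL ℝ (gr U x) := by
    ext1 x; exact (gr_hasF (hd x)).fderiv
  rw [this]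
  exact (innerSL ℝ (E := V3)).continuous.comp ((PiLp.continuous_toLp 2 _).comp (continuous_pi fun i => hc i))

lemma Tk_c1 {k : V3 → ℝ} {c : ℝ} (hk : KB k c) (φ : SchwartzMap V3 ℝ) : ContDiff ℝ 1 (Tk k φ) :=
  c1_of_pd (Tk_diff hk φ) fun i => by rw [pd_Tk_fun hk]; exact Tk_cont hk _

lemma AA_c1 (φ : SchwartzMap V3 ℝ) (i j : Fin 3) : ContDiff ℝ 1 (AA φ i j) := Tk_c1 (KB_K0 i j) φ
lemma AA_cont (φ : SchwartzMap V3 ℝ) (i j : Fin 3) : Continuous (AA φ i j) := (AA_c1 φ i j).continuous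
lemma AA_symm (φ : V3 → ℝ) (i j : Fin 3) (x : V3) : AA φ i j x = AA φ j i x := by
  unfold AA; rw [funext (K0_symm i j)]

lemma qf_cont (φ : SchwartzMap V3 ℝ) {G : V3 → V3} (hG : Continuous G) : Continuous (fun x => qf φ x (G x)) := by
  unfold qf
  have h1 := fun i j => AA_cont φ i j
  have h2 := fun i => (coord_cont i).comp hG
  refine continuous_finsetSum _ fun i _ => continuous_finsetSum _ fun j _ => ((h1 i j).mul (h2 i)).mul (h2 j)

lemma pd_zero_of {U : V3 → ℝ} {x : V3} (h : x ∉ tsupport U) (i : Fin 3) : pd i U x = 0 := by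
  unfold pd; rw [fderiv_of_notMem_tsupport ℝ h]; rfl

lemma gr_zero_of {U : V3 → ℝ} {x : V3} (h : x ∉ tsupport U) : gr U x = 0 := by
  ext i; rw [gr_apply, pd_zero_of h]; rfl

lemma qf_zero (φ : V3 → ℝ) (x : V3) : qf φ x 0 = 0 := by simp [qf]

lemma cs_of {U F : V3 → ℝ} (hU : HasCompactSupport U) (h : ∀ x, x ∉ tsupport U → F x = 0) : HasCompactSupport F :=
  HasCompactSupport.intro hU h

lemma qf_integrable (φ : SchwartzMap V3 ℝ) {U : V3 → ℝ} (h : ContDiff ℝ 1 U) (hc : HasCompactSupport U) :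
    Integrable (fun x => qf φ x (gr U x)) :=
  (qf_cont φ (gr_cont h)).integrable_of_hasCompactSupport (cs_of hc fun x hx => by rw [gr_zero_of hx, qf_zero])

lemma lint_real {U : V3 → ℝ} (φ : SchwartzMap V3 ℝ) (h0 : ∀ v, 0 ≤ φ v) (h : ContDiff ℝ 1 U) (hc : HasCompactSupport U) {c : ℝ} (hcc : 0 ≤ c)
    (H : ∫⁻ x, ENNReal.ofReal (U x ^ 2) ≤ ENNReal.ofReal c * ∫⁻ q, AqE φ q (gr U q)) :
    ∫ x, U x ^ 2 ≤ c * ∫ x, qf φ x (gr U x) := by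
  simp only [AqE_eq φ h0] at H
  have i1 : Integrable (fun x => U x ^ 2) := (h.continuous.pow 2).integrable_of_hasCompactSupport
    (cs_of hc fun x hx => by simp [image_eq_zero_of_notMem_tsupport hx])
  rw [← ofReal_integral_eq_lintegral_ofReal i1 (Filter.Eventually.of_forall fun x => sq_nonneg _),
    ← ofReal_integral_eq_lintegral_ofReal (qf_integrable φ h hc) (Filter.Eventually.of_forall fun x => qf_nonneg φ h0 _ _),
    ← ENNReal.ofReal_mul hcc] at H
  exact (ENNReal.ofReal_le_ofReal_iff (mul_nonneg hcc (integral_nonneg fun x => qf_nonneg φ h0 _ _))).1 H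

variable {Sg : ℝ} {E : Set V3} {U : V3 → ℝ} {x : ℝ}

theorem rstatic_s (φ : SchwartzMap V3 ℝ) (hf : FH φ Sg) (h : ContDiff ℝ 1 U) (hc : HasCompactSupport U)
    (hE : MeasurableSet E) (hUE : ∀ x, U x ≠ 0 → x ∈ E) (hx : 0 < x) (hxS : 800 * Sg * x ≤ 1)
    (hvol : ∀ c, volume (E ∩ Metric.ball c 1) ≤ ENNReal.ofReal (2 * x ^ 3 / √(jap c) ^ 5)) :
    ∫ v, U v ^ 2 ≤ 10 ^ 17 * Sg ^ 2 * x ^ 2 * ∫ v, qf φ v (gr U v) :=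
  lint_real φ hf.nn h hc (by positivity)
    (static_s hf (fun v => gr_hasF (h.differentiable one_ne_zero v)) (gr_cont h) hE hUE hx hxS hvol)

theorem rstatic_L (φ : SchwartzMap V3 ℝ) (hf : FH φ Sg) (h : ContDiff ℝ 1 U) (hc : HasCompactSupport U)
    (hE : MeasurableSet E) (hUE : ∀ x, U x ≠ 0 → x ∈ E) (hx : 0 < x) (hx1 : 800 * x ≤ 1)
    {l : ℝ} (hl : Sg ^ 4 ≤ l) (hEl : ∀ x ∈ E, l / 2 ≤ φ x)
    (hvol : ∀ c, volume (E ∩ Metric.ball c 1) ≤ ENNReal.ofReal (2 * x ^ 5 / (√l * √(jap c)) ^ 3)) :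
    ∫ v, U v ^ 2 ≤ 10 ^ 25 * x ^ 2 / l * ∫ v, qf φ v (gr U v) := by
  have : 0 ≤ l := le_trans (by positivity) hl
  exact lint_real φ hf.nn h hc (by positivity)
    (static_L hf (fun v => gr_hasF (h.differentiable one_ne_zero v)) (gr_cont h) hE hUE hx hx1 hl hEl hvol)

/-! energy identity -/

lemma div_zero {X : V3 → ℝ} (h : ContDiff ℝ 1 X) (hc : HasCompactSupport X) (i : Fin 3) :
    Integrable (pd i X) ∧ ∫ v, pd i X v = 0 := by
  have hi : Integrable (pd i X) := (pd_cont h i).integrable_of_hasCompactSupport (cs_of hc fun x hx => pd_zero_of hx i)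
  refine ⟨hi, ?_⟩
  have := integral_mul_fderiv_eq_neg_fderiv_mul_of_integrable (μ := (volume : Measure V3)) (f := fun _ : V3 => (1:ℝ)) (g := X)
    (v := EuclideanSpace.single i 1) (by simp) (by simp only [one_mul]; exact hi)
    (by simpa using h.continuous.integrable_of_hasCompactSupport hc) (fun z _ => differentiableAt_const _)
    (fun z _ => h.differentiable one_ne_zero z)
  simpa [pd] using this

/-- integrand of the energy identity -/
def enI (φ g : SchwartzMap V3 ℝ) (P P' P'' : ℝ → ℝ) (χ : V3 → ℝ) (v : V3) : ℝ :=
  (∑ i, ∑ j, AA φ i j v * dS i (dS j g) v) * P' (g v) * χ v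
  + P'' (g v) * χ v * (∑ i, ∑ j, AA φ i j v * dS i g v * dS j g v)
  + 2 * P' (g v) * (∑ i, ∑ j, AA φ i j v * dS i g v * pd j χ v)
  + kap * φ v * P (g v) * χ v
  + P (g v) * (∑ i, ∑ j, AA φ i j v * pd i (pd j χ) v)

def enX (φ g : SchwartzMap V3 ℝ) (P P' : ℝ → ℝ) (χ : V3 → ℝ) (i : Fin 3) (v : V3) : ℝ :=
  ((∑ j, AA φ i j v * dS j g v) * P' (g v)) * χ v - (Tk N0 (dS i φ) v * P (g v)) * χ v
    + P (g v) * (∑ j, AA φ i j v * pd j χ v)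

lemma pd_comp {P P' : ℝ → ℝ} (hP : ∀ y, HasDerivAt P (P' y) y) (g : SchwartzMap V3 ℝ) (i : Fin 3) (v : V3) :
    pd i (fun v => P (g v)) v = P' (g v) * dS i g v := by
  have h := (hP (g v)).comp_hasFDerivAt v (schw_diff g v)
  change pd i (P ∘ g) v = _
  rw [pd_eq h, dS_apply]; simp [pd]

lemma energy_id (φ g : SchwartzMap V3 ℝ) {P P' P'' : ℝ → ℝ} (hP : ∀ y, HasDerivAt P (P' y) y)
    (hP' : ∀ y, HasDerivAt P' (P'' y) y) (hP'' : Continuous P'') {χ : V3 → ℝ} (hχ : ContDiff ℝ 2 χ) (hc : HasCompactSupport χ) :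
    Integrable (enI φ g P P' P'' χ) ∧ ∫ v, enI φ g P P' P'' χ v = 0 := by
  have cP' : ContDiff ℝ 1 P' := contDiff_one_iff_deriv.2 ⟨fun y => (hP' y).differentiableAt, by
    rw [show deriv P' = P'' from funext fun y => (hP' y).deriv]; exact hP''⟩
  have cP : ContDiff ℝ 1 P := contDiff_one_iff_deriv.2 ⟨fun y => (hP y).differentiableAt, by
    rw [show deriv P = P' from funext fun y => (hP y).deriv]; exact cP'.continuous⟩
  have cg : ContDiff ℝ 1 g := g.smooth 1
  have cdg : ∀ j, ContDiff ℝ 1 (dS j g) := fun j => (dS j g).smooth 1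
  have cχ : ContDiff ℝ 1 χ := hχ.of_le (by norm_num)
  have cdχ : ∀ j, ContDiff ℝ 1 (pd j χ) := fun j =>
    (hχ.fderiv_right (m := 1) (by norm_num)).clm_apply contDiff_const
  have cPg : ContDiff ℝ 1 (fun v => P (g v)) := cP.comp cg
  have cPg' : ContDiff ℝ 1 (fun v => P' (g v)) := cP'.comp cg
  have cB : ∀ i, ContDiff ℝ 1 (Tk N0 (dS i φ)) := fun i => Tk_c1 KB_N0 _
  have cA1 : ∀ i, ContDiff ℝ 1 (fun v => ∑ j, AA φ i j v * dS j g v) := fun i => ContDiff.sum fun j _ => (AA_c1 φ i j).mul (cdg j)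
  have cA2 : ∀ i, ContDiff ℝ 1 (fun v => ∑ j, AA φ i j v * pd j χ v) := fun i => ContDiff.sum fun j _ => (AA_c1 φ i j).mul (cdχ j)
  have cX : ∀ i, ContDiff ℝ 1 (enX φ g P P' χ i) := fun i =>
    ((((cA1 i).mul cPg').mul cχ).sub (((cB i).mul cPg).mul cχ)).add (cPg.mul (cA2 i))
  have sX : ∀ i, HasCompactSupport (enX φ g P P' χ i) := fun i => cs_of hc fun x hx => by
    unfold enX
    have h1 := image_eq_zero_of_notMem_tsupport hx
    have h2 := fun j => pd_zero_of hx j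
    simp [h1, h2]
  have key : ∀ v, enI φ g P P' P'' χ v = ∑ i, pd i (enX φ g P P' χ i) v := by
    intro v
    have D : ∀ {F : V3 → ℝ}, ContDiff ℝ 1 F → DifferentiableAt ℝ F v := fun h => h.differentiable one_ne_zero v
    have e : ∀ i, pd i (enX φ g P P' χ i) v =
        ((∑ j, (AA (dS i φ) i j v * dS j g v + AA φ i j v * dS i (dS j g) v)) * P' (g v) + (∑ j, AA φ i j v * dS j g v) * (P'' (g v) * dS i g v)) * χ v
        + ((∑ j, AA φ i j v * dS j g v) * P' (g v)) * pd i χ v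
        - ((Tk N0 (dS i (dS i φ)) v * P (g v) + Tk N0 (dS i φ) v * (P' (g v) * dS i g v)) * χ v + (Tk N0 (dS i φ) v * P (g v)) * pd i χ v)
        + (P' (g v) * dS i g v * (∑ j, AA φ i j v * pd j χ v) + P (g v) * (∑ j, (AA (dS i φ) i j v * pd j χ v + AA φ i j v * pd i (pd j χ) v))) := by
      intro i
      unfold enX
      have d1 := D (((cA1 i).mul cPg').mul cχ)
      have d2 := D (((cB i).mul cPg).mul cχ)
      rw [pd_add (d1.fun_sub d2) (D (cPg.mul (cA2 i))), pd_sub d1 d2, pd_mul (D ((cA1 i).mul cPg')) (D cχ),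
        pd_mul (D (cA1 i)) (D cPg'), pd_mul (D ((cB i).mul cPg)) (D cχ), pd_mul (D (cB i)) (D cPg),
        pd_mul (D cPg) (D (cA2 i)), pd_sum fun j => D ((AA_c1 φ i j).mul (cdg j)), pd_sum fun j => D ((AA_c1 φ i j).mul (cdχ j))]
      have a1 : ∀ j, pd i (fun v => AA φ i j v * dS j g v) v = AA (dS i φ) i j v * dS j g v + AA φ i j v * dS i (dS j g) v := by
        intro j
        rw [pd_mul (D (AA_c1 φ i j)) (D (cdg j)), dS_apply i (dS j g)]
        congr 2
        exact pd_Tk (KB_K0 i j) φ i v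
      have a2 : ∀ j, pd i (fun v => AA φ i j v * pd j χ v) v = AA (dS i φ) i j v * pd j χ v + AA φ i j v * pd i (pd j χ) v := by
        intro j
        rw [pd_mul (D (AA_c1 φ i j)) (D (cdχ j))]
        congr 2
        exact pd_Tk (KB_K0 i j) φ i v
      have a3 := pd_comp hP g i v
      have a4 := pd_comp hP' g i v
      have a5 := pd_Tk KB_N0 (dS i φ) i v
      simp only [a1, a2]
      rw [a3, a4, a5]
    rw [Finset.sum_congr rfl fun i _ => e i]
    have h4 := N4 φ v
    have h3 := fun j => N3 j φ v
    unfold enI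
    have hs : ∀ i j, AA φ i j v = AA φ j i v := fun i j => AA_symm φ i j v
    have s01 := hs 1 0
    have s02 := hs 2 0
    have s12 := hs 2 1
    have h30 := h3 0
    have h31 := h3 1
    have h32 := h3 2
    simp only [Fin.sum_univ_three] at h30 h31 h32 h4 ⊢
    change AA (dS 0 φ) 0 0 v + AA (dS 1 φ) 1 0 v + AA (dS 2 φ) 2 0 v = _ at h30
    change AA (dS 0 φ) 0 1 v + AA (dS 1 φ) 1 1 v + AA (dS 2 φ) 2 1 v = _ at h31
    change AA (dS 0 φ) 0 2 v + AA (dS 1 φ) 1 2 v + AA (dS 2 φ) 2 2 v = _ at h32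
    rw [s01, s02, s12, ← h30, ← h31, ← h32]
    linear_combination (P (g v) * χ v) * h4
  constructor
  · rw [show enI φ g P P' P'' χ = fun v => ∑ i, pd i (enX φ g P P' χ i) v from funext key]
    exact integrable_finsetSum _ fun i _ => (div_zero (cX i) (sX i) i).1
  · rw [integral_congr_ae (Filter.Eventually.of_forall key), integral_finsetSum _ fun i _ => (div_zero (cX i) (sX i) i).1]
    exact Finset.sum_eq_zero fun i _ => (div_zero (cX i) (sX i) i).2

end LL

namespace LL
open scoped ENNReal

/-- good cutoff -/
structure Cut (η : V3 → ℝ) (δ : ℝ) : Prop where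
  sm : ContDiff ℝ 2 η
  cs : HasCompactSupport η
  nn : ∀ v, 0 ≤ η v
  le : ∀ v, η v ≤ 1
  d0 : 0 ≤ δ
  d1 : δ ≤ 1
  g1 : ∀ i v, |pd i η v| ≤ δ
  g2 : ∀ i j v, |pd i (pd j (fun v => η v ^ 2)) v| ≤ δ

lemma pd_scale {F : V3 → ℝ} (hF : Differentiable ℝ F) (lam : ℝ) (i : Fin 3) (v : V3) :
    pd i (fun v => F (lam • v)) v = lam * pd i F (lam • v) := by
  have h1 : HasFDerivAt (fun v : V3 => lam • v) (lam • ContinuousLinearMap.id ℝ V3) v := (hasFDerivAt_id v).const_smul lam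
  have h := (hF (lam • v)).hasFDerivAt.comp v h1
  change pd i (F ∘ fun v => lam • v) v = _
  rw [pd_eq h]; simp [pd]

lemma pd_c {n : ℕ} {F : V3 → ℝ} (hF : ContDiff ℝ (n+1 : ℕ) F) (i : Fin 3) : ContDiff ℝ n (pd i F) :=
  (hF.fderiv_right (m := n) (by norm_cast)).clm_apply contDiff_const

lemma pd_bdd {F : V3 → ℝ} (hF : ContDiff ℝ 1 F) (hc : HasCompactSupport F) (i : Fin 3) : ∃ D, ∀ v, |pd i F v| ≤ D := by
  have h : HasCompactSupport (pd i F) := cs_of hc fun x hx => pd_zero_of hx i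
  obtain ⟨D, hD⟩ := h.exists_bound_of_continuous (pd_cont hF i)
  exact ⟨D, hD⟩

lemma pd_cs {F : V3 → ℝ} (hc : HasCompactSupport F) (i : Fin 3) : HasCompactSupport (pd i F) := cs_of hc fun x hx => pd_zero_of hx i

lemma sq_cs {F : V3 → ℝ} (hc : HasCompactSupport F) : HasCompactSupport (fun v => F v ^ 2) :=
  cs_of hc fun x hx => by simp [image_eq_zero_of_notMem_tsupport hx]

lemma exists_cut : ∃ (η : ℕ → V3 → ℝ) (δ : ℕ → ℝ), (∀ n, Cut (η n) (δ n)) ∧ Filter.Tendsto δ Filter.atTop (nhds 0) ∧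
    ∀ v, Filter.Tendsto (fun n => η n v) Filter.atTop (nhds 1) := by
  let b : ContDiffBump (0 : V3) := ⟨1, 2, by norm_num, by norm_num⟩
  have hb : ContDiff ℝ 2 b := b.contDiff
  have hbc : HasCompactSupport b := b.hasCompactSupport
  have hb2 : ContDiff ℝ 2 (fun v => b v ^ 2) := hb.pow 2
  have hb1 : ContDiff ℝ 1 b := hb.of_le (by norm_num)
  have hb21 : ∀ j, ContDiff ℝ 1 (pd j (fun v => b v ^ 2)) := fun j => pd_c (n := 1) hb2 j
  choose D1 hD1 using fun i => pd_bdd hb1 hbc i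
  choose D2 hD2 using fun i j => pd_bdd (hb21 j) (pd_cs (sq_cs hbc) j) i
  have n1 : ∀ i, 0 ≤ D1 i := fun i => (abs_nonneg _).trans (hD1 i 0)
  have n2 : ∀ i j, 0 ≤ D2 i j := fun i j => (abs_nonneg _).trans (hD2 i j 0)
  obtain ⟨D, hD0, hE1, hE2⟩ : ∃ D : ℝ, 0 ≤ D ∧ (∀ i, D1 i ≤ D) ∧ (∀ i j, D2 i j ≤ D) := by
    refine ⟨∑ i, D1 i + ∑ i, ∑ j, D2 i j, add_nonneg (Finset.sum_nonneg fun i _ => n1 i) (Finset.sum_nonneg fun i _ => Finset.sum_nonneg fun j _ => n2 i j), fun i => ?_, fun i j => ?_⟩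
    · have a := Finset.single_le_sum (fun i _ => n1 i) (Finset.mem_univ i)
      have := (Finset.sum_nonneg fun i (_ : i ∈ Finset.univ) => Finset.sum_nonneg fun j (_ : j ∈ Finset.univ) => n2 i j)
      linarith
    · have a := Finset.single_le_sum (fun j _ => n2 i j) (Finset.mem_univ j)
      have a2 := Finset.single_le_sum (fun i _ => Finset.sum_nonneg fun j (_ : j ∈ Finset.univ) => n2 i j) (Finset.mem_univ i)
      have := (Finset.sum_nonneg fun i (_ : i ∈ Finset.univ) => n1 i)
      linarith
  let lam : ℕ → ℝ := fun n => 1 / (n + 1 + D)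
  have hl0 : ∀ n, 0 < lam n := fun n => by have : (0:ℝ) ≤ n := n.cast_nonneg; simp only [lam]; positivity
  have hl1 : ∀ n, lam n ≤ 1 := fun n => by
    have : (0:ℝ) ≤ n := n.cast_nonneg
    simp only [lam]; rw [div_le_one (by positivity)]; linarith
  have hlD : ∀ n, lam n * D ≤ 1 := fun n => by
    have : (0:ℝ) ≤ n := n.cast_nonneg
    simp only [lam]; rw [div_mul_eq_mul_div, div_le_one (by positivity)]; linarith
  have hlt : Filter.Tendsto lam Filter.atTop (nhds 0) := by
    have : Filter.Tendsto (fun n : ℕ => (n:ℝ) + 1 + D) Filter.atTop Filter.atTop :=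
      Filter.tendsto_atTop_add_const_right _ _ (Filter.tendsto_atTop_add_const_right _ _ tendsto_natCast_atTop_atTop)
    exact tendsto_const_nhds.div_atTop this
  refine ⟨fun n v => b (lam n • v), fun n => lam n * D, fun n => ?_, by simpa using hlt.mul_const D, fun v => ?_⟩
  · refine ⟨hb.comp (contDiff_const_smul _), ?_, fun v => b.nonneg, fun v => b.le_one, mul_nonneg (hl0 n).le hD0, hlD n, fun i v => ?_, fun i j v => ?_⟩
    · exact hbc.comp_smul (hl0 n).ne'
    · rw [pd_scale (hb.differentiable (by norm_num)), abs_mul, abs_of_pos (hl0 n)]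
      exact mul_le_mul_of_nonneg_left ((hD1 _ _).trans (hE1 _)) (hl0 n).le
    · have e : pd j (fun v => b (lam n • v) ^ 2) = fun v => lam n * pd j (fun v => b v ^ 2) (lam n • v) := by
        ext v; exact pd_scale (hb2.differentiable (by norm_num)) _ j v
      rw [e]
      have e2 := pd_mul (i := i) (v := v) (F := fun _ => lam n) (G := fun v => pd j (fun v => b v ^ 2) (lam n • v)) (differentiableAt_const _)
        (((hb21 j).differentiable one_ne_zero).comp ((differentiable_id).const_smul (lam n)) v)
      rw [e2, pd_scale ((hb21 j).differentiable one_ne_zero)]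
      have : pd i (fun _ : V3 => lam n) v = 0 := by simp [pd]
      rw [this, zero_mul, zero_add, abs_mul, abs_mul, abs_of_pos (hl0 n)]
      have := (hD2 i j (lam n • v)).trans (hE2 i j)
      have h3 : lam n * |pd i (pd j (fun v => b v ^ 2)) (lam n • v)| ≤ D := by
        have := mul_le_mul (hl1 n) this (abs_nonneg _) zero_le_one
        linarith
      exact mul_le_mul_of_nonneg_left h3 (hl0 n).le
  · refine tendsto_const_nhds.congr' ?_
    have h : Filter.Tendsto (fun n => lam n * ‖v‖) Filter.atTop (nhds 0) := by simpa using hlt.mul_const ‖v‖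
    filter_upwards [h.eventually_lt_const zero_lt_one] with n hn
    refine (b.one_of_mem_closedBall ?_).symm
    rw [mem_closedBall_zero_iff, norm_smul, Real.norm_eq_abs, abs_of_pos (hl0 n)]
    exact hn.le

/-- convex cutoff function data -/
structure Cvx (w w' w'' : ℝ → ℝ) : Prop where
  d1 : ∀ y, HasDerivAt w (w' y) y
  d2 : ∀ y, HasDerivAt w' (w'' y) y
  c2 : Continuous w''
  n0 : ∀ y, 0 ≤ w y
  n1 : ∀ y, 0 ≤ w' y
  n2 : ∀ y, 0 ≤ w'' y
  le : ∀ y, w y ≤ |y|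

lemma Cvx.cw {w w' w'' : ℝ → ℝ} (h : Cvx w w' w'') : Continuous w := continuous_iff_continuousAt.2 fun y => (h.d1 y).continuousAt
lemma Cvx.cw' {w w' w'' : ℝ → ℝ} (h : Cvx w w' w'') : Continuous w' := continuous_iff_continuousAt.2 fun y => (h.d2 y).continuousAt

lemma Cvx.c1 {w w' w'' : ℝ → ℝ} (h : Cvx w w' w'') : ContDiff ℝ 1 w := contDiff_one_iff_deriv.2 ⟨fun y => (h.d1 y).differentiableAt, by
    rw [show deriv w = w' from funext fun y => (h.d1 y).deriv]; exact h.cw'⟩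

def bf (φ : V3 → ℝ) (x ξ ζ : V3) : ℝ := ∑ i, ∑ j, AA φ i j x * ξ i * ζ j

lemma qf_add (φ : V3 → ℝ) (x ξ ζ : V3) (a b : ℝ) : qf φ x (a • ξ + b • ζ) =
    a ^ 2 * qf φ x ξ + 2 * (a * b) * bf φ x ξ ζ + b ^ 2 * qf φ x ζ := by
  have s01 := AA_symm φ 1 0 x
  have s02 := AA_symm φ 2 0 x
  have s12 := AA_symm φ 2 1 x
  simp only [qf, bf, Fin.sum_univ_three, PiLp.add_apply, PiLp.smul_apply, smul_eq_mul, s01, s02, s12]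
  ring

/-- `A : D²g` -/
def AD (φ : V3 → ℝ) (g : SchwartzMap V3 ℝ) (v : V3) : ℝ := ∑ i, ∑ j, AA φ i j v * dS i (dS j g) v

lemma AD_cont (φ g : SchwartzMap V3 ℝ) : Continuous (AD φ g) :=
  continuous_finsetSum _ fun i _ => continuous_finsetSum _ fun j _ => (AA_cont φ i j).mul (dS i (dS j g)).continuous

lemma gr_mul {F η : V3 → ℝ} {v : V3} (hF : DifferentiableAt ℝ F v) (h : DifferentiableAt ℝ η v) :
    gr (fun v => F v * η v) v = η v • gr F v + F v • gr η v := by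
  ext i
  simp only [gr_apply, PiLp.add_apply, PiLp.smul_apply, smul_eq_mul]
  rw [pd_mul hF h]; ring

lemma gr_comp {P P' : ℝ → ℝ} (hP : ∀ y, HasDerivAt P (P' y) y) (g : SchwartzMap V3 ℝ) (v : V3) :
    gr (fun v => P (g v)) v = P' (g v) • gr g v := by
  ext i
  simp only [gr_apply, PiLp.smul_apply, smul_eq_mul]
  rw [pd_comp hP, dS_apply]

lemma qf_abs_le {φ : V3 → ℝ} {x ξ : V3} {M δ : ℝ} (hM : ∀ i j, |AA φ i j x| ≤ M) (hξ : ∀ i, |ξ i| ≤ δ) :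
    qf φ x ξ ≤ 9 * M * δ ^ 2 := by
  have h : ∀ i j, AA φ i j x * ξ i * ξ j ≤ M * δ ^ 2 := fun i j => by
    refine (le_abs_self _).trans ?_
    rw [abs_mul, abs_mul, pow_two, ← mul_assoc]
    have hM0 := (abs_nonneg _).trans (hM i j)
    have hd := (abs_nonneg _).trans (hξ i)
    gcongr
    exacts [hM i j, hξ i, hξ j]
  unfold qf
  calc _ ≤ ∑ i : Fin 3, ∑ j : Fin 3, M * δ ^ 2 := Finset.sum_le_sum fun i _ => Finset.sum_le_sum fun j _ => h i j
    _ = _ := by simp; ring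

theorem energy_ineq (φ g : SchwartzMap V3 ℝ) (h0 : ∀ v, 0 ≤ φ v) {w w' w'' : ℝ → ℝ} (hw : Cvx w w' w'')
    {η : V3 → ℝ} {δ M : ℝ} (hη : Cut η δ) (hM : ∀ i j v, |AA φ i j v| ≤ M) :
    ∫ v, AD φ g v * (2 * w (g v) * w' (g v)) * η v ^ 2 ≤
      -(1/2) * (∫ v, qf φ v (gr (fun v => w (g v) * η v) v)) - 1/2 * (∫ v, w' (g v) ^ 2 * η v ^ 2 * qf φ v (gr g v))
        + 126 * M * δ * ∫ v, g v ^ 2 := by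
  have hk := kap_nonneg
  have hM0 : 0 ≤ M := (abs_nonneg _).trans (hM 0 0 0)
  have cg : Continuous g := g.continuous
  have cη : Continuous η := hη.sm.continuous
  have c1η : ContDiff ℝ 1 η := hη.sm.of_le (by norm_num)
  have cwg : ContDiff ℝ 1 (fun v => w (g v)) := hw.c1.comp (g.smooth 1)
  have dP : ∀ y, HasDerivAt (fun y => w y ^ 2) (2 * w y * w' y) y := fun y => by
    have := (hw.d1 y).fun_pow 2; simpa using this
  have dP' : ∀ y, HasDerivAt (fun y => 2 * w y * w' y) (2 * w' y ^ 2 + 2 * w y * w'' y) y := fun y => by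
    have := ((hw.d1 y).const_mul 2).fun_mul (hw.d2 y)
    rw [show 2 * w' y ^ 2 + 2 * w y * w'' y = 2 * w' y * w' y + 2 * w y * w'' y by ring]; exact this
  obtain ⟨eI, e0⟩ := energy_id φ g dP dP' (((hw.cw'.pow 2).const_mul 2).add ((hw.cw.const_mul 2).mul hw.c2)) (hη.sm.pow 2) (sq_cs hη.cs)
  have i1 : Integrable (fun v => AD φ g v * (2 * w (g v) * w' (g v)) * η v ^ 2) :=
    (((AD_cont φ g).mul (((hw.cw.comp cg).const_mul 2).mul (hw.cw'.comp cg))).mul (cη.pow 2)).integrable_of_hasCompactSupport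
      (cs_of hη.cs fun x hx => by simp [image_eq_zero_of_notMem_tsupport hx])
  have cU : ContDiff ℝ 1 (fun v => w (g v) * η v) := cwg.mul c1η
  have sU : HasCompactSupport (fun v => w (g v) * η v) := cs_of hη.cs fun x hx => by simp [image_eq_zero_of_notMem_tsupport hx]
  have i2 := qf_integrable φ cU sU
  have i3 : Integrable (fun v => w' (g v) ^ 2 * η v ^ 2 * qf φ v (gr g v)) :=
    ((((hw.cw'.comp cg).pow 2).mul (cη.pow 2)).mul (qf_cont φ (gr_cont (g.smooth 1)))).integrable_of_hasCompactSupport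
      (cs_of hη.cs fun x hx => by simp [image_eq_zero_of_notMem_tsupport hx])
  have i4 : Integrable (fun v => g v ^ 2) := by
    have := (g.memLp 2 volume).integrable_sq
    exact this
  have key : ∀ v, AD φ g v * (2 * w (g v) * w' (g v)) * η v ^ 2 ≤
      enI φ g (fun y => w y ^ 2) (fun y => 2 * w y * w' y) (fun y => 2 * w' y ^ 2 + 2 * w y * w'' y) (fun v => η v ^ 2) v
      - 1/2 * qf φ v (gr (fun v => w (g v) * η v) v) - 1/2 * (w' (g v) ^ 2 * η v ^ 2 * qf φ v (gr g v)) + 126 * M * δ * g v ^ 2 := by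
    intro v
    have hu : gr (fun v => w (g v) * η v) v = (w' (g v) * η v) • gr g v + (w (g v)) • gr η v := by
      rw [gr_mul (cwg.differentiable one_ne_zero v) (c1η.differentiable one_ne_zero v), gr_comp hw.d1, smul_smul, mul_comm]
    have q1 := qf_add φ v (gr g v) (gr η v) (w' (g v) * η v) (w (g v))
    have q2 := qf_add φ v (gr g v) (gr η v) (w' (g v) * η v) (7/2 * w (g v))
    have p2 := qf_nonneg φ h0 v ((w' (g v) * η v) • gr g v + (7/2 * w (g v)) • gr η v)
    have p3 := qf_nonneg φ h0 v (gr g v)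
    have p4 := qf_nonneg φ h0 v (gr η v)
    have bd4 := qf_abs_le (x := v) (ξ := gr η v) (fun i j => hM i j v) (fun i => hη.g1 i v)
    have hchi : ∀ j, pd j (fun v => η v ^ 2) v = 2 * η v * pd j η v := by
      intro j
      have : (fun v => η v ^ 2) = fun v => η v * η v := by ext v; ring
      rw [this, pd_mul (c1η.differentiable one_ne_zero v) (c1η.differentiable one_ne_zero v)]; ring
    have hB : ∑ i, ∑ j, AA φ i j v * dS i g v * pd j (fun v => η v ^ 2) v = 2 * η v * bf φ v (gr g v) (gr η v) := by
      simp only [hchi, bf, gr_apply, dS_apply, Finset.mul_sum]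
      exact Finset.sum_congr rfl fun i _ => Finset.sum_congr rfl fun j _ => by ring
    have hQ : ∑ i, ∑ j, AA φ i j v * dS i g v * dS j g v = qf φ v (gr g v) := by
      simp only [qf, gr_apply, dS_apply]
    have hR : -(∑ i, ∑ j, AA φ i j v * pd i (pd j (fun v => η v ^ 2)) v) ≤ 9 * M * δ := by
      have h : ∀ i j, -(AA φ i j v * pd i (pd j (fun v => η v ^ 2)) v) ≤ M * δ := fun i j => by
        refine (neg_le_abs _).trans ?_
        rw [abs_mul]
        exact mul_le_mul (hM i j v) (hη.g2 i j v) (abs_nonneg _) hM0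
      simp only [Fin.sum_univ_three]
      linarith [h 0 0, h 0 1, h 0 2, h 1 0, h 1 1, h 1 2, h 2 0, h 2 1, h 2 2]
    unfold enI
    simp only [hB, hQ]
    change AD φ g v * (2 * w (g v) * w' (g v)) * η v ^ 2 ≤ AD φ g v * (2 * w (g v) * w' (g v)) * η v ^ 2 + _ + _ + _ + _ - _ - _ + _
    rw [hu, q1]
    rw [q2] at p2
    generalize qf φ v (gr g v) = Q at *
    generalize bf φ v (gr g v) (gr η v) = B at *
    generalize qf φ v (gr η v) = E at *
    generalize (∑ i, ∑ j, AA φ i j v * pd i (pd j (fun v => η v ^ 2)) v) = R at *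
    have n1 : 0 ≤ w (g v) * w'' (g v) * η v ^ 2 * Q := by have := hw.n0 (g v); have := hw.n2 (g v); positivity
    have n2 : 0 ≤ kap * φ v * w (g v) ^ 2 * η v ^ 2 := by have := h0 v; positivity
    have n3 : w (g v) ^ 2 ≤ g v ^ 2 := by rw [← sq_abs (g v)]; exact pow_le_pow_left₀ (hw.n0 _) (hw.le _) 2
    have n4 : 13 * E - R ≤ 126 * M * δ := by
      have : M * δ ^ 2 ≤ M * δ := by
        have := mul_nonneg (mul_nonneg hM0 hη.d0) (sub_nonneg.2 hη.d1); nlinarith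
      nlinarith
    have n5 : w (g v) ^ 2 * (13 * E - R) ≤ 126 * M * δ * g v ^ 2 := by
      have := hη.d0
      calc _ ≤ w (g v) ^ 2 * (126 * M * δ) := mul_le_mul_of_nonneg_left n4 (sq_nonneg _)
        _ ≤ g v ^ 2 * (126 * M * δ) := mul_le_mul_of_nonneg_right n3 (by positivity)
        _ = _ := by ring
    nlinarith [mul_nonneg (sq_nonneg (w (g v))) p4]
  have := integral_mono i1 (((eI.sub (i2.const_mul (1/2))).sub (i3.const_mul (1/2))).add (i4.const_mul (126 * M * δ))) key
  refine this.trans (le_of_eq ?_)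
  have e := integral_add ((eI.sub (i2.const_mul (1/2))).sub (i3.const_mul (1/2))) (i4.const_mul (126 * M * δ))
  have e' := integral_sub (eI.sub (i2.const_mul (1/2))) (i3.const_mul (1/2))
  have e'' := integral_sub eI (i2.const_mul (1/2))
  simp only [Pi.add_apply, Pi.sub_apply, integral_const_mul] at e e' e'' ⊢
  rw [e, e', e'', e0]; ring

end LL

namespace LL
open scoped ENNReal

def rr (y : ℝ) : ℝ := 6 * max 0 (y * (1 - y))
def th (y : ℝ) : ℝ := ∫ s in (0:ℝ)..y, rr s
def VV (y : ℝ) : ℝ := ∫ s in (0:ℝ)..y, th s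

lemma rr_cont : Continuous rr := by unfold rr; fun_prop
lemma rr_nn (y : ℝ) : 0 ≤ rr y := by unfold rr; positivity
lemma rr_le (y : ℝ) : rr y ≤ 3/2 := by
  unfold rr
  have : max 0 (y * (1 - y)) ≤ 1/4 := max_le (by norm_num) (by nlinarith [sq_nonneg (y - 1/2)])
  linarith
lemma rr_neg {y : ℝ} (h : y ≤ 0) : rr y = 0 := by
  unfold rr; rw [max_eq_left (by nlinarith)]; ring
lemma rr_big {y : ℝ} (h : 1 ≤ y) : rr y = 0 := by
  unfold rr; rw [max_eq_left (by nlinarith)]; ring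
lemma th_d (y : ℝ) : HasDerivAt th (rr y) y :=
  intervalIntegral.integral_hasDerivAt_right (rr_cont.intervalIntegrable _ _) (rr_cont.stronglyMeasurableAtFilter _ _) rr_cont.continuousAt
lemma th_cont : Continuous th := continuous_iff_continuousAt.2 fun y => (th_d y).continuousAt
lemma VV_d (y : ℝ) : HasDerivAt VV (th y) y :=
  intervalIntegral.integral_hasDerivAt_right (th_cont.intervalIntegrable _ _) (th_cont.stronglyMeasurableAtFilter _ _) th_cont.continuousAt
lemma th_neg {y : ℝ} (h : y ≤ 0) : th y = 0 := by
  unfold th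
  rw [intervalIntegral.integral_congr (g := fun _ => (0:ℝ))]
  · simp
  · intro s hs
    rw [Set.uIcc_of_ge h] at hs
    exact rr_neg hs.2
lemma th_one : th 1 = 1 := by
  unfold th
  rw [intervalIntegral.integral_congr (g := fun s => 6 * s - 6 * s ^ 2)]
  · have h1 : ∫ s in (0:ℝ)..1, (6 * s - 6 * s ^ 2) = (∫ s in (0:ℝ)..1, 6 * s) - ∫ s in (0:ℝ)..1, 6 * s ^ 2 :=
      intervalIntegral.integral_sub (Continuous.intervalIntegrable (by fun_prop) _ _) (Continuous.intervalIntegrable (by fun_prop) _ _)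
    have h2 : ∫ s in (0:ℝ)..1, 6 * s = 3 := by
      rw [intervalIntegral.integral_const_mul, integral_id]; norm_num
    have h3 : ∫ s in (0:ℝ)..1, 6 * s ^ 2 = 2 := by
      rw [intervalIntegral.integral_const_mul, integral_pow]; norm_num
    rw [h1, h2, h3]; norm_num
  · intro s hs
    rw [Set.uIcc_of_le zero_le_one] at hs
    simp only [rr]
    rw [max_eq_right (mul_nonneg hs.1 (by linarith [hs.2]))]; ring
lemma th_big {y : ℝ} (h : 1 ≤ y) : th y = 1 := by
  have : th y = th 1 + ∫ s in (1:ℝ)..y, rr s := by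
    unfold th
    rw [intervalIntegral.integral_add_adjacent_intervals (rr_cont.intervalIntegrable _ _) (rr_cont.intervalIntegrable _ _)]
  rw [this, th_one, intervalIntegral.integral_congr (g := fun _ => (0:ℝ))]
  · simp
  · intro s hs
    rw [Set.uIcc_of_le h] at hs
    exact rr_big hs.1
lemma th_mono : Monotone th := monotone_of_deriv_nonneg (fun y => (th_d y).differentiableAt) fun y => by
  rw [(th_d y).deriv]; exact rr_nn y
lemma th_nn (y : ℝ) : 0 ≤ th y := by
  rcases le_total y 0 with h | h
  · exact (th_neg h).ge
  · rw [← th_neg le_rfl]; exact th_mono h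
lemma th_le (y : ℝ) : th y ≤ 1 := by
  rcases le_total y 1 with h | h
  · rw [← th_one]; exact th_mono h
  · exact (th_big h).le
lemma VV_neg {y : ℝ} (h : y ≤ 0) : VV y = 0 := by
  unfold VV
  rw [intervalIntegral.integral_congr (g := fun _ => (0:ℝ))]
  · simp
  · intro s hs
    rw [Set.uIcc_of_ge h] at hs
    exact th_neg hs.2
lemma VV_mono : Monotone VV := monotone_of_deriv_nonneg (fun y => (VV_d y).differentiableAt) fun y => by
  rw [(VV_d y).deriv]; exact th_nn y
lemma VV_nn (y : ℝ) : 0 ≤ VV y := by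
  rcases le_total y 0 with h | h
  · exact (VV_neg h).ge
  · rw [← VV_neg le_rfl]; exact VV_mono h
lemma VV_le (y : ℝ) : VV y ≤ max 0 y := by
  rcases le_total y 0 with h | h
  · rw [VV_neg h]; exact le_max_left _ _
  · refine le_trans ?_ (le_max_right _ _)
    unfold VV
    have := intervalIntegral.integral_mono_on (μ := volume) (f := th) (g := fun _ => (1:ℝ)) h (th_cont.intervalIntegrable 0 y) (continuous_const.intervalIntegrable 0 y) fun s _ => th_le s
    simpa using this
lemma VV_ge (y : ℝ) : y - 1 ≤ VV y := by
  rcases le_total y 1 with h | h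
  · linarith [VV_nn y]
  · have : VV y = VV 1 + ∫ s in (1:ℝ)..y, th s := by
      unfold VV
      rw [intervalIntegral.integral_add_adjacent_intervals (th_cont.intervalIntegrable _ _) (th_cont.intervalIntegrable _ _)]
    rw [this, intervalIntegral.integral_congr (g := fun _ => (1:ℝ))]
    · simp; exact VV_nn 1
    · intro s hs
      rw [Set.uIcc_of_le h] at hs
      exact th_big hs.1

def lk (l : ℝ) (k : ℕ) : ℝ := l * (1 - (1/2) ^ (k+1))
def ek (l : ℝ) (k : ℕ) : ℝ := l * (1/2) ^ (k+3)
def wv (l : ℝ) (k : ℕ) (y : ℝ) : ℝ := ek l k * VV ((y - lk l k) / ek l k)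
def wv' (l : ℝ) (k : ℕ) (y : ℝ) : ℝ := th ((y - lk l k) / ek l k)
def wv'' (l : ℝ) (k : ℕ) (y : ℝ) : ℝ := rr ((y - lk l k) / ek l k) / ek l k

variable {l : ℝ} {k : ℕ}
lemma ek_pos (hl : 0 < l) : 0 < ek l k := by unfold ek; positivity
lemma lk_half (hl : 0 < l) : l / 2 ≤ lk l k := by
  unfold lk
  have : ((1:ℝ)/2) ^ (k+1) ≤ 1/2 := by
    rw [pow_succ]; have := pow_le_one₀ (n := k) (a := (1:ℝ)/2) (by norm_num) (by norm_num); linarith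
  nlinarith
lemma lk_pos (hl : 0 < l) : 0 < lk l k := by linarith [lk_half (k := k) hl]
lemma lk_le (hl : 0 < l) : lk l k + ek l k ≤ l := by
  unfold lk ek
  have : (0:ℝ) < (1/2) ^ k := by positivity
  rw [pow_add, pow_add]; nlinarith [mul_pos hl this]
lemma lk_succ : lk l (k+1) = lk l k + 2 * ek l k := by unfold lk ek; ring
lemma wv_le (hl : 0 < l) (y : ℝ) : wv l k y ≤ max 0 (y - lk l k) := by
  unfold wv
  have e := ek_pos (k := k) hl
  calc _ ≤ ek l k * max 0 ((y - lk l k) / ek l k) := mul_le_mul_of_nonneg_left (VV_le _) e.le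
    _ = _ := by rw [mul_max_of_nonneg _ _ e.le]; simp; rw [mul_div_cancel₀ _ e.ne']
lemma wv_ge (hl : 0 < l) (y : ℝ) : y - lk l k - ek l k ≤ wv l k y := by
  unfold wv
  have e := ek_pos (k := k) hl
  calc _ = ek l k * ((y - lk l k) / ek l k - 1) := by field_simp
    _ ≤ _ := mul_le_mul_of_nonneg_left (VV_ge _) e.le
lemma wv_nn (hl : 0 < l) (y : ℝ) : 0 ≤ wv l k y := mul_nonneg (ek_pos hl).le (VV_nn _)
lemma wv_ge_l (hl : 0 < l) (y : ℝ) : y - l ≤ wv l k y := by linarith [wv_ge (k := k) hl y, lk_le (k := k) hl]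
lemma wv_cvx (hl : 0 < l) : Cvx (wv l k) (wv' l k) (wv'' l k) := by
  have e := ek_pos (k := k) hl
  have hd : ∀ y, HasDerivAt (fun y => (y - lk l k) / ek l k) (1 / ek l k) y := fun y => ((hasDerivAt_id y).sub_const _).div_const _
  refine ⟨fun y => ?_, fun y => ?_, ?_, wv_nn hl, fun y => th_nn _, fun y => div_nonneg (rr_nn _) e.le, fun y => ?_⟩
  · have := ((VV_d _).comp y (hd y)).const_mul (ek l k)
    have e2 : ek l k * (th ((y - lk l k) / ek l k) * (1 / ek l k)) = wv' l k y := by unfold wv'; field_simp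
    rw [e2] at this; exact this
  · have := ((th_d _).comp y (hd y))
    have e2 : (rr ((y - lk l k) / ek l k) * (1 / ek l k)) = wv'' l k y := by unfold wv''; field_simp
    rw [e2] at this; exact this
  · unfold wv''; exact (rr_cont.comp (by fun_prop)).div_const _
  · refine (wv_le hl y).trans (max_le (abs_nonneg _) ?_)
    linarith [le_abs_self y, lk_pos (k := k) hl]
lemma wv'_le (y : ℝ) : wv' l k y ≤ 1 := th_le _
lemma wv'_nn (y : ℝ) : 0 ≤ wv' l k y := th_nn _
lemma wv'_zero (hl : 0 < l) {y : ℝ} (h : y ≤ lk l k) : wv' l k y = 0 := th_neg (div_nonpos_of_nonpos_of_nonneg (by linarith) (ek_pos hl).le)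
lemma wv_zero (hl : 0 < l) {y : ℝ} (h : y ≤ lk l k) : wv l k y = 0 := by
  unfold wv; rw [VV_neg (div_nonpos_of_nonpos_of_nonneg (by linarith) (ek_pos hl).le), mul_zero]
lemma wv'_one (hl : 0 < l) {y : ℝ} (h : l ≤ y) : wv' l k y = 1 := by
  refine th_big ?_
  rw [le_div_iff₀ (ek_pos hl)]; linarith [lk_le (k := k) hl]
lemma wv_succ_le (hl : 0 < l) (y : ℝ) : wv l (k+1) y ≤ wv l k y := by
  refine (wv_le hl y).trans (max_le (wv_nn hl y) ?_)
  have := wv_ge (k := k) hl y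
  have := ek_pos (k := k) hl
  rw [lk_succ]; linarith
lemma wv_prev_ge (hl : 0 < l) {y : ℝ} (h : lk l (k+1) < y) : ek l k ≤ wv l k y := by
  have := wv_ge (k := k) hl y
  rw [lk_succ] at h; linarith

end LL

namespace LL
open scoped ENNReal

/-- time-differentiable family -/
structure TD (g g' : ℝ → V3 → ℝ) (a b : ℝ) : Prop where
  dv : ∀ t ∈ Set.Ioo a b, ∀ v, HasDerivAt (fun τ => g τ v) (g' t v) t
  c0 : ContinuousOn (fun q : ℝ × V3 => g q.1 q.2) (Set.Ioo a b ×ˢ Set.univ)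
  c1 : ContinuousOn (fun q : ℝ × V3 => g' q.1 q.2) (Set.Ioo a b ×ˢ Set.univ)
  sch : ∀ t ∈ Set.Ioo a b, ∃ φ : SchwartzMap V3 ℝ, ∀ v, g t v = φ v

lemma TD.sub {g g' : ℝ → V3 → ℝ} {a b a' b' : ℝ} (h : TD g g' a b) (h1 : a ≤ a') (h2 : b' ≤ b) : TD g g' a' b' := by
  have hs : Set.Ioo a' b' ⊆ Set.Ioo a b := Set.Ioo_subset_Ioo h1 h2
  exact ⟨fun t ht => h.dv t (hs ht), h.c0.mono (Set.prod_mono hs le_rfl), h.c1.mono (Set.prod_mono hs le_rfl), fun t ht => h.sch t (hs ht)⟩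

lemma ode {F F' : ℝ → ℝ} {s t α β : ℝ} (hst : s < t) (hα : 0 < α) (hβ : 0 ≤ β)
    (hd : ∀ τ ∈ Set.Icc s t, HasDerivAt F (F' τ) τ) (hF : ∀ τ ∈ Set.Icc s t, F' τ ≤ -α * F τ + β) (h0 : 0 ≤ F s) :
    F t ≤ F s / (α * (t - s)) + β / α := by
  have hH : ∀ τ ∈ Set.Icc s t, HasDerivAt (fun τ => exp (α * (τ - s)) * (F τ - β / α))
      (exp (α * (τ - s)) * α * (F τ - β / α) + exp (α * (τ - s)) * F' τ) τ := by
    intro τ hτ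
    have h1 : HasDerivAt (fun τ => α * (τ - s)) α τ := by simpa using ((hasDerivAt_id τ).sub_const s).const_mul α
    exact h1.exp.fun_mul ((hd τ hτ).sub_const _)
  have anti : AntitoneOn (fun τ => exp (α * (τ - s)) * (F τ - β / α)) (Set.Icc s t) := by
    refine antitoneOn_of_deriv_nonpos (convex_Icc s t) (fun τ hτ => (hH τ hτ).continuousAt.continuousWithinAt)
      (fun τ hτ => (hH τ (interior_subset hτ)).differentiableAt.differentiableWithinAt) fun τ hτ => ?_
    have hτ' := interior_subset hτ
    rw [(hH τ hτ').deriv, mul_assoc, ← mul_add]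
    refine mul_nonpos_of_nonneg_of_nonpos (exp_pos _).le ?_
    have := hF τ hτ'
    have e : α * (F τ - β / α) = α * F τ - β := by field_simp
    rw [e]; linarith
  have h := anti ⟨le_rfl, hst.le⟩ ⟨hst.le, le_rfl⟩ hst.le
  simp only [sub_self, mul_zero, exp_zero, one_mul] at h
  have hx : 0 < α * (t - s) := mul_pos hα (by linarith)
  have he : α * (t - s) ≤ exp (α * (t - s)) := by linarith [add_one_le_exp (α * (t - s))]
  have hp := exp_pos (α * (t - s))
  have hb : 0 ≤ β / α := by positivity
  by_cases hc : F t - β / α ≤ 0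
  · have : 0 ≤ F s / (α * (t - s)) := by positivity
    linarith
  · push Not at hc
    have : α * (t - s) * (F t - β / α) ≤ F s := by
      calc _ ≤ exp (α * (t - s)) * (F t - β / α) := mul_le_mul_of_nonneg_right he hc.le
        _ ≤ F s - β / α := h
        _ ≤ F s := by linarith
    have := (le_div_iff₀ hx).2 (by linarith [mul_comm (α * (t - s)) (F t - β / α)] : (F t - β / α) * (α * (t - s)) ≤ F s)
    linarith

lemma time_deriv {g g' : ℝ → V3 → ℝ} {a b : ℝ} (H : TD g g' a b) {w w' w'' : ℝ → ℝ} (hw : Cvx w w' w'')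
    {η : V3 → ℝ} (cη : Continuous η) (sη : HasCompactSupport η) {t : ℝ} (ht : t ∈ Set.Ioo a b) :
    HasDerivAt (fun τ => ∫ v, (w (g τ v) * η v) ^ 2) (∫ v, g' t v * (2 * w (g t v) * w' (g t v)) * η v ^ 2) t := by
  obtain ⟨ε, hε, hball⟩ := Metric.isOpen_iff.1 isOpen_Ioo t ht
  have hcl : Metric.closedBall t (ε/2) ⊆ Set.Ioo a b := (Metric.closedBall_subset_ball (by linarith)).trans hball
  have cI : ContinuousOn (fun q : ℝ × V3 => g' q.1 q.2 * (2 * w (g q.1 q.2) * w' (g q.1 q.2)) * η q.2 ^ 2) (Set.Ioo a b ×ˢ Set.univ) := by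
    refine (H.c1.mul (((hw.cw.comp_continuousOn H.c0).const_mul 2 |>.mul (hw.cw'.comp_continuousOn H.c0)))).mul ?_
    exact ((cη.comp continuous_snd).pow 2).continuousOn
  have hK : IsCompact (Metric.closedBall t (ε/2) ×ˢ tsupport η) := (isCompact_closedBall _ _).prod sη
  obtain ⟨C, hC⟩ := hK.exists_bound_of_continuousOn (cI.mono (Set.prod_mono hcl (Set.subset_univ _)))
  have slice0 : ∀ τ ∈ Set.Ioo a b, Continuous (g τ) := fun τ hτ => by
    obtain ⟨φ, hφ⟩ := H.sch τ hτ
    rw [funext hφ]; exact φ.continuous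
  have slice1 : ∀ τ ∈ Set.Ioo a b, Continuous (g' τ) := fun τ hτ => by
    rw [← continuousOn_univ]
    exact H.c1.comp (continuous_const.prodMk continuous_id).continuousOn fun v _ => ⟨hτ, trivial⟩
  have cF : ∀ τ ∈ Set.Ioo a b, Continuous (fun v => (w (g τ v) * η v) ^ 2) := fun τ hτ =>
    ((hw.cw.comp (slice0 τ hτ)).mul cη).pow 2
  refine (hasDerivAt_integral_of_dominated_loc_of_deriv_le (F := fun τ v => (w (g τ v) * η v) ^ 2)
    (F' := fun τ v => g' τ v * (2 * w (g τ v) * w' (g τ v)) * η v ^ 2) (bound := (tsupport η).indicator fun _ => C)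
    (s := Metric.ball t (ε/2)) (Metric.ball_mem_nhds t (by linarith)) ?_ ?_ ?_ ?_ ?_ ?_).2
  · filter_upwards [isOpen_Ioo.mem_nhds ht] with τ hτ
    exact (cF τ hτ).aestronglyMeasurable
  · exact (cF t ht).integrable_of_hasCompactSupport (cs_of sη fun x hx => by simp [image_eq_zero_of_notMem_tsupport hx])
  · refine Continuous.aestronglyMeasurable ?_
    exact ((slice1 t ht).mul (((hw.cw.comp (slice0 t ht)).const_mul 2).mul (hw.cw'.comp (slice0 t ht)))).mul (cη.pow 2)
  · refine Filter.Eventually.of_forall fun v τ hτ => ?_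
    by_cases hv : v ∈ tsupport η
    · rw [Set.indicator_of_mem hv]
      exact hC (τ, v) ⟨Metric.ball_subset_closedBall hτ, hv⟩
    · rw [Set.indicator_of_notMem hv]; simp [image_eq_zero_of_notMem_tsupport hv]
  · rw [integrable_indicator_iff (isClosed_tsupport η).measurableSet]
    exact integrableOn_const (IsCompact.measure_lt_top sη).ne
  · refine Filter.Eventually.of_forall fun v τ hτ => ?_
    have hτ' := hcl (Metric.ball_subset_closedBall hτ)
    have h1 := (hw.d1 (g τ v)).comp τ (H.dv τ hτ' v)
    have h2 := (h1.mul_const (η v)).fun_pow 2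
    have e : (2:ℕ) * (w (g τ v) * η v) ^ (2 - 1) * (w' (g τ v) * g' τ v * η v) = g' τ v * (2 * w (g τ v) * w' (g τ v)) * η v ^ 2 := by
      norm_num; ring
    rw [← e]; exact h2

lemma wg_int {w w' w'' : ℝ → ℝ} (hw : Cvx w w' w'') (φ : SchwartzMap V3 ℝ) :
    Integrable (fun v => w (φ v) ^ 2) ∧ ∫ v, w (φ v) ^ 2 ≤ ∫ v, φ v ^ 2 := by
  have i4 : Integrable (fun v => φ v ^ 2) := (φ.memLp 2 volume).integrable_sq
  have hle : ∀ v, w (φ v) ^ 2 ≤ φ v ^ 2 := fun v => by rw [← sq_abs (φ v)]; exact pow_le_pow_left₀ (hw.n0 _) (hw.le _) 2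
  have i : Integrable (fun v => w (φ v) ^ 2) := i4.mono' ((hw.cw.comp φ.continuous).pow 2).aestronglyMeasurable
    (Filter.Eventually.of_forall fun v => by rw [Real.norm_eq_abs, abs_of_nonneg (sq_nonneg _)]; exact hle v)
  exact ⟨i, integral_mono i i4 hle⟩

theorem step {g g' : ℝ → V3 → ℝ} {a b : ℝ} (H : TD g g' a b) {w w' w'' : ℝ → ℝ} (hw : Cvx w w' w'')
    {α β M : ℝ} (hα : 0 < α) (hβ : 0 ≤ β) (hM : 0 ≤ M)
    (hyp : ∀ t ∈ Set.Ioo a b, ∀ η δ, Cut η δ → ∫ v, g' t v * (2 * w (g t v) * w' (g t v)) * η v ^ 2 ≤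
      -α * (∫ v, (w (g t v) * η v) ^ 2) + β + M * δ)
    {s t : ℝ} (hs : s ∈ Set.Ioo a b) (ht : t ∈ Set.Ioo a b) (hst : s < t) :
    ∫ v, w (g t v) ^ 2 ≤ (∫ v, w (g s v) ^ 2) / (α * (t - s)) + β / α := by
  obtain ⟨η, δ, hc, hδ, hη⟩ := exists_cut
  have hI : ∀ τ ∈ Set.Ioo a b, Integrable (fun v => w (g τ v) ^ 2) := fun τ hτ => by
    obtain ⟨φ, hφ⟩ := H.sch τ hτ
    simp only [hφ]; exact (wg_int hw φ).1
  have hle : ∀ n τ v, (w (g τ v) * η n v) ^ 2 ≤ w (g τ v) ^ 2 := fun n τ v => by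
    rw [mul_pow]
    exact mul_le_of_le_one_right (sq_nonneg _) (pow_le_one₀ ((hc n).nn v) ((hc n).le v))
  have hmeas : ∀ n, ∀ τ ∈ Set.Ioo a b, AEStronglyMeasurable (fun v => (w (g τ v) * η n v) ^ 2) volume := fun n τ hτ => by
    obtain ⟨φ, hφ⟩ := H.sch τ hτ
    simp only [hφ]
    exact (((hw.cw.comp φ.continuous).mul (hc n).sm.continuous).pow 2).aestronglyMeasurable
  have hs2 : ∀ n, ∫ v, (w (g s v) * η n v) ^ 2 ≤ ∫ v, w (g s v) ^ 2 := fun n =>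
    integral_mono_of_nonneg (Filter.Eventually.of_forall fun v => sq_nonneg _) (hI s hs) (Filter.Eventually.of_forall fun v => hle n s v)
  have hn : ∀ n, ∫ v, (w (g t v) * η n v) ^ 2 ≤ (∫ v, w (g s v) ^ 2) / (α * (t - s)) + (β + M * δ n) / α := fun n => by
    have sub : Set.Icc s t ⊆ Set.Ioo a b := fun τ hτ => ⟨hs.1.trans_le hτ.1, hτ.2.trans_lt ht.2⟩
    have := ode hst hα (add_nonneg hβ (mul_nonneg hM (hc n).d0)) (F := fun τ => ∫ v, (w (g τ v) * η n v) ^ 2)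
      (fun τ hτ => time_deriv H hw (hc n).sm.continuous (hc n).cs (sub hτ))
      (fun τ hτ => by have := hyp τ (sub hτ) _ _ (hc n); linarith) (integral_nonneg fun v => sq_nonneg _)
    refine this.trans (add_le_add_left ?_ _)
    exact div_le_div_of_nonneg_right (hs2 n) (mul_pos hα (by linarith)).le
  have l1 : Filter.Tendsto (fun n => ∫ v, (w (g t v) * η n v) ^ 2) Filter.atTop (nhds (∫ v, w (g t v) ^ 2)) := by
    refine tendsto_integral_of_dominated_convergence (fun v => w (g t v) ^ 2) (fun n => hmeas n t ht) (hI t ht)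
      (fun n => Filter.Eventually.of_forall fun v => by rw [Real.norm_eq_abs, abs_of_nonneg (sq_nonneg _)]; exact hle n t v)
      (Filter.Eventually.of_forall fun v => ?_)
    have := ((hη v).const_mul (w (g t v))).pow 2
    simpa using this
  have l2 : Filter.Tendsto (fun n => (∫ v, w (g s v) ^ 2) / (α * (t - s)) + (β + M * δ n) / α) Filter.atTop
      (nhds ((∫ v, w (g s v) ^ 2) / (α * (t - s)) + β / α)) := by
    have := ((hδ.const_mul M).const_add β).div_const α |>.const_add ((∫ v, w (g s v) ^ 2) / (α * (t - s)))
    simpa using this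
  exact le_of_tendsto_of_tendsto' l1 l2 hn

lemma td_of {f : ℝ → V3 → ℝ} {T : ℝ} (hf : SmoothRapidSolutionOn (Set.Icc 0 T) f) (σ c : ℝ) :
    TD (fun t v => σ * (f t v - c * muS v)) (fun t v => σ * landauRHS (f t) v) 0 T := by
  have hsub : Set.Ioo (0:ℝ) T ×ˢ (Set.univ : Set V3) ⊆ Set.Icc 0 T ×ˢ Set.univ := Set.prod_mono Set.Ioo_subset_Icc_self le_rfl
  have hop : IsOpen (Set.Ioo (0:ℝ) T ×ˢ (Set.univ : Set V3)) := isOpen_Ioo.prod isOpen_univ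
  have sm := hf.smooth.mono hsub
  have dv : ∀ t ∈ Set.Ioo 0 T, ∀ v, HasDerivAt (fun τ => f τ v) (landauRHS (f t) v) t := fun t ht v => hf.solves t (by rwa [interior_Icc]) v
  refine ⟨fun t ht v => ?_, ?_, ?_, fun t ht => ?_⟩
  · exact ((dv t ht v).sub_const _).const_mul σ
  · exact continuousOn_const.mul (sm.continuousOn.sub ((muS.continuous.comp continuous_snd).const_mul c).continuousOn)
  · refine continuousOn_const.mul ?_
    have h1 : ContinuousOn (fun q => fderiv ℝ (fun q : ℝ × V3 => f q.1 q.2) q ((1:ℝ), (0:V3))) (Set.Ioo (0:ℝ) T ×ˢ (Set.univ : Set V3)) :=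
      (sm.continuousOn_fderiv_of_isOpen hop (by simp)).clm_apply continuousOn_const
    refine h1.congr fun q hq => ?_
    have hd : DifferentiableAt ℝ (fun q : ℝ × V3 => f q.1 q.2) (q.1, q.2) := (sm.contDiffAt (hop.mem_nhds hq)).differentiableAt (by simp)
    have h2 : HasDerivAt (fun τ : ℝ => (τ, q.2)) ((1:ℝ), (0:V3)) q.1 := (hasDerivAt_id q.1).prodMk (hasDerivAt_const q.1 q.2)
    have h3 := hd.hasFDerivAt.comp_hasDerivAt q.1 h2
    exact (dv q.1 hq.1 q.2).unique h3
  · obtain ⟨φ, hφ⟩ := hf.schwartz t (Set.Ioo_subset_Icc_self ht)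
    refine ⟨σ • (φ - c • muS), fun v => ?_⟩
    simp [hφ]

end LL

namespace LL
open scoped ENNReal

/-- the weight `⟨v⟩^{9/2}` -/
def J9 (v : V3) : ℝ := √(jap v) ^ 9

lemma J9_eq (v : V3) : J9 v = jap v ^ ((9:ℝ)/2) := by
  unfold J9
  have : 0 ≤ jap v := by linarith [one_le_jap v]
  rw [Real.sqrt_eq_rpow, ← Real.rpow_natCast, ← Real.rpow_mul this]; norm_num
lemma J9_one (v : V3) : 1 ≤ J9 v := one_le_pow₀ (one_le_sqrt_jap v)
lemma J9_cont : Continuous J9 := (continuous_sqrt.comp jap_continuous).pow 9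
lemma J9_pos (v : V3) : 0 < J9 v := by linarith [J9_one v]

lemma wint (φ : SchwartzMap V3 ℝ) (m : ℝ) : Integrable (fun v => φ v ^ 2 * jap v ^ m) := by
  obtain ⟨n, hn⟩ := exists_nat_ge m
  have h0 := SchwartzMap.one_add_le_sup_seminorm_apply (𝕜 := ℝ) (m := (n + 4, 0)) le_rfl le_rfl φ
  set C := 2 ^ (n + 4, 0).1 * ((Finset.Iic (n + 4, 0)).sup fun m => SchwartzMap.seminorm ℝ m.1 m.2) φ with hC
  obtain ⟨D, hD0, hD⟩ := schw_sup φ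
  have h1 : Integrable (fun z : V3 => (1 + ‖z‖) ^ (-(4:ℝ))) := integrable_one_add_norm (by simp; norm_num)
  refine (h1.const_mul (D * C)).mono' ?_ (Filter.Eventually.of_forall fun v => ?_)
  · have : Continuous (fun v : V3 => jap v ^ m) := jap_continuous.rpow_const fun v => Or.inl (by linarith [one_le_jap v])
    exact ((φ.continuous.pow 2).mul this).aestronglyMeasurable
  · have hj := one_le_jap v
    have hp : (0:ℝ) < 1 + ‖v‖ := by positivity
    have a1 : jap v ^ m ≤ (1 + ‖v‖) ^ n := by
      calc jap v ^ m ≤ jap v ^ (n:ℝ) := Real.rpow_le_rpow_of_exponent_le hj hn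
        _ = jap v ^ n := Real.rpow_natCast _ _
        _ ≤ _ := pow_le_pow_left₀ (by linarith) (jap_le v) n
    have a2 := h0 v
    rw [norm_iteratedFDeriv_zero, Real.norm_eq_abs] at a2
    have a0 : 0 ≤ jap v ^ m := Real.rpow_nonneg (by linarith) _
    rw [Real.norm_of_nonneg (by positivity), Real.rpow_neg hp.le]
    have e : (1 + ‖v‖) ^ (4:ℝ) = (1 + ‖v‖) ^ 4 := by exact_mod_cast Real.rpow_natCast (1 + ‖v‖) 4
    rw [e, ← div_eq_mul_inv, le_div_iff₀ (by positivity)]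
    calc φ v ^ 2 * jap v ^ m * (1 + ‖v‖) ^ 4 = |φ v| * (jap v ^ m * (1 + ‖v‖) ^ 4 * |φ v|) := by rw [← sq_abs]; ring
      _ ≤ |φ v| * ((1 + ‖v‖) ^ n * (1 + ‖v‖) ^ 4 * |φ v|) := by gcongr
      _ = |φ v| * ((1 + ‖v‖) ^ (n + 4) * |φ v|) := by rw [pow_add]
      _ ≤ D * C := mul_le_mul (hD v) a2 (by positivity) hD0.le

lemma wint9 (φ : SchwartzMap V3 ℝ) : Integrable (fun v => φ v ^ 2 * J9 v) := by
  simp only [J9_eq]; exact wint φ _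

lemma far_int : Integrable (fun z : V3 => (J9 z)⁻¹) := by
  have h := integrable_rpow_neg_one_add_norm_sq (E := V3) (μ := volume) (r := 9/2) (by simp; norm_num)
  refine h.congr (Filter.Eventually.of_forall fun v => ?_)
  simp only [J9_eq, jap]
  rw [Real.sqrt_eq_rpow, ← Real.rpow_mul (by positivity), ← Real.rpow_neg (by positivity)]; norm_num

def nearf (z : V3) : ℝ := (Metric.ball (0:V3) 1).indicator (fun z => ‖z‖⁻¹ ^ 2) z

lemma nearf_nn (z : V3) : 0 ≤ nearf z := Set.indicator_nonneg (fun _ _ => by positivity) _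

lemma near_int : Integrable nearf := by
  unfold nearf
  rw [integrable_indicator_iff Metric.isOpen_ball.measurableSet]
  refine integrableOn_ball_of_norm_le_rpow (C := 1) (α := 2) (by simp) (by simp; norm_num) ?_ (by apply Measurable.aestronglyMeasurable; fun_prop)
  refine Filter.Eventually.of_forall fun z => ?_
  rw [Real.norm_of_nonneg (by positivity), Real.rpow_neg (norm_nonneg _), one_mul, inv_pow]
  norm_cast

lemma K0_le (i j : Fin 3) (z : V3) : |K0 i j z| ≤ ‖z‖⁻¹ := by
  rcases eq_or_ne z 0 with rfl | h
  · simp [K0]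
  have hz : 0 < ‖z‖ := norm_pos_iff.2 h
  have h1 : |z i * z j / ‖z‖ ^ 2| ≤ 1 := by
    rw [abs_div, abs_mul, abs_of_pos (by positivity : 0 < ‖z‖ ^ 2), div_le_one (by positivity), pow_two]
    exact mul_le_mul (abs_coord_le _ _) (abs_coord_le _ _) (abs_nonneg _) hz.le
  have h2 : |(if i = j then (1:ℝ) else 0)| ≤ 1 := by split_ifs <;> simp
  unfold K0
  rw [abs_div, abs_of_pos (by positivity : 0 < 8 * π * ‖z‖), inv_eq_one_div, div_le_div_iff₀ (by positivity) hz]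
  have h3 := (abs_sub (if i = j then (1:ℝ) else 0) (z i * z j / ‖z‖ ^ 2)).trans (add_le_add h2 h1)
  nlinarith [Real.pi_gt_three]

lemma AA_bound : ∃ CA : ℝ, 1 ≤ CA ∧ ∀ (g : SchwartzMap V3 ℝ) (N : ℝ), 0 < N → ∫ v, g v ^ 2 * J9 v ≤ N ^ 2 →
    ∀ i j v, |AA g i j v| ≤ CA * N := by
  set C1 := ∫ z : V3, (J9 z)⁻¹
  set C2 := ∫ z : V3, nearf z
  have hC1 : 0 ≤ C1 := integral_nonneg fun z => inv_nonneg.2 (J9_pos z).le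
  have hC2 : 0 ≤ C2 := integral_nonneg nearf_nn
  refine ⟨1 + C1 + C2, by linarith, fun g N hN hg i j v => ?_⟩
  have i1 : Integrable (fun z => g (v - z) ^ 2 * J9 (v - z)) := (wint9 g).comp_sub_left v
  have i2 : Integrable (fun z => (J9 (v - z))⁻¹) := far_int.comp_sub_left v
  have e1 : ∫ z, g (v - z) ^ 2 * J9 (v - z) = ∫ z, g z ^ 2 * J9 z := integral_sub_left_eq_self (fun z => g z ^ 2 * J9 z) volume v
  have e2 : ∫ z, (J9 (v - z))⁻¹ = C1 := integral_sub_left_eq_self (fun z => (J9 z)⁻¹) volume v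
  have key : ∀ z, ‖g (v - z) * K0 i j z‖ ≤ N⁻¹ * (g (v - z) ^ 2 * J9 (v - z)) + N * (J9 (v - z))⁻¹ + N * nearf z := by
    intro z
    rw [Real.norm_eq_abs, abs_mul]
    have hK := K0_le i j z
    have hJ := J9_one (v - z)
    have hJp := J9_pos (v - z)
    have hn := nearf_nn z
    have h3 : 0 ≤ N * (J9 (v - z))⁻¹ := by positivity
    by_cases hz : z ∈ Metric.ball (0:V3) 1
    · have e : nearf z = ‖z‖⁻¹ ^ 2 := Set.indicator_of_mem hz _
      have h1 : |g (v - z)| * |K0 i j z| ≤ |g (v - z)| * ‖z‖⁻¹ := by gcongr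
      have h2 : |g (v - z)| * ‖z‖⁻¹ ≤ N⁻¹ * |g (v - z)| ^ 2 + N * ‖z‖⁻¹ ^ 2 := by
        have : N⁻¹ * N = 1 := inv_mul_cancel₀ hN.ne'
        have h5 : 0 ≤ N⁻¹ * (|g (v - z)| - N * ‖z‖⁻¹) ^ 2 := by positivity
        have e5 : N⁻¹ * (|g (v - z)| - N * ‖z‖⁻¹) ^ 2 = N⁻¹ * |g (v - z)| ^ 2 - 2 * (N⁻¹ * N) * |g (v - z)| * ‖z‖⁻¹ + (N⁻¹ * N) * N * ‖z‖⁻¹ ^ 2 := by ring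
        rw [e5, this] at h5
        have : 0 ≤ |g (v - z)| * ‖z‖⁻¹ := by positivity
        linarith
      have h4 : N⁻¹ * |g (v - z)| ^ 2 ≤ N⁻¹ * (g (v - z) ^ 2 * J9 (v - z)) := by
        rw [sq_abs]
        exact mul_le_mul_of_nonneg_left (le_mul_of_one_le_right (sq_nonneg _) hJ) (by positivity)
      rw [e]; linarith
    · have hz' : 1 ≤ ‖z‖ := by simpa using hz
      have h1 : |g (v - z)| * |K0 i j z| ≤ |g (v - z)| :=
        mul_le_of_le_one_right (abs_nonneg _) (hK.trans (inv_le_one_of_one_le₀ hz'))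
      have h2 : |g (v - z)| ≤ N⁻¹ * (g (v - z) ^ 2 * J9 (v - z)) + N * (J9 (v - z))⁻¹ := by
        set a := |g (v - z)|
        set b := J9 (v - z)
        rw [← sq_abs]
        change a ≤ N⁻¹ * (a ^ 2 * b) + N * b⁻¹
        have ha : 0 ≤ a := abs_nonneg _
        have : N⁻¹ * (a ^ 2 * b) + N * b⁻¹ - a = ((a * b - N) ^ 2 + a * b * N) / (N * b) := by field_simp; ring
        have : 0 ≤ N⁻¹ * (a ^ 2 * b) + N * b⁻¹ - a := by rw [this]; positivity
        linarith
      have : 0 ≤ N * nearf z := by positivity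
      linarith
  have hI := ((i1.const_mul N⁻¹).add (i2.const_mul N)).add (near_int.const_mul N)
  have := norm_integral_le_of_norm_le hI (Filter.Eventually.of_forall key)
  have e := integral_add ((i1.const_mul N⁻¹).add (i2.const_mul N)) (near_int.const_mul N)
  have e' := integral_add (i1.const_mul N⁻¹) (i2.const_mul N)
  simp only [Pi.add_apply, integral_const_mul] at e e' this
  rw [e, e', e1, e2] at this
  refine this.trans ?_
  have : N⁻¹ * ∫ z, g z ^ 2 * J9 z ≤ N := by
    calc _ ≤ N⁻¹ * N ^ 2 := by gcongr
      _ = N := by field_simp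
  nlinarith

lemma FH_of {φ : SchwartzMap V3 ℝ} (h0 : ∀ v, 0 ≤ φ v) (hN : Normalized φ) {Sg : ℝ} (h1 : 1 ≤ Sg) (h2 : ∫ v, φ v ^ 2 ≤ Sg ^ 2) : FH φ Sg := by
  have iφ : Integrable φ := φ.integrable
  have i2 : Integrable (fun v => φ v ^ 2) := (φ.memLp 2 volume).integrable_sq
  have i3 : Integrable (fun v => ‖v‖ ^ 2 * φ v) := by
    have := φ.integrable_pow_mul volume 2
    refine this.congr (Filter.Eventually.of_forall fun v => ?_)
    simp only [Real.norm_eq_abs, abs_of_nonneg (h0 v)]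
  refine ⟨h0, φ.continuous, h1, ?_, ?_, ?_⟩
  · rw [← ofReal_integral_eq_lintegral_ofReal iφ (Filter.Eventually.of_forall h0), hN.1]; simp
  · rw [← ofReal_integral_eq_lintegral_ofReal iφ.integrableOn (Filter.Eventually.of_forall h0)]
    apply ENNReal.ofReal_le_ofReal
    have e := integral_add_compl (μ := volume) (f := φ) (s := Metric.ball 0 4) Metric.isOpen_ball.measurableSet iφ
    rw [hN.1] at e
    have : ∫ v in (Metric.ball 0 4)ᶜ, φ v ≤ 3/16 := by
      calc ∫ v in (Metric.ball 0 4)ᶜ, φ v ≤ ∫ v in (Metric.ball 0 4)ᶜ, (1/16) * (‖v‖ ^ 2 * φ v) := by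
            refine setIntegral_mono_on iφ.integrableOn (i3.const_mul _).integrableOn Metric.isOpen_ball.measurableSet.compl fun v hv => ?_
            have hv' : 4 ≤ ‖v‖ := by simpa using hv
            have : 16 ≤ ‖v‖ ^ 2 := by nlinarith
            nlinarith [h0 v]
        _ ≤ ∫ v, (1/16) * (‖v‖ ^ 2 * φ v) :=
            setIntegral_le_integral (i3.const_mul _) (Filter.Eventually.of_forall fun v => by have := h0 v; positivity)
        _ = 3/16 := by rw [integral_const_mul, hN.2.2]; norm_num
    linarith
  · rw [← ofReal_integral_eq_lintegral_ofReal i2 (Filter.Eventually.of_forall fun v => sq_nonneg _)]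
    exact ENNReal.ofReal_le_ofReal h2

lemma cheb {E : Set V3} (hE : MeasurableSet E) {h : V3 → ℝ} (hi : Integrable h) (h0 : ∀ v, 0 ≤ h v) {a F : ℝ} (ha : 0 < a)
    (hE2 : ∀ v ∈ E, a ≤ h v) (hF : ∫ v, h v ≤ F) : volume E ≤ ENNReal.ofReal (F / a) := by
  have h1 : ENNReal.ofReal a * volume E ≤ ENNReal.ofReal F := by
    calc ENNReal.ofReal a * volume E = ∫⁻ v in E, ENNReal.ofReal a := by simp
      _ ≤ ∫⁻ v in E, ENNReal.ofReal (h v) := setLIntegral_mono' hE fun v hv => ENNReal.ofReal_le_ofReal (hE2 v hv)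
      _ ≤ ∫⁻ v, ENNReal.ofReal (h v) := setLIntegral_le_lintegral _ _
      _ = ENNReal.ofReal (∫ v, h v) := (ofReal_integral_eq_lintegral_ofReal hi (Filter.Eventually.of_forall h0)).symm
      _ ≤ _ := ENNReal.ofReal_le_ofReal hF
  rw [ENNReal.ofReal_div_of_pos ha, ENNReal.le_div_iff_mul_le (Or.inl (by simpa using ha)) (Or.inl ENNReal.ofReal_ne_top), mul_comm]
  exact h1

lemma J9_cmp {x c : V3} (h : x ∈ Metric.ball c 1) : J9 c ≤ 32 * J9 x := by
  have h1 : jap c ≤ 2 * jap x := jap_le_two (by rw [← dist_eq_norm, dist_comm]; exact (Metric.mem_ball.1 h).le)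
  have h2 : √(jap c) ≤ √2 * √(jap x) := by rw [← Real.sqrt_mul (by norm_num)]; exact Real.sqrt_le_sqrt h1
  unfold J9
  calc _ ≤ (√2 * √(jap x)) ^ 9 := pow_le_pow_left₀ (Real.sqrt_nonneg _) h2 9
    _ = √2 ^ 9 * √(jap x) ^ 9 := mul_pow _ _ _
    _ ≤ _ := by
      gcongr
      have h3 : √2 ^ 2 = 2 := Real.sq_sqrt (by norm_num)
      have : √2 ^ 9 = (√2 ^ 2) ^ 4 * √2 := by ring
      rw [this, h3]
      have : √2 ≤ 2 := by rw [Real.sqrt_le_left (by norm_num)]; norm_num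
      linarith

lemma vol_wt {E : Set V3} (hE : MeasurableSet E) (g : SchwartzMap V3 ℝ) {a N : ℝ} (ha : 0 < a) (hE2 : ∀ v ∈ E, a ≤ g v)
    (hN : ∫ v, g v ^ 2 * J9 v ≤ N ^ 2) (c : V3) :
    volume (E ∩ Metric.ball c 1) ≤ ENNReal.ofReal (32 * N ^ 2 / (a ^ 2 * J9 c)) := by
  have := cheb (hE.inter Metric.isOpen_ball.measurableSet) (wint9 g) (fun v => mul_nonneg (sq_nonneg _) (J9_pos v).le)
    (a := a ^ 2 * J9 c / 32) (by have := J9_pos c; positivity) (E := E ∩ Metric.ball c 1) (fun v hv => ?_) hN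
  · refine this.trans (le_of_eq ?_)
    congr 1; have := J9_pos c; field_simp
  · have h1 := J9_cmp hv.2
    have h2 := hE2 v hv.1
    have h3 : a ^ 2 ≤ g v ^ 2 := pow_le_pow_left₀ ha.le h2 2
    have := J9_pos v
    calc a ^ 2 * J9 c / 32 ≤ a ^ 2 * (32 * J9 v) / 32 := by gcongr
      _ = a ^ 2 * J9 v := by ring
      _ ≤ _ := by gcongr

end LL

namespace LL
open scoped ENNReal

theorem DG {g g' : ℝ → V3 → ℝ} {a b : ℝ} (hab : a < b) (H : TD g g' a b) {l N θ A B : ℝ} (hl : 0 < l) (hθ : 0 < θ) (hθ1 : θ < 1)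
    (hA : 0 < A) (hB : 0 ≤ B) (hN : ∀ t ∈ Set.Ioo a b, ∫ v, g t v ^ 2 ≤ N ^ 2)
    (hcond : 8 / (b - a) + B ≤ A * θ)
    (hyp : ∀ k : ℕ, ∃ M, 0 ≤ M ∧ ∀ t ∈ Set.Ioo a b, ∫ v, wv l k (g t v) ^ 2 ≤ N ^ 2 * θ ^ k → ∀ η δ, Cut η δ →
      ∫ v, g' t v * (2 * wv l (k+1) (g t v) * wv' l (k+1) (g t v)) * η v ^ 2 ≤
      -(A * 4 ^ k) * (∫ v, (wv l (k+1) (g t v) * η v) ^ 2) + B * 2 ^ k * (N ^ 2 * θ ^ k) + M * δ) :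
    ∀ t ∈ Set.Ioo ((a + b) / 2) b, ∀ v, g t v ≤ l := by
  set τ := b - a with hτ
  have hτ0 : 0 < τ := sub_pos.2 hab
  let s : ℕ → ℝ := fun k => a + τ / 2 * (1 - (1/2) ^ k)
  have hs_a : ∀ k, a ≤ s k := fun k => by
    have : ((1:ℝ)/2) ^ k ≤ 1 := pow_le_one₀ (by norm_num) (by norm_num)
    have : 0 ≤ τ / 2 * (1 - (1/2) ^ k) := mul_nonneg (by linarith) (by linarith)
    simp only [s]; linarith
  have hs_m : ∀ k, s k ≤ (a + b) / 2 := fun k => by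
    have : (0:ℝ) < ((1:ℝ)/2) ^ k := by positivity
    simp only [s]; nlinarith
  have main : ∀ k : ℕ, ∀ t ∈ Set.Ioo (s k) b, ∫ v, wv l k (g t v) ^ 2 ≤ N ^ 2 * θ ^ k := by
    intro k
    induction k with
    | zero =>
      intro t ht
      have ht' : t ∈ Set.Ioo a b := ⟨(hs_a 0).trans_lt ht.1, ht.2⟩
      obtain ⟨φ, hφ⟩ := H.sch t ht'
      have := hN t ht'
      simp only [hφ] at this ⊢
      simpa using (wg_int (wv_cvx (k := 0) hl) φ).2.trans this
    | succ k ih =>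
      intro t ht
      obtain ⟨M, hM, hyp⟩ := hyp k
      have hq : (0:ℝ) < (1/2) ^ k := by positivity
      have e1 : s (k+1) = s k + τ / 4 * (1/2) ^ k := by simp only [s]; rw [pow_succ]; ring
      set r := s k + τ / 8 * (1/2) ^ k with hr
      have hq2 := mul_pos hτ0 hq
      have hr1 : s k < r := by linarith
      have hrt : τ / 8 * (1/2) ^ k ≤ t - r := by have := ht.1; rw [e1] at this; linarith
      have hrt' : r < t := by linarith
      have hr' : r ∈ Set.Ioo (s k) b := ⟨hr1, hrt'.trans ht.2⟩
      have ht' : t ∈ Set.Ioo (s k) b := ⟨hr1.trans hrt', ht.2⟩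
      have sub : Set.Ioo (s k) b ⊆ Set.Ioo a b := Set.Ioo_subset_Ioo (hs_a k) le_rfl
      have hβ : 0 ≤ B * 2 ^ k * (N ^ 2 * θ ^ k) := by positivity
      have hα : 0 < A * 4 ^ k := by positivity
      have st := step (H.sub (hs_a k) le_rfl) (wv_cvx (k := k+1) hl) hα hβ hM
        (fun t ht η δ hc => hyp t (sub ht) (ih t ht) η δ hc) hr' ht' hrt'
      refine st.trans ?_
      have hFr : ∫ v, wv l (k+1) (g r v) ^ 2 ≤ N ^ 2 * θ ^ k := by
        refine le_trans ?_ (ih r hr')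
        obtain ⟨φ, hφ⟩ := H.sch r (sub hr')
        simp only [hφ]
        exact integral_mono (wg_int (wv_cvx (k := k+1) hl) φ).1 (wg_int (wv_cvx (k := k) hl) φ).1
          fun v => pow_le_pow_left₀ (wv_nn hl _) (wv_succ_le hl _) 2
      have hX : 0 ≤ N ^ 2 * θ ^ k := by positivity
      set X := N ^ 2 * θ ^ k
      have h24 : (2:ℝ) ^ k ≤ 4 ^ k := pow_le_pow_left₀ (by norm_num) (by norm_num) k
      have e4 : (4:ℝ) ^ k * (1/2) ^ k = 2 ^ k := by rw [← mul_pow]; norm_num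
      have h1 : (∫ v, wv l (k+1) (g r v) ^ 2) / (A * 4 ^ k * (t - r)) ≤ X * (8 / τ / A) := by
        have h2 : A * τ / 8 ≤ A * 4 ^ k * (t - r) := by
          calc A * τ / 8 ≤ A * τ / 8 * 2 ^ k := le_mul_of_one_le_right (by positivity) (one_le_pow₀ (by norm_num))
            _ = A * 4 ^ k * (τ / 8 * (1/2) ^ k) := by rw [← e4]; ring
            _ ≤ _ := by gcongr
        calc _ ≤ X / (A * τ / 8) := div_le_div₀ hX hFr (by positivity) h2
          _ = _ := by field_simp
      have h2 : B * 2 ^ k * X / (A * 4 ^ k) ≤ X * (B / A) := by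
        rw [div_le_iff₀ hα]
        calc B * 2 ^ k * X ≤ B * 4 ^ k * X := by gcongr
          _ = _ := by field_simp
      have h3 : (8 / τ + B) / A ≤ θ := by rw [div_le_iff₀ hA]; linarith
      calc _ ≤ X * (8 / τ / A) + X * (B / A) := add_le_add h1 h2
        _ = X * ((8 / τ + B) / A) := by ring
        _ ≤ X * θ := by gcongr
        _ = _ := by simp only [X]; rw [pow_succ]; ring
  intro t ht v
  have ht' : t ∈ Set.Ioo a b := ⟨by linarith [ht.1], ht.2⟩
  obtain ⟨φ, hφ⟩ := H.sch t ht'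
  have c : Continuous (fun v => max 0 (φ v - l) ^ 2) := (continuous_const.max (φ.continuous.sub continuous_const)).pow 2
  have hle : ∀ k v, max 0 (φ v - l) ^ 2 ≤ wv l k (φ v) ^ 2 := fun k v =>
    pow_le_pow_left₀ (le_max_left _ _) (max_le (wv_nn hl _) (wv_ge_l hl _)) 2
  have hi : Integrable (fun v => max 0 (φ v - l) ^ 2) := (wg_int (wv_cvx (k := 0) hl) φ).1.mono' c.aestronglyMeasurable
    (Filter.Eventually.of_forall fun v => by rw [Real.norm_of_nonneg (sq_nonneg _)]; exact hle 0 v)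
  have h0 : ∫ v, max 0 (φ v - l) ^ 2 ≤ 0 := by
    have lim : Filter.Tendsto (fun k : ℕ => N ^ 2 * θ ^ k) Filter.atTop (nhds 0) := by
      simpa using (tendsto_pow_atTop_nhds_zero_of_lt_one hθ.le hθ1).const_mul (N ^ 2)
    refine ge_of_tendsto' lim fun k => ?_
    have := main k t ⟨(hs_m k).trans_lt ht.1, ht.2⟩
    simp only [hφ] at this
    exact (integral_mono hi (wg_int (wv_cvx (k := k) hl) φ).1 (hle k)).trans this
  have h1 : ∫ v, max 0 (φ v - l) ^ 2 = 0 := le_antisymm h0 (integral_nonneg fun v => sq_nonneg _)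
  have h2 := (integral_eq_zero_iff_of_nonneg (fun v => sq_nonneg _) hi).1 h1
  have h3 := (Continuous.ae_eq_iff_eq volume c continuous_const).1 h2
  have h4 := congrFun h3 v
  change max 0 (φ v - l) ^ 2 = 0 at h4
  have h5 : max 0 (φ v - l) = 0 := by simpa using h4
  rw [hφ]
  have := le_max_right 0 (φ v - l)
  linarith

end LL

namespace LL
open scoped ENNReal

def ABnd (CA : ℝ) : Prop := 1 ≤ CA ∧ ∀ (g : SchwartzMap V3 ℝ) (N : ℝ), 0 < N → ∫ v, g v ^ 2 * J9 v ≤ N ^ 2 →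
    ∀ i j v, |AA g i j v| ≤ CA * N

lemma dS_smul (σ : ℝ) (h : SchwartzMap V3 ℝ) (i : Fin 3) : dS i (σ • h) = σ • dS i h := by
  ext v
  rw [dS_apply, SchwartzMap.smul_apply, dS_apply]
  have e : ((σ • h : SchwartzMap V3 ℝ) : V3 → ℝ) = fun v => σ * h v := by ext v; simp
  unfold pd
  rw [e, fderiv_const_mul h.differentiableAt]; simp

lemma AA_smul (σ : ℝ) (h : SchwartzMap V3 ℝ) (i j : Fin 3) (v : V3) : AA (σ • h : SchwartzMap V3 ℝ) i j v = σ * AA h i j v := by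
  unfold AA Tk
  rw [← integral_const_mul]
  congr 1; ext z; simp; ring

lemma pert_s (φ g : SchwartzMap V3 ℝ) {σ : ℝ} (hg : ∀ v, g v = σ * (φ v - muS v)) (v : V3) :
    σ * landauRHS φ v = AD φ g v + (kap * φ v * g v + (∑ i, ∑ j, AA g i j v * dS i (dS j muS) v) + kap * muS v * g v) := by
  have e : g = σ • (φ - muS) := by ext v; rw [hg]; simp
  rw [pert_eq]
  unfold AD
  rw [e]
  simp only [dS_smul, AA_smul, SchwartzMap.smul_apply, SchwartzMap.sub_apply, smul_eq_mul, Fin.sum_univ_three]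
  ring

lemma AA_contS (g : SchwartzMap V3 ℝ) (h : Fin 3 → Fin 3 → V3 → ℝ) (hh : ∀ i j, Continuous (h i j)) :
    Continuous (fun v => ∑ i, ∑ j, AA g i j v * h i j v) :=
  continuous_finsetSum _ fun i _ => continuous_finsetSum _ fun j _ => (AA_cont g i j).mul (hh i j)

lemma sup_mu : ∃ Cm : ℝ, 0 ≤ Cm ∧ (∀ v, muS v ≤ Cm) ∧ ∀ i j v, |dS i (dS j muS) v| ≤ Cm := by
  obtain ⟨c0, h0, H0⟩ := schw_sup muS
  choose c h H using fun i j => schw_sup (dS i (dS j muS))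
  have hs : 0 ≤ ∑ i, ∑ j, c i j := Finset.sum_nonneg fun i _ => Finset.sum_nonneg fun j _ => (h i j).le
  refine ⟨c0 + ∑ i, ∑ j, c i j, by positivity, fun v => ?_, fun i j v => ?_⟩
  · have := (le_abs_self _).trans (H0 v); linarith
  · have a := Finset.single_le_sum (fun j _ => (h i j).le) (Finset.mem_univ j)
    have a2 := Finset.single_le_sum (fun i _ => Finset.sum_nonneg fun j (_ : j ∈ Finset.univ) => (h i j).le) (Finset.mem_univ i)
    linarith [H i j v]

lemma combine (φ g : SchwartzMap V3 ℝ) (h0 : ∀ v, 0 ≤ φ v) {w w' w'' : ℝ → ℝ} (hw : Cvx w w' w'') {η : V3 → ℝ} {δ M : ℝ} (hη : Cut η δ)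
    (hM : ∀ i j v, |AA φ i j v| ≤ M) {G R : V3 → ℝ} (hG : ∀ v, G v = AD φ g v + R v) (cR : Continuous R) :
    Integrable (fun v => R v * (2 * w (g v) * w' (g v)) * η v ^ 2) ∧
    ∫ v, G v * (2 * w (g v) * w' (g v)) * η v ^ 2 ≤
      -(1/2) * (∫ v, qf φ v (gr (fun v => w (g v) * η v) v)) - 1/2 * (∫ v, w' (g v) ^ 2 * η v ^ 2 * qf φ v (gr g v))
        + 126 * M * δ * (∫ v, g v ^ 2) + ∫ v, R v * (2 * w (g v) * w' (g v)) * η v ^ 2 := by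
  have cg := g.continuous
  have cη := hη.sm.continuous
  have i1 : ∀ F : V3 → ℝ, Continuous F → Integrable (fun v => F v * (2 * w (g v) * w' (g v)) * η v ^ 2) := fun F cF =>
    ((cF.mul (((hw.cw.comp cg).const_mul 2).mul (hw.cw'.comp cg))).mul (cη.pow 2)).integrable_of_hasCompactSupport
      (cs_of hη.cs fun x hx => by simp [image_eq_zero_of_notMem_tsupport hx])
  refine ⟨i1 R cR, ?_⟩
  have e : ∀ v, G v * (2 * w (g v) * w' (g v)) * η v ^ 2 = AD φ g v * (2 * w (g v) * w' (g v)) * η v ^ 2 + R v * (2 * w (g v) * w' (g v)) * η v ^ 2 :=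
    fun v => by rw [hG]; ring
  simp only [e]
  rw [integral_add (i1 _ (AD_cont φ g)) (i1 R cR)]
  exact add_le_add_left (energy_ineq φ g h0 hw hη hM) _

lemma vmin_s {W : ℝ≥0∞} {x0 P : ℝ} (hx : 0 ≤ x0) (hP : 0 ≤ P) (k : ℕ) (h1 : W ≤ ENNReal.ofReal (2 * x0 ^ 3 * 4 ^ k * ((1/4) ^ k) ^ 9))
    (h2 : W ≤ ENNReal.ofReal (2 * x0 ^ 3 * 4 ^ k * P ^ 9)) : W ≤ ENNReal.ofReal (2 * (x0 * (1/2) ^ k) ^ 3 * P ^ 5) := by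
  set q : ℝ := (1/4) ^ k with hq
  have hq0 : 0 < q := by positivity
  have e4 : (4:ℝ) ^ k * q = 1 := by rw [hq, ← mul_pow]; norm_num
  have e2 : ((1:ℝ)/2) ^ k * (1/2) ^ k = q := by rw [hq, ← mul_pow]; norm_num
  have h12 : ((1:ℝ)/2) ^ k ≤ 1 := pow_le_one₀ (by norm_num) (by norm_num)
  have h120 : (0:ℝ) < (1/2) ^ k := by positivity
  have fin : 2 * x0 ^ 3 * 4 ^ k * (q ^ 4 * P ^ 5) ≤ 2 * (x0 * (1/2) ^ k) ^ 3 * P ^ 5 := by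
    have : 2 * x0 ^ 3 * 4 ^ k * (q ^ 4 * P ^ 5) = 2 * x0 ^ 3 * P ^ 5 * (q ^ 3) := by
      calc _ = 2 * x0 ^ 3 * P ^ 5 * (q ^ 3) * (4 ^ k * q) := by ring
        _ = _ := by rw [e4]; ring
    rw [this, ← e2]
    have h3 : ((1:ℝ)/2) ^ k * (1/2) ^ k ≤ (1/2) ^ k := mul_le_of_le_one_right h120.le h12
    calc _ ≤ 2 * x0 ^ 3 * P ^ 5 * ((1/2) ^ k) ^ 3 := by gcongr
      _ = _ := by ring
  rcases le_total q P with h | h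
  · refine h1.trans (ENNReal.ofReal_le_ofReal (le_trans ?_ fin))
    have : q ^ 9 ≤ q ^ 4 * P ^ 5 := by
      calc q ^ 9 = q ^ 4 * q ^ 5 := by ring
        _ ≤ _ := by gcongr
    gcongr
  · refine h2.trans (ENNReal.ofReal_le_ofReal (le_trans ?_ fin))
    have : P ^ 9 ≤ q ^ 4 * P ^ 5 := by
      calc P ^ 9 = P ^ 4 * P ^ 5 := by ring
        _ ≤ _ := by gcongr
    gcongr

/-- common volume facts for level sets -/
lemma lev_vol (g : SchwartzMap V3 ℝ) {l N F : ℝ} (hl : 0 < l) (k : ℕ) (hN : ∫ v, g v ^ 2 * J9 v ≤ N ^ 2)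
    (hF : ∫ v, wv l k (g v) ^ 2 ≤ F) (c : V3) :
    volume ({v | lk l (k+1) < g v} ∩ Metric.ball c 1) ≤ ENNReal.ofReal (F * 64 * 4 ^ k / l ^ 2) ∧
    volume ({v | lk l (k+1) < g v} ∩ Metric.ball c 1) ≤ ENNReal.ofReal (128 * N ^ 2 / (l ^ 2 * J9 c)) := by
  have hm : MeasurableSet {v | lk l (k+1) < g v} := (isOpen_lt continuous_const g.continuous).measurableSet
  have he := ek_pos (k := k) hl
  constructor
  · refine (measure_mono Set.inter_subset_left).trans ?_
    have := cheb hm (wg_int (wv_cvx (k := k) hl) g).1 (fun v => sq_nonneg _) (pow_pos he 2)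
      (fun v hv => pow_le_pow_left₀ he.le (wv_prev_ge hl hv) 2) hF
    refine this.trans (le_of_eq ?_)
    congr 1
    unfold ek
    have h2 : ((1:ℝ)/2) ^ (k+3) = (1/2)^k / 8 := by rw [pow_add]; norm_num; ring
    have h4 : (4:ℝ) ^ k * ((1/2) ^ k) ^ 2 = 1 := by rw [← pow_mul, mul_comm k 2, pow_mul, ← mul_pow]; norm_num
    rw [h2, div_eq_div_iff (by positivity) (by positivity)]
    calc F * l ^ 2 = F * l ^ 2 * (4 ^ k * ((1/2) ^ k) ^ 2) := by rw [h4, mul_one]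
      _ = _ := by ring
  · have := vol_wt hm g (a := l/2) (by linarith) (fun v hv => (lk_half hl).trans (le_of_lt hv)) hN c
    refine this.trans (le_of_eq ?_)
    congr 1
    have := J9_pos c
    field_simp; ring

lemma alg_s {n Sg I Q : ℝ} (hn0 : 0 < n) (hSg : 0 < Sg) (k : ℕ) (h : I ≤ 10 ^ 17 * Sg ^ 2 * ((n ^ 2)⁻¹ * (1/2) ^ k) ^ 2 * Q) :
    (n ^ 4 / (2 * 10 ^ 17 * Sg ^ 2)) * 4 ^ k * I ≤ 1/2 * Q := by
  have h4 : (4:ℝ) ^ k * ((1/2) ^ k) ^ 2 = 1 := by rw [← pow_mul, mul_comm k 2, pow_mul, ← mul_pow]; norm_num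
  have hc : (0:ℝ) ≤ (n ^ 4 / (2 * 10 ^ 17 * Sg ^ 2)) * 4 ^ k := by positivity
  refine (mul_le_mul_of_nonneg_left h hc).trans (le_of_eq ?_)
  rw [mul_pow ((n ^ 2)⁻¹)]
  generalize ((1:ℝ)/2) ^ k = y at *
  generalize (4:ℝ) ^ k = z at *
  calc _ = (z * y ^ 2) * ((n ^ 4 / (2 * 10 ^ 17 * Sg ^ 2)) * (10 ^ 17 * Sg ^ 2 * ((n ^ 2)⁻¹) ^ 2 * Q)) := by ring
    _ = _ := by rw [h4]; field_simp

set_option maxHeartbeats 1000000 in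
theorem stat_s {φ g : SchwartzMap V3 ℝ} {Sg σ S Kf CA Cm n M : ℝ} (hf : FH φ Sg) (hS : 0 < S) (hn : 1 ≤ n) (hn2 : 800 * Sg ≤ n ^ 2)
    (hCA : ABnd CA) (hm1 : ∀ v, muS v ≤ Cm) (hm2 : ∀ i j v, |dS i (dS j muS) v| ≤ Cm) (hCm : 0 ≤ Cm)
    (hK : ∀ v, φ v ≤ Kf) (hg : ∀ v, g v = σ * (φ v - muS v)) (hgS : ∫ v, g v ^ 2 * J9 v ≤ S ^ 2) (hM : ∀ i j v, |AA φ i j v| ≤ M)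
    {k : ℕ} (hF : ∫ v, wv (8 * n ^ 3 * S) k (g v) ^ 2 ≤ S ^ 2 * ((1/4) ^ 9) ^ k) {η : V3 → ℝ} {δ : ℝ} (hη : Cut η δ) :
    ∫ v, (σ * landauRHS φ v) * (2 * wv (8 * n ^ 3 * S) (k+1) (g v) * wv' (8 * n ^ 3 * S) (k+1) (g v)) * η v ^ 2 ≤
      -((n ^ 4 / (2 * 10 ^ 17 * Sg ^ 2)) * 4 ^ k) * (∫ v, (wv (8 * n ^ 3 * S) (k+1) (g v) * η v) ^ 2)
        + (32 * (kap * Kf + kap * Cm + 9 * CA * Cm)) * 2 ^ k * (S ^ 2 * ((1/4) ^ 9) ^ k) + (126 * M * S ^ 2) * δ := by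
  set l := 8 * n ^ 3 * S with hl_def
  have hn0 : 0 < n := by linarith
  have hl : 0 < l := by positivity
  have hSl : S ≤ l := by
    rw [hl_def]; have : 1 ≤ n ^ 3 := one_le_pow₀ hn
    nlinarith
  have hk := kap_nonneg
  have hM0 : 0 ≤ M := (abs_nonneg _).trans (hM 0 0 0)
  have hSg := hf.one
  have h0 := hf.nn
  have hKf : 0 ≤ Kf := (h0 0).trans (hK 0)
  have hCA1 := hCA.1
  set R : V3 → ℝ := fun v => kap * φ v * g v + (∑ i, ∑ j, AA g i j v * dS i (dS j muS) v) + kap * muS v * g v with hR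
  have cR : Continuous R := ((((φ.continuous.const_mul kap).mul g.continuous)).add
    (AA_contS g (fun i j => dS i (dS j muS)) fun i j => (dS i (dS j muS)).continuous)).add ((muS.continuous.const_mul kap).mul g.continuous)
  have hw := wv_cvx (k := k+1) hl
  obtain ⟨iR, hc⟩ := combine φ g h0 hw hη hM (fun v => pert_s φ g hg v) cR
  have hg2 : ∫ v, g v ^ 2 ≤ S ^ 2 := le_trans (integral_mono ((g.memLp 2 volume).integrable_sq) (wint9 g)
    fun v => le_mul_of_one_le_right (sq_nonneg _) (J9_one v)) hgS
  -- static inequality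
  have hst : ∫ v, (wv l (k+1) (g v) * η v) ^ 2 ≤ 10 ^ 17 * Sg ^ 2 * ((n ^ 2)⁻¹ * (1/2) ^ k) ^ 2 *
      ∫ v, qf φ v (gr (fun v => wv l (k+1) (g v) * η v) v) := by
    have h12 : ((1:ℝ)/2) ^ k ≤ 1 := pow_le_one₀ (by norm_num) (by norm_num)
    refine rstatic_s φ hf ((hw.c1.comp (g.smooth 1)).mul (hη.sm.of_le (by norm_num)))
      (cs_of hη.cs fun x hx => by simp [image_eq_zero_of_notMem_tsupport hx])
      (E := {v | lk l (k+1) < g v}) (isOpen_lt continuous_const g.continuous).measurableSet ?_ (by positivity) ?_ fun c => ?_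
    · intro x hx
      by_contra hcon
      rw [Set.mem_ofPred_eq, not_lt] at hcon
      exact hx (by rw [wv_zero hl hcon, zero_mul])
    · calc 800 * Sg * ((n ^ 2)⁻¹ * (1/2) ^ k) ≤ 800 * Sg * ((n ^ 2)⁻¹ * 1) := by gcongr
        _ ≤ n ^ 2 * ((n ^ 2)⁻¹ * 1) := by gcongr
        _ = 1 := by field_simp
    · have hj : 0 < √(jap c) := by have := one_le_sqrt_jap c; linarith
      obtain ⟨v1, v2⟩ := lev_vol g hl k hgS hF c
      have := vmin_s (x0 := (n ^ 2)⁻¹) (P := (√(jap c))⁻¹) (by positivity) (by positivity) k (v1.trans (ENNReal.ofReal_le_ofReal ?_)) (v2.trans (ENNReal.ofReal_le_ofReal ?_))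
      · refine this.trans (le_of_eq ?_)
        rw [inv_pow, ← div_eq_mul_inv]
      · rw [← pow_mul, mul_comm 9 k, pow_mul, hl_def]
        have : S ^ 2 * ((1/4) ^ k) ^ 9 * 64 * 4 ^ k / (8 * n ^ 3 * S) ^ 2 = ((n ^ 2)⁻¹) ^ 3 * 4 ^ k * ((1/4) ^ k) ^ 9 := by
          field_simp; ring
        rw [this]
        have : 0 ≤ ((n ^ 2)⁻¹) ^ 3 * 4 ^ k * ((1/4) ^ k) ^ 9 := by positivity
        linarith
      · have : 128 * S ^ 2 / (l ^ 2 * J9 c) = 2 * ((n ^ 2)⁻¹) ^ 3 * 1 * ((√(jap c))⁻¹) ^ 9 := by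
          rw [hl_def]; unfold J9; field_simp; ring
        rw [this]
        gcongr
        exact one_le_pow₀ (by norm_num)
  -- reaction
  have hre : ∫ v, R v * (2 * wv l (k+1) (g v) * wv' l (k+1) (g v)) * η v ^ 2 ≤
      (32 * (kap * Kf + kap * Cm + 9 * CA * Cm)) * 2 ^ k * (S ^ 2 * ((1/4) ^ 9) ^ k) := by
    have hp : ∀ v, R v * (2 * wv l (k+1) (g v) * wv' l (k+1) (g v)) * η v ^ 2 ≤
        (32 * (kap * Kf + kap * Cm + 9 * CA * Cm)) * 2 ^ k * wv l k (g v) ^ 2 := by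
      intro v
      have hη0 := hη.nn v
      have hη1 : η v ^ 2 ≤ 1 := pow_le_one₀ hη0 (hη.le v)
      rcases le_or_gt (g v) (lk l (k+1)) with h | h
      · rw [wv_zero hl h]; simp; positivity
      have hgp : 0 < g v := (lk_pos hl).trans h
      have hW := wv_nn (k := k) hl (g v)
      have w1 := wv_nn (k := k+1) hl (g v)
      have w2 := wv_succ_le (k := k) hl (g v)
      have w3 := wv'_le (l := l) (k := k+1) (g v)
      have w3' := wv'_nn (l := l) (k := k+1) (g v)
      have w4 := wv_prev_ge hl h
      have w5 := wv_ge (k := k) hl (g v)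
      have w6 := lk_le (k := k) hl
      set W := wv l k (g v)
      have e8 : l ≤ 8 * 2 ^ k * W := by
        have : 8 * 2 ^ k * ek l k = l := by
          unfold ek; rw [pow_add]
          have : (2:ℝ) ^ k * (1/2) ^ k = 1 := by rw [← mul_pow]; norm_num
          calc _ = l * (2 ^ k * (1/2) ^ k) := by ring
            _ = l := by rw [this, mul_one]
        rw [← this]; gcongr
      have h2k : (1:ℝ) ≤ 2 ^ k := one_le_pow₀ (by norm_num)
      have e16 : g v ≤ 16 * 2 ^ k * W := by nlinarith
      have src : ∑ i, ∑ j, AA g i j v * dS i (dS j muS) v ≤ 9 * CA * Cm * S := by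
        have : ∀ i j, AA g i j v * dS i (dS j muS) v ≤ CA * S * Cm := fun i j => by
          refine (le_abs_self _).trans ?_
          rw [abs_mul]
          exact mul_le_mul (hCA.2 g S hS hgS i j v) (hm2 i j v) (abs_nonneg _) (by positivity)
        calc _ ≤ ∑ i : Fin 3, ∑ j : Fin 3, CA * S * Cm := Finset.sum_le_sum fun i _ => Finset.sum_le_sum fun j _ => this i j
          _ = _ := by simp; ring
      have hRv : R v ≤ (kap * Kf + kap * Cm + 9 * CA * Cm) * (16 * 2 ^ k * W) := by
        have a1 : kap * φ v * g v ≤ kap * Kf * (16 * 2 ^ k * W) := by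
          have := hK v; have := h0 v; gcongr
        have a2 : kap * muS v * g v ≤ kap * Cm * (16 * 2 ^ k * W) := by
          have := hm1 v; gcongr
        have a3 : 9 * CA * Cm * S ≤ 9 * CA * Cm * (16 * 2 ^ k * W) := by
          have : S ≤ 16 * 2 ^ k * W := by nlinarith
          gcongr
        simp only [hR]; linarith
      have hX : 0 ≤ (kap * Kf + kap * Cm + 9 * CA * Cm) * (16 * 2 ^ k * W) := by positivity
      have hww : 2 * wv l (k+1) (g v) * wv' l (k+1) (g v) ≤ 2 * W := by nlinarith
      have hww0 : 0 ≤ 2 * wv l (k+1) (g v) * wv' l (k+1) (g v) := by positivity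
      calc _ ≤ (kap * Kf + kap * Cm + 9 * CA * Cm) * (16 * 2 ^ k * W) * (2 * wv l (k+1) (g v) * wv' l (k+1) (g v)) * η v ^ 2 := by gcongr
        _ ≤ (kap * Kf + kap * Cm + 9 * CA * Cm) * (16 * 2 ^ k * W) * (2 * W) * 1 := by gcongr
        _ = _ := by ring
    have iW := (wg_int (wv_cvx (k := k) hl) g).1
    refine (integral_mono iR (iW.const_mul _) hp).trans ?_
    rw [integral_const_mul]
    gcongr
  have hq : 0 ≤ ∫ v, wv' l (k+1) (g v) ^ 2 * η v ^ 2 * qf φ v (gr g v) := integral_nonneg fun v => by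
    have := qf_nonneg φ h0 v (gr g v); positivity
  have hq2 : (n ^ 4 / (2 * 10 ^ 17 * Sg ^ 2)) * 4 ^ k * (∫ v, (wv l (k+1) (g v) * η v) ^ 2) ≤ 1/2 * ∫ v, qf φ v (gr (fun v => wv l (k+1) (g v) * η v) v) := by
    exact alg_s hn0 (by linarith) k hst
  have he : 126 * M * δ * (∫ v, g v ^ 2) ≤ 126 * M * S ^ 2 * δ := by
    have := hη.d0
    calc _ ≤ 126 * M * δ * S ^ 2 := by gcongr
      _ = _ := by ring
  linarith

end LL

namespace LL
open scoped ENNReal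

lemma qf_add2 (φ : V3 → ℝ) (h0 : ∀ v, 0 ≤ φ v) (hq : ∀ x ξ, 0 ≤ qf φ x ξ) (x ξ ζ : V3) (a b : ℝ) :
    qf φ x (a • ξ + b • ζ) ≤ 2 * a ^ 2 * qf φ x ξ + 2 * b ^ 2 * qf φ x ζ := by
  have h1 := qf_add φ x ξ ζ a b
  have h2 := qf_add φ x ξ ζ a (-b)
  have h3 := hq x (a • ξ + (-b) • ζ)
  rw [h2] at h3
  rw [h1]; nlinarith

/-- dyadic truncations -/
def Lj (l : ℝ) (j : ℕ) : ℝ := 2 ^ (j+1) * l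
def ps (L y : ℝ) : ℝ := L * th (y / L - 1)
def ps' (L y : ℝ) : ℝ := rr (y / L - 1)

lemma Lj_pos {l : ℝ} (hl : 0 < l) (j : ℕ) : 0 < Lj l j := by unfold Lj; positivity
lemma Lj_succ (l : ℝ) (j : ℕ) : Lj l (j+1) = 2 * Lj l j := by unfold Lj; rw [pow_succ]; ring
lemma Lj_ge {l : ℝ} (hl : 0 < l) (j : ℕ) : 2 * l ≤ Lj l j := by
  unfold Lj; rw [pow_succ]
  have : (1:ℝ) ≤ 2 ^ j := one_le_pow₀ (by norm_num)
  nlinarith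
lemma ps_d {L : ℝ} (hL : 0 < L) (y : ℝ) : HasDerivAt (ps L) (ps' L y) y := by
  have h := ((th_d (y / L - 1)).comp y (((hasDerivAt_id y).div_const L).sub_const 1)).const_mul L
  have e : L * (rr (y / L - 1) * (1 / L)) = ps' L y := by unfold ps'; field_simp
  rw [← e]; exact h
lemma ps'_cont {L : ℝ} : Continuous (ps' L) := rr_cont.comp (by fun_prop)
lemma ps_c1 {L : ℝ} (hL : 0 < L) : ContDiff ℝ 1 (ps L) := by
  rw [contDiff_one_iff_deriv]
  refine ⟨fun y => (ps_d hL y).differentiableAt, ?_⟩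
  have : deriv (ps L) = ps' L := funext fun y => (ps_d hL y).deriv
  rw [this]; exact ps'_cont
lemma ps_zero {L y : ℝ} (hL : 0 < L) (h : y ≤ L) : ps L y = 0 := by
  unfold ps; rw [th_neg, mul_zero]; rw [sub_nonpos, div_le_one hL]; exact h
lemma ps'_zero {L y : ℝ} (hL : 0 < L) (h : y ≤ L) : ps' L y = 0 := by
  unfold ps'; rw [rr_neg]; rw [sub_nonpos, div_le_one hL]; exact h
lemma ps'_zero2 {L y : ℝ} (hL : 0 < L) (h : 2 * L ≤ y) : ps' L y = 0 := by
  unfold ps'; rw [rr_big]; rw [le_sub_iff_add_le, le_div_iff₀ hL]; linarith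
lemma ps_big {L y : ℝ} (hL : 0 < L) (h : 2 * L ≤ y) : ps L y = L := by
  unfold ps; rw [th_big, mul_one]; rw [le_sub_iff_add_le, le_div_iff₀ hL]; linarith
lemma ps_nn {L : ℝ} (hL : 0 < L) (y : ℝ) : 0 ≤ ps L y := mul_nonneg hL.le (th_nn _)
lemma ps_le {L : ℝ} (hL : 0 < L) (y : ℝ) : ps L y ≤ L := mul_le_of_le_one_right hL.le (th_le _)
lemma ps'_nn (L y : ℝ) : 0 ≤ ps' L y := rr_nn _
lemma ps'_le (L y : ℝ) : ps' L y ≤ 3/2 := rr_le _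

lemma sum_ps_a {l : ℝ} (hl : 0 < l) (y : ℝ) (J : ℕ) : ∑ j ∈ Finset.range J, ps (Lj l j) y ^ 2 ≤ 1/3 * (Lj l J) ^ 2 := by
  induction J with
  | zero => simp; positivity
  | succ J ih =>
    rw [Finset.sum_range_succ, Lj_succ]
    have := pow_le_pow_left₀ (ps_nn (Lj_pos hl J) y) (ps_le (Lj_pos hl J) y) 2
    nlinarith

lemma sum_ps {l : ℝ} (hl : 0 < l) (y : ℝ) (J : ℕ) : ∑ j ∈ Finset.range J, ps (Lj l j) y ^ 2 ≤ 4/3 * y ^ 2 := by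
  induction J with
  | zero => simp; positivity
  | succ J ih =>
    rcases le_total y (Lj l J) with h | h
    · rw [Finset.sum_range_succ, ps_zero (Lj_pos hl J) h]; simpa using ih
    · have := sum_ps_a hl y (J+1)
      rw [Lj_succ] at this
      have := pow_le_pow_left₀ (Lj_pos hl J).le h 2
      nlinarith

lemma sum_ps'_zero {l : ℝ} (hl : 0 < l) {y : ℝ} (J : ℕ) (h : Lj l J ≤ y) : ∑ j ∈ Finset.range J, ps' (Lj l j) y ^ 2 = 0 := by
  induction J with
  | zero => simp
  | succ J ih =>
    rw [Lj_succ] at h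
    have := Lj_pos hl J
    rw [Finset.sum_range_succ, ih (by linarith), ps'_zero2 this h]; simp

lemma sum_ps' {l : ℝ} (hl : 0 < l) (y : ℝ) (J : ℕ) : ∑ j ∈ Finset.range J, ps' (Lj l j) y ^ 2 ≤ 9/4 := by
  induction J with
  | zero => simp; norm_num
  | succ J ih =>
    rw [Finset.sum_range_succ]
    rcases le_total y (Lj l J) with h | h
    · rw [ps'_zero (Lj_pos hl J) h]; simpa using ih
    · rw [sum_ps'_zero hl J h]
      have := pow_le_pow_left₀ (ps'_nn (Lj l J) y) (ps'_le (Lj l J) y) 2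
      linarith

lemma sum_ps'_wv {l : ℝ} (hl : 0 < l) (y : ℝ) (J k : ℕ) : ∑ j ∈ Finset.range J, ps' (Lj l j) y ^ 2 ≤ 9/4 * wv' l k y ^ 2 := by
  rcases le_total y l with h | h
  · have : ∑ j ∈ Finset.range J, ps' (Lj l j) y ^ 2 = 0 := Finset.sum_eq_zero fun j _ => by
      rw [ps'_zero (Lj_pos hl j) (by have := Lj_ge hl j; linarith)]; simp
    rw [this]; positivity
  · rw [wv'_one hl h]; simpa using sum_ps' hl y J

lemma exists_j {l : ℝ} (hl : 0 < l) {y : ℝ} (h : 4 * l < y) (J : ℕ) (hJ : y ≤ 2 * Lj l J) :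
    ∃ j ∈ Finset.range J, 2 * Lj l j ≤ y ∧ y ≤ 4 * Lj l j := by
  induction J with
  | zero => unfold Lj at hJ; norm_num at hJ; linarith
  | succ J ih =>
    rcases le_total y (2 * Lj l J) with h' | h'
    · obtain ⟨j, hj, H⟩ := ih h'
      exact ⟨j, Finset.mem_range.2 (by have := Finset.mem_range.1 hj; omega), H⟩
    · exact ⟨J, by simp, h', by rw [Lj_succ] at hJ; linarith⟩

lemma cube_le {l : ℝ} (hl : 0 < l) {y : ℝ} (h : 4 * l < y) (J : ℕ) (hJ : y ≤ 2 * Lj l J) :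
    y ^ 3 ≤ 64 * ∑ j ∈ Finset.range J, Lj l j * ps (Lj l j) y ^ 2 := by
  obtain ⟨j, hj, h1, h2⟩ := exists_j hl h J hJ
  have := Finset.single_le_sum (f := fun j => Lj l j * ps (Lj l j) y ^ 2) (fun j _ => mul_nonneg (Lj_pos hl j).le (sq_nonneg _)) hj
  rw [ps_big (Lj_pos hl j) h1] at this
  have h3 : y ^ 3 ≤ (4 * Lj l j) ^ 3 := pow_le_pow_left₀ (by linarith) h2 3
  nlinarith

lemma exists_J {l : ℝ} (hl : 0 < l) (K : ℝ) : ∃ J, K ≤ 2 * Lj l J := by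
  obtain ⟨J, hJ⟩ := pow_unbounded_of_one_lt (K / l) (one_lt_two)
  refine ⟨J, ?_⟩
  rw [div_lt_iff₀ hl] at hJ
  unfold Lj
  rw [pow_succ]
  have : 0 < 2 ^ J * l := by positivity
  linarith

lemma vmin_L {W : ℝ≥0∞} {x0 P c : ℝ} (hx : 0 ≤ x0) (hP : 0 ≤ P) (hc : 0 ≤ c) (k : ℕ) (h1 : W ≤ ENNReal.ofReal (2 * x0 ^ 5 * c * 4 ^ k * ((1/32) ^ k) ^ 3))
    (h2 : W ≤ ENNReal.ofReal (2 * x0 ^ 5 * c * 4 ^ k * P ^ 3)) : W ≤ ENNReal.ofReal (2 * (x0 * (1/2) ^ k) ^ 5 * c * P) := by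
  set q : ℝ := (1/32) ^ k with hq
  have hq0 : 0 < q := by positivity
  have e5 : (((1:ℝ)/2) ^ k) ^ 5 = q := by rw [hq, ← pow_mul, mul_comm k 5, pow_mul]; norm_num
  have e4 : (4:ℝ) ^ k * q ≤ 1 := by rw [hq, ← mul_pow]; exact pow_le_one₀ (by norm_num) (by norm_num)
  have fin : 2 * x0 ^ 5 * c * 4 ^ k * (q ^ 2 * P) ≤ 2 * (x0 * (1/2) ^ k) ^ 5 * c * P := by
    rw [mul_pow x0, e5]
    calc _ = 2 * (x0 ^ 5 * q) * c * P * (4 ^ k * q) := by ring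
      _ ≤ _ := mul_le_of_le_one_right (by positivity) e4
  rcases le_total q P with h | h
  · refine h1.trans (ENNReal.ofReal_le_ofReal (le_trans ?_ fin))
    have : q ^ 3 ≤ q ^ 2 * P := by
      calc q ^ 3 = q ^ 2 * q := by ring
        _ ≤ _ := by gcongr
    gcongr
  · refine h2.trans (ENNReal.ofReal_le_ofReal (le_trans ?_ fin))
    have : P ^ 3 ≤ q ^ 2 * P := by
      calc P ^ 3 = P ^ 2 * P := by ring
        _ ≤ _ := by gcongr
    gcongr

lemma alg_L {n l I Q : ℝ} (hn0 : 0 < n) (hl : 0 < l) (k : ℕ) (h : I ≤ 10 ^ 25 * (n⁻¹ * (1/2) ^ k) ^ 2 / l * Q) :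
    (l * n ^ 2 / (2 * 10 ^ 25)) * 4 ^ k * I ≤ 1/2 * Q := by
  have h4 : (4:ℝ) ^ k * ((1/2) ^ k) ^ 2 = 1 := by rw [← pow_mul, mul_comm k 2, pow_mul, ← mul_pow]; norm_num
  have hc : (0:ℝ) ≤ (l * n ^ 2 / (2 * 10 ^ 25)) * 4 ^ k := by positivity
  refine (mul_le_mul_of_nonneg_left h hc).trans (le_of_eq ?_)
  rw [mul_pow (n⁻¹)]
  generalize ((1:ℝ)/2) ^ k = y at *
  generalize (4:ℝ) ^ k = z at *
  calc _ = (z * y ^ 2) * ((l * n ^ 2 / (2 * 10 ^ 25)) * (10 ^ 25 * (n⁻¹) ^ 2 / l * Q)) := by ring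
    _ = _ := by rw [h4]; field_simp

lemma ps_int (φ : SchwartzMap V3 ℝ) {L : ℝ} (hL : 0 < L) {η : V3 → ℝ} {δ : ℝ} (hη : Cut η δ) :
    Integrable (fun v => ps L (φ v) ^ 2) ∧ Integrable (fun v => ps' L (φ v) ^ 2 * η v ^ 2 * qf φ v (gr φ v)) := by
  have c1 : ContDiff ℝ 1 (fun v => ps L (φ v)) := (ps_c1 hL).comp (φ.smooth 1)
  have ips : Integrable (fun v => ps L (φ v) ^ 2) := by
    have i4 : Integrable (fun v => φ v ^ 2) := (φ.memLp 2 volume).integrable_sq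
    refine i4.mono' (c1.continuous.pow 2).aestronglyMeasurable (Filter.Eventually.of_forall fun v => ?_)
    rw [Real.norm_of_nonneg (sq_nonneg _)]
    rcases le_total (φ v) L with h | h
    · rw [ps_zero hL h]; simp; positivity
    · exact pow_le_pow_left₀ (ps_nn hL _) ((ps_le hL _).trans h) 2
  have i3 : Integrable (fun v => ps' L (φ v) ^ 2 * η v ^ 2 * qf φ v (gr φ v)) :=
    ((((ps'_cont.comp φ.continuous).pow 2).mul (hη.sm.continuous.pow 2)).mul (qf_cont φ (gr_cont (φ.smooth 1)))).integrable_of_hasCompactSupport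
      (cs_of hη.cs fun x hx => by simp [image_eq_zero_of_notMem_tsupport hx])
  exact ⟨ips, i3⟩

/-- one dyadic level -/
lemma cub_j {φ : SchwartzMap V3 ℝ} {Sg n s M L : ℝ} (hf : FH φ Sg) (hn : 800 ≤ n) (hs : s = 64 * n ^ 5 * Sg ^ 2) (hLs : s ^ 2 ≤ L)
    (hS : ∫ v, φ v ^ 2 * J9 v ≤ Sg ^ 2) (hM : ∀ i j v, |AA φ i j v| ≤ M) {η : V3 → ℝ} {δ : ℝ} (hη : Cut η δ) :
    L * ∫ v, (ps L (φ v) * η v) ^ 2 ≤ 10 ^ 25 * (n⁻¹) ^ 2 * ∫ v, (2 * (ps' L (φ v) ^ 2 * η v ^ 2 * qf φ v (gr φ v)) + 18 * M * δ * ps L (φ v) ^ 2) := by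
  have hn0 : 0 < n := by linarith
  have hSg := hf.one
  have hs0 : 0 < s := by rw [hs]; positivity
  have hL : 0 < L := lt_of_lt_of_le (by positivity) hLs
  have h0 := hf.nn
  have hM0 : 0 ≤ M := (abs_nonneg _).trans (hM 0 0 0)
  have hsL : s ≤ √L := Real.le_sqrt_of_sq_le hLs
  have c1 : ContDiff ℝ 1 (fun v => ps L (φ v)) := (ps_c1 hL).comp (φ.smooth 1)
  have c1η : ContDiff ℝ 1 η := hη.sm.of_le (by norm_num)
  have cU : ContDiff ℝ 1 (fun v => ps L (φ v) * η v) := c1.mul c1η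
  have sU : HasCompactSupport (fun v => ps L (φ v) * η v) := cs_of hη.cs fun x hx => by simp [image_eq_zero_of_notMem_tsupport hx]
  have hE : MeasurableSet {v | L < φ v} := (isOpen_lt continuous_const φ.continuous).measurableSet
  have hst : ∫ v, (ps L (φ v) * η v) ^ 2 ≤ 10 ^ 25 * (n⁻¹) ^ 2 / L * ∫ v, qf φ v (gr (fun v => ps L (φ v) * η v) v) := by
    refine rstatic_L φ hf cU sU (E := {v | L < φ v}) hE ?_ (by positivity) ?_ ?_ ?_ fun c => ?_
    · intro x hx
      by_contra hcon
      rw [Set.mem_ofPred_eq, not_lt] at hcon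
      exact hx (by rw [ps_zero hL hcon, zero_mul])
    · rw [← div_eq_mul_inv, div_le_one hn0]; exact hn
    · refine le_trans ?_ hLs
      rw [hs]
      have : (1:ℝ) ≤ (64 * n ^ 5) := by
        have : (1:ℝ) ≤ n ^ 5 := one_le_pow₀ (by linarith)
        linarith
      calc Sg ^ 4 = (1 * Sg ^ 2) ^ 2 := by ring
        _ ≤ _ := by gcongr
    · intro x hx
      rw [Set.mem_ofPred_eq] at hx
      linarith
    · refine (vol_wt hE φ hL (fun v hv => le_of_lt hv) hS c).trans (ENNReal.ofReal_le_ofReal ?_)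
      have hj := one_le_sqrt_jap c
      have hj0 : 0 < √(jap c) := by linarith
      have hJ : √(jap c) ^ 3 ≤ J9 c := by unfold J9; exact pow_le_pow_right₀ hj (by norm_num)
      have e : L ^ 2 = √L ^ 3 * √L := by
        have := Real.sq_sqrt hL.le
        calc L ^ 2 = (√L ^ 2) ^ 2 := by rw [this]
          _ = _ := by ring
      have hsq : 0 < √L := Real.sqrt_pos.2 hL
      calc 32 * Sg ^ 2 / (L ^ 2 * J9 c) ≤ 32 * Sg ^ 2 / (√L ^ 3 * s * √(jap c) ^ 3) := by
            rw [e]; gcongr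
        _ = (1/2) * (n⁻¹) ^ 5 / (√L * √(jap c)) ^ 3 := by
            rw [hs]; have : Sg ≠ 0 := by positivity
            field_simp; norm_num
        _ ≤ _ := by gcongr; norm_num
  have hpt : ∀ v, qf φ v (gr (fun v => ps L (φ v) * η v) v) ≤ 2 * (ps' L (φ v) ^ 2 * η v ^ 2 * qf φ v (gr φ v)) + 18 * M * δ * ps L (φ v) ^ 2 := by
    intro v
    rw [gr_mul (c1.differentiable one_ne_zero v) (c1η.differentiable one_ne_zero v), gr_comp (ps_d hL) φ v, smul_smul]
    refine (qf_add2 φ h0 (qf_nonneg φ h0) v _ _ _ _).trans ?_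
    have hq := qf_abs_le (φ := φ) (x := v) (ξ := gr η v) (fun i j => hM i j v) (fun i => by rw [gr_apply]; exact hη.g1 i v)
    have hd0 := hη.d0
    have hd1 := hη.d1
    have h2 : qf φ v (gr η v) ≤ 9 * M * δ := hq.trans (by
      have : δ ^ 2 ≤ δ := by nlinarith
      gcongr)
    have h3 := mul_le_mul_of_nonneg_left h2 (show 0 ≤ 2 * ps L (φ v) ^ 2 by positivity)
    nlinarith
  have i2 := qf_integrable φ cU sU
  obtain ⟨ips, i3⟩ := ps_int φ hL hη
  have hmono := integral_mono i2 ((i3.const_mul 2).add (ips.const_mul (18 * M * δ))) hpt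
  have h5 := mul_le_mul_of_nonneg_left hst hL.le
  refine h5.trans ?_
  rw [← mul_assoc, mul_div_cancel₀ _ hL.ne']
  exact mul_le_mul_of_nonneg_left hmono (by positivity)

/-- all dyadic levels together -/
lemma cub_all {φ : SchwartzMap V3 ℝ} {Sg n s M : ℝ} (hf : FH φ Sg) (hn : 800 ≤ n) (hs : s = 64 * n ^ 5 * Sg ^ 2)
    (hS : ∫ v, φ v ^ 2 * J9 v ≤ Sg ^ 2) (hM : ∀ i j v, |AA φ i j v| ≤ M) {η : V3 → ℝ} {δ : ℝ} (hη : Cut η δ) (J k : ℕ) :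
    ∑ j ∈ Finset.range J, Lj (s ^ 2) j * (∫ v, (ps (Lj (s ^ 2) j) (φ v) * η v) ^ 2) ≤
      10 ^ 25 * (n⁻¹) ^ 2 * (9/2 * (∫ v, wv' (s ^ 2) k (φ v) ^ 2 * η v ^ 2 * qf φ v (gr φ v)) + 24 * M * δ * ∫ v, φ v ^ 2) := by
  have hn0 : 0 < n := by linarith
  have hSg := hf.one
  have hs0 : 0 < s := by rw [hs]; positivity
  have hl : 0 < s ^ 2 := by positivity
  have hM0 : 0 ≤ M := (abs_nonneg _).trans (hM 0 0 0)
  have hd := hη.d0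
  have i4 : Integrable (fun v => φ v ^ 2) := (φ.memLp 2 volume).integrable_sq
  have i5 : Integrable (fun v => wv' (s ^ 2) k (φ v) ^ 2 * η v ^ 2 * qf φ v (gr φ v)) :=
    (((((wv_cvx (k := k) hl).cw'.comp φ.continuous).pow 2).mul (hη.sm.continuous.pow 2)).mul (qf_cont φ (gr_cont (φ.smooth 1)))).integrable_of_hasCompactSupport
      (cs_of hη.cs fun x hx => by simp [image_eq_zero_of_notMem_tsupport hx])
  have ij : ∀ j, Integrable (fun v => 2 * (ps' (Lj (s ^ 2) j) (φ v) ^ 2 * η v ^ 2 * qf φ v (gr φ v)) + 18 * M * δ * ps (Lj (s ^ 2) j) (φ v) ^ 2) := fun j =>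
    ((ps_int φ (Lj_pos hl j) hη).2.const_mul 2).add ((ps_int φ (Lj_pos hl j) hη).1.const_mul _)
  calc _ ≤ ∑ j ∈ Finset.range J, 10 ^ 25 * (n⁻¹) ^ 2 * ∫ v, (2 * (ps' (Lj (s ^ 2) j) (φ v) ^ 2 * η v ^ 2 * qf φ v (gr φ v)) + 18 * M * δ * ps (Lj (s ^ 2) j) (φ v) ^ 2) :=
        Finset.sum_le_sum fun j _ => cub_j hf hn hs (by have := Lj_ge hl j; linarith) hS hM hη
    _ = 10 ^ 25 * (n⁻¹) ^ 2 * ∫ v, ∑ j ∈ Finset.range J, (2 * (ps' (Lj (s ^ 2) j) (φ v) ^ 2 * η v ^ 2 * qf φ v (gr φ v)) + 18 * M * δ * ps (Lj (s ^ 2) j) (φ v) ^ 2) := by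
        rw [integral_finsetSum _ fun j _ => ij j, Finset.mul_sum]
    _ ≤ 10 ^ 25 * (n⁻¹) ^ 2 * ∫ v, (9/2 * (wv' (s ^ 2) k (φ v) ^ 2 * η v ^ 2 * qf φ v (gr φ v)) + 24 * M * δ * φ v ^ 2) := by
        refine mul_le_mul_of_nonneg_left (integral_mono (integrable_finsetSum _ fun j _ => ij j) ((i5.const_mul _).add (i4.const_mul _)) fun v => ?_) (by positivity)
        simp only [Finset.sum_add_distrib, ← Finset.mul_sum, ← Finset.sum_mul]
        have a1 := sum_ps'_wv hl (φ v) J k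
        have a2 := sum_ps hl (φ v) J
        have hq := qf_nonneg φ hf.nn v (gr φ v)
        have b1 := mul_le_mul_of_nonneg_right a1 (show 0 ≤ η v ^ 2 * qf φ v (gr φ v) by positivity)
        have b2 := mul_le_mul_of_nonneg_left a2 (show 0 ≤ 18 * M * δ by positivity)
        simp only [mul_assoc] at b1 b2 ⊢
        linarith
    _ = _ := by
        rw [integral_add (i5.const_mul _) (i4.const_mul _), integral_const_mul, integral_const_mul]

end LL

namespace LL
open scoped ENNReal

lemma stat_L_lev {φ : SchwartzMap V3 ℝ} {Sg n s : ℝ} (hf : FH φ Sg) (hn : 800 ≤ n) (hs : s = 64 * n ^ 5 * Sg ^ 2)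
    (hS : ∫ v, φ v ^ 2 * J9 v ≤ Sg ^ 2)
    {k : ℕ} (hF : ∫ v, wv (s ^ 2) k (φ v) ^ 2 ≤ Sg ^ 2 * ((1/2) ^ 15) ^ k) {η : V3 → ℝ} {δ : ℝ} (hη : Cut η δ) :
    (s ^ 2 * n ^ 2 / (2 * 10 ^ 25)) * 4 ^ k * (∫ v, (wv (s ^ 2) (k+1) (φ v) * η v) ^ 2) ≤
      1/2 * ∫ v, qf φ v (gr (fun v => wv (s ^ 2) (k+1) (φ v) * η v) v) := by
  have hn0 : 0 < n := by linarith
  have hSg := hf.one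
  have hs0 : 0 < s := by rw [hs]; positivity
  have hl : 0 < s ^ 2 := by positivity
  have hSs : Sg ^ 2 ≤ s := by
    rw [hs]
    have : (1:ℝ) ≤ n ^ 5 := one_le_pow₀ (by linarith)
    nlinarith [sq_nonneg Sg]
  have hw := wv_cvx (k := k+1) hl
  refine alg_L hn0 hl k ?_
  have h12 : ((1:ℝ)/2) ^ k ≤ 1 := pow_le_one₀ (by norm_num) (by norm_num)
  refine rstatic_L φ hf ((hw.c1.comp (φ.smooth 1)).mul (hη.sm.of_le (by norm_num)))
    (cs_of hη.cs fun x hx => by simp [image_eq_zero_of_notMem_tsupport hx])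
    (E := {v | lk (s ^ 2) (k+1) < φ v}) (isOpen_lt continuous_const φ.continuous).measurableSet ?_ (by positivity) ?_ ?_ ?_ fun c => ?_
  · intro x hx
    by_contra hcon
    rw [Set.mem_ofPred_eq, not_lt] at hcon
    exact hx (by rw [Function.comp_apply, wv_zero hl hcon, zero_mul])
  · calc 800 * (n⁻¹ * (1/2) ^ k) ≤ n * (n⁻¹ * 1) := by gcongr
      _ = 1 := by field_simp
  · calc Sg ^ 4 = (Sg ^ 2) ^ 2 := by ring
      _ ≤ _ := by gcongr
  · intro x hx
    exact (lk_half hl).trans (le_of_lt hx)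
  · have hj : 0 < √(jap c) := by have := one_le_sqrt_jap c; linarith
    obtain ⟨v1, v2⟩ := lev_vol φ hl k hS hF c
    have hSg0 : Sg ≠ 0 := by positivity
    have es : 64 * Sg ^ 2 / (s ^ 2) ^ 2 = (n⁻¹) ^ 5 * (s ^ 3)⁻¹ := by
      have : s * (n⁻¹) ^ 5 = 64 * Sg ^ 2 := by rw [hs]; field_simp
      rw [← this]; field_simp
    have := vmin_L (x0 := n⁻¹) (P := (√(jap c) ^ 3)⁻¹) (c := (s ^ 3)⁻¹) (by positivity) (by positivity) (by positivity) k
      (v1.trans (ENNReal.ofReal_le_ofReal ?_)) (v2.trans (ENNReal.ofReal_le_ofReal ?_))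
    · refine this.trans (le_of_eq ?_)
      rw [Real.sqrt_sq hs0.le]
      congr 1
      rw [mul_pow s]; field_simp
    · rw [show ((1:ℝ)/2) ^ 15 = (1/32) ^ 3 by norm_num, ← pow_mul, mul_comm 3 k, pow_mul]
      have hz : 0 ≤ 64 * Sg ^ 2 / (s ^ 2) ^ 2 * (4 ^ k * ((1/32) ^ k) ^ 3) := by positivity
      calc _ = 64 * Sg ^ 2 / (s ^ 2) ^ 2 * (4 ^ k * ((1/32) ^ k) ^ 3) := by ring
        _ ≤ 2 * (64 * Sg ^ 2 / (s ^ 2) ^ 2 * (4 ^ k * ((1/32) ^ k) ^ 3)) := by linarith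
        _ = _ := by rw [es]; ring
    · have h4 : (1:ℝ) ≤ 4 ^ k := one_le_pow₀ (by norm_num)
      have hJ := J9_pos c
      calc 128 * Sg ^ 2 / ((s ^ 2) ^ 2 * J9 c) = 2 * (64 * Sg ^ 2 / (s ^ 2) ^ 2) * (√(jap c) ^ 9)⁻¹ * 1 := by
            unfold J9; field_simp; ring
        _ ≤ 2 * (64 * Sg ^ 2 / (s ^ 2) ^ 2) * (√(jap c) ^ 9)⁻¹ * 4 ^ k := by gcongr
        _ = _ := by rw [es, inv_pow (√(jap c) ^ 3), ← pow_mul]; ring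

lemma L_pt {l y h κ : ℝ} (hl : 0 < l) (hκ : 0 ≤ κ) (hy : 0 ≤ y) (h0 : 0 ≤ h) (h1 : h ≤ 1) (J k : ℕ) (hJ : y ≤ 2 * Lj l J) :
    (κ * y ^ 2) * (2 * wv l (k+1) y * wv' l (k+1) y) * h ^ 2 ≤
      256 * κ * l * 2 ^ k * wv l k y ^ 2 + 128 * κ * ∑ j ∈ Finset.range J, Lj l j * (ps (Lj l j) y * h) ^ 2 := by
  have hs : 0 ≤ ∑ j ∈ Finset.range J, Lj l j * (ps (Lj l j) y * h) ^ 2 :=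
    Finset.sum_nonneg fun j _ => mul_nonneg (Lj_pos hl j).le (sq_nonneg _)
  have hη1 : h ^ 2 ≤ 1 := pow_le_one₀ h0 h1
  have w1 := wv_nn (k := k+1) hl y
  have w2 := wv_succ_le (k := k) hl y
  have w3 := wv'_le (l := l) (k := k+1) y
  have w3' := wv'_nn (l := l) (k := k+1) y
  have hW := wv_nn (k := k) hl y
  rcases le_or_gt y (lk l (k+1)) with hh | hh
  · rw [wv_zero hl hh]
    have : 0 ≤ 256 * κ * l * 2 ^ k * wv l k y ^ 2 + 128 * κ * ∑ j ∈ Finset.range J, Lj l j * (ps (Lj l j) y * h) ^ 2 := by positivity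
    simpa using this
  rcases le_or_gt y (4 * l) with h4 | h4
  · have w4 := wv_prev_ge hl hh
    set W := wv l k y
    have e8 : l ≤ 8 * 2 ^ k * W := by
      have : 8 * 2 ^ k * ek l k = l := by
        unfold ek; rw [pow_add]
        have : (2:ℝ) ^ k * (1/2) ^ k = 1 := by rw [← mul_pow]; norm_num
        calc _ = l * (2 ^ k * (1/2) ^ k) := by ring
          _ = l := by rw [this, mul_one]
      rw [← this]; gcongr
    have hy2 : y ^ 2 ≤ 128 * l * 2 ^ k * W := by
      calc y ^ 2 = y * y := by ring
        _ ≤ (4 * l) * (4 * (8 * 2 ^ k * W)) := mul_le_mul h4 (h4.trans (by linarith)) hy (by positivity)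
        _ = _ := by ring
    have hww : 2 * wv l (k+1) y * wv' l (k+1) y ≤ 2 * W := by nlinarith
    have hww0 : 0 ≤ 2 * wv l (k+1) y * wv' l (k+1) y := by positivity
    have : (κ * y ^ 2) * (2 * wv l (k+1) y * wv' l (k+1) y) * h ^ 2 ≤ 256 * κ * l * 2 ^ k * W ^ 2 := by
      calc _ ≤ (κ * (128 * l * 2 ^ k * W)) * (2 * W) * 1 := by gcongr
        _ = _ := by ring
    have : 0 ≤ 128 * κ * ∑ j ∈ Finset.range J, Lj l j * (ps (Lj l j) y * h) ^ 2 := by positivity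
    linarith
  · have hc := cube_le hl h4 J hJ
    have wy : wv l (k+1) y ≤ y := by
      have := (wv_cvx (k := k+1) hl).le y
      rwa [abs_of_nonneg hy] at this
    have hww : 2 * wv l (k+1) y * wv' l (k+1) y ≤ 2 * y := by nlinarith
    have e : ∑ j ∈ Finset.range J, Lj l j * (ps (Lj l j) y * h) ^ 2 = (∑ j ∈ Finset.range J, Lj l j * ps (Lj l j) y ^ 2) * h ^ 2 := by
      rw [Finset.sum_mul]; exact Finset.sum_congr rfl fun j _ => by ring
    have : 0 ≤ 256 * κ * l * 2 ^ k * wv l k y ^ 2 := by positivity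
    rw [e]
    calc _ ≤ (κ * y ^ 2) * (2 * y) * h ^ 2 := by gcongr
      _ = 2 * κ * (y ^ 3) * h ^ 2 := by ring
      _ ≤ 2 * κ * (64 * ∑ j ∈ Finset.range J, Lj l j * ps (Lj l j) y ^ 2) * h ^ 2 := by gcongr
      _ = 128 * κ * ((∑ j ∈ Finset.range J, Lj l j * ps (Lj l j) y ^ 2) * h ^ 2) := by ring
      _ ≤ _ := by linarith

lemma L_fin {n Q Y κ c : ℝ} (hn0 : 0 < n) (hY : 0 ≤ Y) (hQ : 0 ≤ Q) (hn2 : 1152 * κ * 10 ^ 25 ≤ n ^ 2)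
    (h : c ≤ 128 * κ * (10 ^ 25 * (n⁻¹) ^ 2 * (9/2 * Q + 24 * Y))) : c ≤ 1/2 * Q + 3 * Y := by
  have e : 1152 * κ * 10 ^ 25 * (n⁻¹) ^ 2 ≤ 1 := by
    calc _ ≤ n ^ 2 * (n⁻¹) ^ 2 := by gcongr
      _ = 1 := by field_simp
  have h2 := mul_le_mul_of_nonneg_right e hQ
  have h3 := mul_le_mul_of_nonneg_right e hY
  nlinarith

theorem stat_L {φ : SchwartzMap V3 ℝ} {Sg n s M : ℝ} (hf : FH φ Sg) (hn : 800 ≤ n) (hn2 : 1152 * kap * 10 ^ 25 ≤ n ^ 2)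
    (hs : s = 64 * n ^ 5 * Sg ^ 2) (hS : ∫ v, φ v ^ 2 * J9 v ≤ Sg ^ 2) (hM : ∀ i j v, |AA φ i j v| ≤ M)
    {k : ℕ} (hF : ∫ v, wv (s ^ 2) k (φ v) ^ 2 ≤ Sg ^ 2 * ((1/2) ^ 15) ^ k) {η : V3 → ℝ} {δ : ℝ} (hη : Cut η δ) :
    ∫ v, landauRHS φ v * (2 * wv (s ^ 2) (k+1) (φ v) * wv' (s ^ 2) (k+1) (φ v)) * η v ^ 2 ≤
      -((s ^ 2 * n ^ 2 / (2 * 10 ^ 25)) * 4 ^ k) * (∫ v, (wv (s ^ 2) (k+1) (φ v) * η v) ^ 2)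
        + (256 * kap * s ^ 2) * 2 ^ k * (Sg ^ 2 * ((1/2) ^ 15) ^ k) + (129 * M * Sg ^ 2) * δ := by
  have hn0 : 0 < n := by linarith
  have hSg := hf.one
  have hs0 : 0 < s := by rw [hs]; positivity
  have hl : 0 < s ^ 2 := by positivity
  have hM0 : 0 ≤ M := (abs_nonneg _).trans (hM 0 0 0)
  have hk := kap_nonneg
  have hd := hη.d0
  have h0 := hf.nn
  have hw := wv_cvx (k := k+1) hl
  obtain ⟨iR, hc⟩ := combine φ φ h0 hw hη hM (G := landauRHS φ) (R := fun v => kap * φ v ^ 2) (fun v => landau_eq φ v)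
    ((φ.continuous.pow 2).const_mul kap)
  have h1 := stat_L_lev hf hn hs hS hF hη
  have hg2 : ∫ v, φ v ^ 2 ≤ Sg ^ 2 := le_trans (integral_mono ((φ.memLp 2 volume).integrable_sq) (wint9 φ)
    fun v => le_mul_of_one_le_right (sq_nonneg _) (J9_one v)) hS
  obtain ⟨K, hK0, hK⟩ := schw_sup φ
  obtain ⟨J, hJ⟩ := exists_J hl K
  have iW := (wg_int (wv_cvx (k := k) hl) φ).1
  have iU : ∀ j, Integrable (fun v => (ps (Lj (s ^ 2) j) (φ v) * η v) ^ 2) := fun j =>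
    ((((ps_c1 (Lj_pos hl j)).continuous.comp φ.continuous).mul hη.sm.continuous).pow 2).integrable_of_hasCompactSupport
      (cs_of hη.cs fun x hx => by simp [image_eq_zero_of_notMem_tsupport hx])
  have hre : ∫ v, (kap * φ v ^ 2) * (2 * wv (s ^ 2) (k+1) (φ v) * wv' (s ^ 2) (k+1) (φ v)) * η v ^ 2 ≤
      256 * kap * s ^ 2 * 2 ^ k * (∫ v, wv (s ^ 2) k (φ v) ^ 2) + 128 * kap * ∑ j ∈ Finset.range J, Lj (s ^ 2) j * (∫ v, (ps (Lj (s ^ 2) j) (φ v) * η v) ^ 2) := by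
    have iS : Integrable (fun v => ∑ j ∈ Finset.range J, Lj (s ^ 2) j * (ps (Lj (s ^ 2) j) (φ v) * η v) ^ 2) :=
      integrable_finsetSum _ fun j _ => (iU j).const_mul _
    refine (integral_mono iR ((iW.const_mul _).add (iS.const_mul _)) fun v =>
      L_pt hl hk (h0 v) (hη.nn v) (hη.le v) J k (((le_abs_self _).trans (hK v)).trans hJ)).trans (le_of_eq ?_)
    rw [integral_add' (iW.const_mul _) (iS.const_mul _), integral_const_mul, integral_const_mul, integral_finsetSum _ fun j _ => (iU j).const_mul _]
    simp only [integral_const_mul]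
  have hcub := cub_all hf hn hs hS hM hη J (k+1)
  have hQ : 0 ≤ ∫ v, wv' (s ^ 2) (k+1) (φ v) ^ 2 * η v ^ 2 * qf φ v (gr φ v) := integral_nonneg fun v => by
    have := qf_nonneg φ h0 v (gr φ v); positivity
  have hP : 0 ≤ ∫ v, φ v ^ 2 := integral_nonneg fun v => sq_nonneg _
  have hfin := L_fin hn0 (Y := M * δ * ∫ v, φ v ^ 2) (by positivity) hQ hn2
    ((mul_le_mul_of_nonneg_left hcub (show 0 ≤ 128 * kap by positivity)).trans (le_of_eq (by ring)))
  have hb : 256 * kap * s ^ 2 * 2 ^ k * (∫ v, wv (s ^ 2) k (φ v) ^ 2) ≤ 256 * kap * s ^ 2 * 2 ^ k * (Sg ^ 2 * ((1/2) ^ 15) ^ k) := by gcongr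
  have he : 129 * M * δ * (∫ v, φ v ^ 2) ≤ 129 * M * Sg ^ 2 * δ := by
    calc _ ≤ 129 * M * δ * Sg ^ 2 := by gcongr
      _ = _ := by ring
  linarith

end LL

namespace LL
open scoped ENNReal

lemma j9_l2 (φ : SchwartzMap V3 ℝ) {N : ℝ} (h : ∫ v, φ v ^ 2 * J9 v ≤ N ^ 2) : ∫ v, φ v ^ 2 ≤ N ^ 2 :=
  le_trans (integral_mono ((φ.memLp 2 volume).integrable_sq) (wint9 φ)
    fun v => le_mul_of_one_le_right (sq_nonneg _) (J9_one v)) h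

theorem thm_L : ∃ K : ℝ, 1 ≤ K ∧ ∀ (T : ℝ) (f : ℝ → V3 → ℝ), SmoothRapidSolutionOn (Set.Icc 0 T) f →
    (∀ t ∈ Set.Icc (0 : ℝ) T, Normalized (f t)) → ∀ a b Sg : ℝ, 0 ≤ a → b = a + 1 → b ≤ T → 1 ≤ Sg →
    (∀ t ∈ Set.Ioo a b, ∫ v, f t v ^ 2 * J9 v ≤ Sg ^ 2) → ∀ t ∈ Set.Ioo ((a + b) / 2) b, ∀ v, f t v ≤ K * Sg ^ 4 := by
  obtain ⟨CA, hCA, hAA⟩ := AA_bound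
  have hk := kap_nonneg
  obtain ⟨n, hn, hn2, hn3⟩ : ∃ n : ℝ, 800 ≤ n ∧ 1152 * kap * 10 ^ 25 ≤ n ^ 2 ∧ (8 + 256 * kap) * (2 * 10 ^ 25 * 2 ^ 15) ≤ n ^ 2 := by
    refine ⟨800 + 1152 * kap * 10 ^ 25 + (8 + 256 * kap) * (2 * 10 ^ 25 * 2 ^ 15), by linarith [show 0 ≤ 1152 * kap * 10 ^ 25 + (8 + 256 * kap) * (2 * 10 ^ 25 * 2 ^ 15) by positivity], ?_, ?_⟩
    · have h1 : 0 ≤ (8 + 256 * kap) * (2 * 10 ^ 25 * 2 ^ 15) := by positivity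
      have h2 : 0 ≤ 1152 * kap * 10 ^ 25 := by positivity
      nlinarith
    · have h1 : 0 ≤ (8 + 256 * kap) * (2 * 10 ^ 25 * 2 ^ 15) := by positivity
      have h2 : 0 ≤ 1152 * kap * 10 ^ 25 := by positivity
      nlinarith
  have hn0 : 0 < n := by linarith
  have h64 : 1 ≤ 64 * n ^ 5 := by
    have : (1:ℝ) ≤ n ^ 5 := one_le_pow₀ (by linarith)
    linarith
  refine ⟨(64 * n ^ 5) ^ 2, one_le_pow₀ h64, fun T f hf hN a b Sg ha hab hb hSg hL2 => ?_⟩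
  have hTD := (td_of hf 1 0).sub ha hb
  simp only [one_mul, zero_mul, sub_zero] at hTD
  set s := 64 * n ^ 5 * Sg ^ 2 with hs
  have hs1 : 1 ≤ s ^ 2 := one_le_pow₀ (by
    have : 1 ≤ Sg ^ 2 := one_le_pow₀ hSg
    rw [hs]; nlinarith)
  have hIcc : ∀ t ∈ Set.Ioo a b, t ∈ Set.Icc (0:ℝ) T := fun t ht => ⟨by linarith [ht.1], by linarith [ht.2]⟩
  have hSg0 : 0 < Sg := by linarith
  have main := DG (l := s ^ 2) (N := Sg) (θ := (1/2) ^ 15) (A := s ^ 2 * n ^ 2 / (2 * 10 ^ 25)) (B := 256 * kap * s ^ 2)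
    (by linarith) hTD (by linarith) (by norm_num) (by norm_num) (by positivity) (by positivity) ?_ ?_ ?_
  · intro t ht v
    refine (main t ht v).trans (le_of_eq ?_)
    rw [hs]; ring
  · intro t ht
    obtain ⟨φ, hφ⟩ := hf.schwartz t (hIcc t ht)
    have h := hL2 t ht
    simp only [hφ] at h ⊢
    exact j9_l2 φ h
  · have e : b - a = 1 := by linarith
    rw [e, div_one]
    calc 8 + 256 * kap * s ^ 2 ≤ (8 + 256 * kap) * s ^ 2 := by nlinarith
      _ = s ^ 2 * ((8 + 256 * kap) * (2 * 10 ^ 25 * 2 ^ 15)) / (2 * 10 ^ 25) * (1/2) ^ 15 := by ring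
      _ ≤ _ := by gcongr
  · intro k
    refine ⟨129 * (CA * Sg) * Sg ^ 2, by positivity, fun t ht hF η δ hη => ?_⟩
    obtain ⟨φ, hφ⟩ := hf.schwartz t (hIcc t ht)
    have e : f t = φ := funext hφ
    have h := hL2 t ht
    have hN' := hN t (hIcc t ht)
    have h0 := hf.nonneg t (hIcc t ht)
    rw [e] at h hN' h0 hF ⊢
    exact stat_L (FH_of h0 hN' hSg (j9_l2 φ h)) hn hn2 hs h (fun i j v => hAA φ Sg hSg0 h i j v) hF hη

theorem thm_s (Sg Kf : ℝ) (hSg : 1 ≤ Sg) (hKf : 0 ≤ Kf) : ∃ K : ℝ, 0 < K ∧ ∀ (T : ℝ) (f : ℝ → V3 → ℝ), SmoothRapidSolutionOn (Set.Icc 0 T) f →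
    (∀ t ∈ Set.Icc (0 : ℝ) T, Normalized (f t)) → ∀ a b S : ℝ, 0 ≤ a → b = a + 1/2 → b ≤ T → 0 < S →
    (∀ t ∈ Set.Ioo a b, ∫ v, f t v ^ 2 * J9 v ≤ Sg ^ 2) → (∀ t ∈ Set.Ioo a b, ∀ v, f t v ≤ Kf) →
    (∀ t ∈ Set.Ioo a b, ∫ v, (f t v - muS v) ^ 2 * J9 v ≤ S ^ 2) →
    ∀ t ∈ Set.Ioo ((a + b) / 2) b, ∀ v, |f t v - muS v| ≤ K * S := by
  obtain ⟨CA, hCA, hAA⟩ := AA_bound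
  obtain ⟨Cm, hCm, hm1, hm2⟩ := sup_mu
  have hk := kap_nonneg
  have hSg0 : 0 < Sg := by linarith
  set B := 32 * (kap * Kf + kap * Cm + 9 * CA * Cm) with hB
  have hB0 : 0 ≤ B := by positivity
  obtain ⟨n, hn, hn2, hn3⟩ : ∃ n : ℝ, 1 ≤ n ∧ 800 * Sg ≤ n ^ 2 ∧ (16 + B) * (2 * 10 ^ 17 * Sg ^ 2 * 4 ^ 9) ≤ n ^ 4 := by
    have h1 : 0 ≤ (16 + B) * (2 * 10 ^ 17 * Sg ^ 2 * 4 ^ 9) := by positivity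
    have h2 : 1 ≤ 1 + 800 * Sg + (16 + B) * (2 * 10 ^ 17 * Sg ^ 2 * 4 ^ 9) := by linarith
    refine ⟨1 + 800 * Sg + (16 + B) * (2 * 10 ^ 17 * Sg ^ 2 * 4 ^ 9), h2, ?_, ?_⟩
    · exact le_trans (by linarith) (le_self_pow₀ h2 two_ne_zero)
    · exact le_trans (by linarith) (le_self_pow₀ h2 four_ne_zero)
  have hn0 : 0 < n := by linarith
  refine ⟨8 * n ^ 3, by positivity, fun T f hf hN a b S ha hab hb hS hL2 hK hh => ?_⟩
  have hIcc : ∀ t ∈ Set.Ioo a b, t ∈ Set.Icc (0:ℝ) T := fun t ht => ⟨by linarith [ht.1], by linarith [ht.2]⟩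
  have key : ∀ σ : ℝ, σ ^ 2 = 1 → ∀ t ∈ Set.Ioo ((a + b) / 2) b, ∀ v, σ * (f t v - muS v) ≤ 8 * n ^ 3 * S := by
    intro σ hσ
    have hTD := (td_of hf σ 1).sub ha hb
    simp only [one_mul] at hTD
    have eg : ∀ t ∈ Set.Ioo a b, ∃ φ g : SchwartzMap V3 ℝ, f t = φ ∧ (∀ v, g v = σ * (f t v - muS v)) ∧ ∫ v, g v ^ 2 * J9 v ≤ S ^ 2 := by
      intro t ht
      obtain ⟨φ, hφ⟩ := hf.schwartz t (hIcc t ht)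
      have hg : ∀ v, (σ • (φ - muS) : SchwartzMap V3 ℝ) v = σ * (f t v - muS v) := fun v => by rw [hφ]; simp
      refine ⟨φ, σ • (φ - muS), funext hφ, hg, ?_⟩
      have := hh t ht
      simp only [hg, mul_pow, hσ, one_mul]
      exact this
    refine DG (l := 8 * n ^ 3 * S) (N := S) (θ := (1/4) ^ 9) (A := n ^ 4 / (2 * 10 ^ 17 * Sg ^ 2)) (B := B)
      (by linarith) hTD (by positivity) (by norm_num) (by norm_num) (by positivity) hB0 ?_ ?_ ?_
    · intro t ht
      obtain ⟨φ, g, h1, h2, h3⟩ := eg t ht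
      simp only [← h2]
      exact j9_l2 g h3
    · have e : b - a = 1/2 := by linarith
      rw [e]
      calc 8 / (1/2) + B = ((16 + B) * (2 * 10 ^ 17 * Sg ^ 2 * 4 ^ 9)) / (2 * 10 ^ 17 * Sg ^ 2) * (1/4) ^ 9 := by field_simp; ring
        _ ≤ _ := by gcongr
    · intro k
      refine ⟨126 * (CA * Sg) * S ^ 2, by positivity, fun t ht hF η δ hη => ?_⟩
      obtain ⟨φ, g, e, hg, h3⟩ := eg t ht
      have h := hL2 t ht
      have hN' := hN t (hIcc t ht)
      have h0 := hf.nonneg t (hIcc t ht)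
      have hK' := hK t ht
      rw [e] at h hN' h0 hK' hg
      simp only [e, ← hg] at hF ⊢
      exact stat_s (FH_of h0 hN' hSg (j9_l2 φ h)) hS hn hn2 ⟨hCA, hAA⟩ hm1 hm2 hCm hK' hg h3 (fun i j v => hAA φ Sg hSg0 h i j v) hF hη
  intro t ht v
  rw [abs_le]
  have h1 := key 1 (by norm_num) t ht v
  have h2 := key (-1) (by norm_num) t ht v
  constructor <;> linarith

lemma endT {T : ℝ} (hT : 1 ≤ T) {f : ℝ → V3 → ℝ} (hf : SmoothRapidSolutionOn (Set.Icc 0 T) f) (v : V3) {B : ℝ}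
    (h : ∀ t ∈ Set.Ioo (T - 1/4) T, |f t v - muS v| ≤ B) : |f T v - muS v| ≤ B := by
  have hc : ContinuousOn (fun t => f t v) (Set.Icc 0 T) :=
    hf.smooth.continuousOn.comp (f := fun t => (t, v)) (by fun_prop) fun t ht => ⟨ht, trivial⟩
  have h1 : ContinuousWithinAt (fun t => |f t v - muS v|) (Set.Ioo (T - 1/4) T) T :=
    (((hc T ⟨by linarith, le_rfl⟩).mono fun t ht => ⟨by linarith [ht.1], ht.2.le⟩).sub continuousWithinAt_const).abs
  haveI : (nhdsWithin T (Set.Ioo (T - 1/4) T)).NeBot := right_nhdsWithin_Ioo_neBot (by linarith)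
  exact le_of_tendsto h1 (eventually_nhdsWithin_of_forall h)

set_option maxHeartbeats 1000000 in
theorem main9 : ∃ C : ℝ, 0 < C ∧ ∀ T : ℝ, 1 ≤ T → ∀ f : ℝ → V3 → ℝ, SmoothRapidSolutionOn (Set.Icc 0 T) f →
    (∀ t ∈ Set.Icc (0 : ℝ) T, Normalized (f t)) → ∀ S : ℝ, 0 < S →
    (∀ t ∈ Set.Ioo (T - 1) T, ∫ v, (f t v - muS v) ^ 2 * J9 v ≤ S ^ 2) →
    ∀ v : V3, |f T v - muS v| ≤ C * (S ^ (4 : ℝ) + S ^ ((4 : ℝ) / 7)) := by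
  obtain ⟨K, hK, HL⟩ := thm_L
  obtain ⟨Cm, hCm, hm1, -⟩ := sup_mu
  set c := ∫ v, muS v ^ 2 * J9 v with hc
  have hc0 : 0 ≤ c := integral_nonneg fun v => mul_nonneg (sq_nonneg _) (J9_pos v).le
  set D := 2 + 2 * c with hD
  have hD1 : 1 ≤ D := by linarith
  obtain ⟨K2, hK2, Hs⟩ := thm_s D (K * D ^ 4) hD1 (by positivity)
  clear_value D
  have hmu0 : ∀ v, 0 ≤ muS v := fun v => by rw [muS_apply]; unfold maxwellian; positivity
  refine ⟨K * D ^ 4 + Cm + K2, by positivity, fun T hT f hf hN S hS hh v => ?_⟩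
  have hIcc : ∀ t ∈ Set.Ioo (T - 1) T, t ∈ Set.Icc (0:ℝ) T := fun t ht => ⟨by linarith [ht.1], by linarith [ht.2]⟩
  have hf2 : ∀ t ∈ Set.Ioo (T - 1) T, ∫ v, f t v ^ 2 * J9 v ≤ 2 * S ^ 2 + 2 * c := by
    intro t ht
    obtain ⟨φ, hφ⟩ := hf.schwartz t (hIcc t ht)
    have h := hh t ht
    simp only [hφ] at h ⊢
    have i1 : Integrable (fun v => (φ v - muS v) ^ 2 * J9 v) := by simpa using wint9 (φ - muS)
    have i2 := wint9 muS
    calc _ ≤ ∫ v, (2 * ((φ v - muS v) ^ 2 * J9 v) + 2 * (muS v ^ 2 * J9 v)) := by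
          refine integral_mono (wint9 φ) ((i1.const_mul 2).add (i2.const_mul 2)) fun v => ?_
          have : φ v ^ 2 ≤ 2 * (φ v - muS v) ^ 2 + 2 * muS v ^ 2 := by nlinarith [sq_nonneg (φ v - 2 * muS v)]
          have := mul_le_mul_of_nonneg_right this (J9_pos v).le
          simp only
          linarith
      _ = 2 * (∫ v, (φ v - muS v) ^ 2 * J9 v) + 2 * c := by
          rw [integral_add (i1.const_mul 2) (i2.const_mul 2), integral_const_mul, integral_const_mul]
      _ ≤ _ := by linarith
  have p4 : S ^ (4:ℝ) = S ^ 4 := by exact_mod_cast Real.rpow_natCast S 4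
  have q0 : 0 < S ^ ((4:ℝ)/7) := Real.rpow_pos_of_pos hS _
  have p0 : 0 < S ^ 4 := by positivity
  rw [p4]
  rcases le_or_gt 1 S with h1 | h1
  · have hS4 : 1 ≤ S ^ 4 := one_le_pow₀ h1
    have hDS : 1 ≤ D * S := by nlinarith
    have hb := HL T f hf hN (T - 1) T (D * S) (by linarith) (by ring) le_rfl hDS fun t ht => (hf2 t ht).trans (by
      rw [mul_pow]
      have : 1 ≤ S ^ 2 := one_le_pow₀ h1
      have h3 : D ≤ D ^ 2 := le_self_pow₀ hD1 two_ne_zero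
      have := mul_le_mul_of_nonneg_right h3 (sq_nonneg S)
      nlinarith)
    have : |f T v - muS v| ≤ (K * D ^ 4 + Cm) * S ^ 4 := by
      refine endT hT hf v fun t ht => ?_
      have h2 := hb t ⟨by linarith [ht.1], ht.2⟩ v
      have h3 := hf.nonneg t ⟨by linarith [ht.1], ht.2.le⟩ v
      have h4 := hmu0 v
      have h5 := hm1 v
      have h6 : 0 ≤ K * D ^ 4 * S ^ 4 := by positivity
      have h7 : Cm ≤ Cm * S ^ 4 := le_mul_of_one_le_right hCm hS4
      rw [mul_pow, ← mul_assoc] at h2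
      rw [abs_le, add_mul]
      constructor <;> linarith
    have h8 : 0 ≤ K * D ^ 4 + Cm := by positivity
    nlinarith [mul_nonneg h8 q0.le, mul_pos hK2 p0, mul_pos hK2 q0]
  · have hfD : ∀ t ∈ Set.Ioo (T - 1) T, ∫ v, f t v ^ 2 * J9 v ≤ D ^ 2 := fun t ht => (hf2 t ht).trans (by
      have : S ^ 2 ≤ 1 := pow_le_one₀ hS.le h1.le
      have h3 : D ≤ D ^ 2 := le_self_pow₀ hD1 two_ne_zero
      linarith)
    have hb := HL T f hf hN (T - 1) T D (by linarith) (by ring) le_rfl hD1 hfD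
    have hsub : Set.Ioo (T - 1/2) T ⊆ Set.Ioo (T - 1) T := Set.Ioo_subset_Ioo (by linarith) le_rfl
    have hb2 := Hs T f hf hN (T - 1/2) T S (by linarith) (by ring) le_rfl hS (fun t ht => hfD t (hsub ht))
      (fun t ht => hb t ⟨by linarith [ht.1], ht.2⟩) (fun t ht => hh t (hsub ht))
    have : |f T v - muS v| ≤ K2 * S := endT hT hf v fun t ht => hb2 t ⟨by linarith [ht.1], ht.2⟩ v
    have h9 : S ≤ S ^ ((4:ℝ)/7) := by
      have := Real.rpow_le_rpow_of_exponent_ge hS h1.le (show (4:ℝ)/7 ≤ 1 by norm_num)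
      rwa [Real.rpow_one] at this
    have h8 : 0 ≤ K * D ^ 4 + Cm := by positivity
    have h10 := mul_le_mul_of_nonneg_left h9 hK2.le
    nlinarith [mul_nonneg h8 q0.le, mul_nonneg h8 p0.le, mul_pos hK2 p0]

theorem final (m : ℝ) (hm : (9 : ℝ) / 2 ≤ m) :
    ∃ C : ℝ, 0 < C ∧
      ∀ T : ℝ, 1 ≤ T →
      ∀ f : ℝ → V3 → ℝ, SmoothRapidSolutionOn (Set.Icc 0 T) f →
        (∀ t ∈ Set.Icc (0 : ℝ) T, Normalized (f t)) →
        ∀ S : ℝ,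
          (∀ t ∈ Set.Ioo (T - 1) T,
            (∫ v : V3, (f t v - maxwellian v) ^ 2 * jap v ^ m) ^ ((1 : ℝ) / 2) ≤ S) →
          ∀ v : V3, |f T v - maxwellian v| ≤ C * (S ^ (4 : ℝ) + S ^ ((4 : ℝ) / 7)) := by
  obtain ⟨C, hC, H⟩ := main9
  refine ⟨C, hC, fun T hT f hf hN S hS v => ?_⟩
  have hS0 : 0 ≤ S := by
    refine le_trans ?_ (hS (T - 1/2) ⟨by linarith, by linarith⟩)
    refine Real.rpow_nonneg (integral_nonneg fun v => ?_) _
    have := one_le_jap v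
    positivity
  have key : ∀ S' ∈ Set.Ioi S, |f T v - maxwellian v| ≤ C * (S' ^ (4 : ℝ) + S' ^ ((4 : ℝ) / 7)) := by
    intro S' hS'
    have hS'0 : 0 < S' := lt_of_le_of_lt hS0 hS'
    refine H T hT f hf hN S' hS'0 (fun t ht => ?_) v
    have h1 := (hS t ht).trans (le_of_lt hS')
    obtain ⟨φ, hφ⟩ := hf.schwartz t ⟨by linarith [ht.1], ht.2.le⟩
    have i1 : Integrable (fun v => (f t v - muS v) ^ 2 * J9 v) := by
      simp only [hφ]; simpa using wint9 (φ - muS)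
    have i2 : Integrable (fun v => (f t v - muS v) ^ 2 * jap v ^ m) := by
      simp only [hφ]; simpa using wint (φ - muS) m
    have h2 : ∫ v, (f t v - muS v) ^ 2 * J9 v ≤ ∫ v, (f t v - muS v) ^ 2 * jap v ^ m :=
      integral_mono i1 i2 fun v => by
        simp only [J9_eq]
        exact mul_le_mul_of_nonneg_left (Real.rpow_le_rpow_of_exponent_le (one_le_jap v) hm) (sq_nonneg _)
    refine h2.trans ?_
    rw [← Real.sqrt_eq_rpow] at h1
    exact (Real.sqrt_le_left hS'0.le).1 h1
  have hcont : Continuous (fun x : ℝ => C * (x ^ (4:ℝ) + x ^ ((4:ℝ)/7))) :=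
    ((Real.continuous_rpow_const (by norm_num)).add (Real.continuous_rpow_const (by norm_num))).const_mul C
  exact ge_of_tendsto (hcont.continuousWithinAt (s := Set.Ioi S) (x := S)) (eventually_nhdsWithin_of_forall key)

end LL

/-- weighted `L²` convergence to the Maxwellian upgrades to `L^∞`. -/
theorem L2_to_Linfty_convergence
    (m : ℝ) (hm : (9 : ℝ) / 2 ≤ m) :
    ∃ C : ℝ, 0 < C ∧
      ∀ T : ℝ, 1 ≤ T →
      ∀ f : ℝ → V3 → ℝ, SmoothRapidSolutionOn (Set.Icc 0 T) f →
        (∀ t ∈ Set.Icc (0 : ℝ) T, Normalized (f t)) →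
        ∀ S : ℝ,
          (∀ t ∈ Set.Ioo (T - 1) T,
            (∫ v : V3, (f t v - maxwellian v) ^ 2 * jap v ^ m) ^ ((1 : ℝ) / 2) ≤ S) →
          ∀ v : V3, |f T v - maxwellian v| ≤ C * (S ^ (4 : ℝ) + S ^ ((4 : ℝ) / 7)) := by
  exact LL.final m hm
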